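/- Let d ≥ 3, α < d/2 and δ ∈ [0, d/(4α)). Then ℙ-almost surely, log P^ω₀(X_t = (⌊t^δ⌋, 0)) / log t → −r(d,α,δ) as t → ∞, where r(d,α,δ) = max(1/(2α), 1/2) + d/2 for δ ∈ [0, max(1/(2α), 1/2)], and r(d,α,δ) = δ(1+2α) − 1 + d/2 for δ ∈ (max(1/(2α), 1/2), d/(4α)). That is, P^ω₀(X_t = t^δ e₁) = t^{−r(d,α,δ)+o(1)}. -/

import Mathlib

open MeasureTheory ProbabilityTheory Filter Set

noncomputable section

/-- `n`-step transition probabilities of the discrete-time simple random walk on `ℤ^m`. -/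
def srwKernel (m : ℕ) : ℕ → (Fin m → ℤ) → (Fin m → ℤ) → ℝ
  | 0, x, y => if x = y then 1 else 0
  | n + 1, x, y =>
      (∑ i : Fin m, (srwKernel m n (Function.update x i (x i + 1)) y
        + srwKernel m n (Function.update x i (x i - 1)) y)) / (2 * m)

/-- Transition kernel of the continuous-time simple random walk on `ℤ^m` which jumps to
each of its `2m` nearest neighbours at rate `1` (total jump rate `2m`). -/
def heatKernel (m : ℕ) (t : ℝ) (x y : Fin m → ℤ) : ℝ :=
  ∑' n : ℕ, Real.exp (-(2 * m) * t) * ((2 * m) * t) ^ n / n.factorial * srwKernel m n x y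

/-- `(P, S)` is (a realization of) the continuous-time simple random walk on `ℤ^m`:
under `P x` the process `S` starts at `x`, has right-continuous (piecewise constant)
paths, and its finite-dimensional distributions are given by the heat kernel. -/
structure IsCTSRW (m : ℕ) {Ω : Type*} [MeasurableSpace Ω]
    (P : (Fin m → ℤ) → Measure Ω) (S : ℝ → Ω → (Fin m → ℤ)) : Prop where
  prob : ∀ x, IsProbabilityMeasure (P x)
  meas : Measurable fun p : ℝ × Ω => S p.1 p.2
  start : ∀ x, ∀ᵐ ω ∂ P x, S 0 ω = x
  rightCont : ∀ x, ∀ᵐ ω ∂ P x, ∀ t : ℝ, 0 ≤ t →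
    ∃ ε > (0 : ℝ), ∀ u, t ≤ u → u < t + ε → S u ω = S t ω
  fdd : ∀ x (n : ℕ) (t : Fin (n + 1) → ℝ), 0 ≤ t 0 →
    (∀ i : Fin n, t i.castSucc ≤ t i.succ) →
    ∀ y : Fin (n + 1) → (Fin m → ℤ),
      (P x {ω | ∀ i, S (t i) ω = y i}).toReal
        = heatKernel m (t 0) x (y 0)
          * ∏ i : Fin n, heatKernel m (t i.succ - t i.castSucc) (y i.castSucc) (y i.succ)

/-- `z` is an i.i.d. nonnegative random scenery on `ℤ^d` whose common upper tail decays
like `r^{-α+o(1)}`. -/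
structure IsScenery (d : ℕ) (α : ℝ) {Ω : Type*} [MeasurableSpace Ω]
    (μ : Measure Ω) (z : (Fin d → ℤ) → Ω → ℝ) : Prop where
  prob : IsProbabilityMeasure μ
  meas : ∀ x, Measurable (z x)
  nonneg : ∀ x ω, 0 ≤ z x ω
  indep : iIndepFun z μ
  ident : ∀ x, IdentDistrib (z x) (z 0) μ μ
  tail : Tendsto (fun r : ℝ => Real.log (μ {ω | r < z 0 ω}).toReal / Real.log r)
    atTop (nhds (-α))

/-- The random walk in random scenery `A(t) = ∫₀ᵗ z(S_u) du`. -/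
def rwrs {Ωz Ωw : Type*} (d : ℕ) (z : (Fin d → ℤ) → Ωz → ℝ)
    (S : ℝ → Ωw → (Fin d → ℤ)) (t : ℝ) (ζ : Ωz) (ω : Ωw) : ℝ :=
  ∫ u in Set.Ioc (0 : ℝ) t, z (S u ω) ζ

end
open MeasureTheory ProbabilityTheory Filter Set

noncomputable section

/-- The clock process `A²(t) = ∫₀ᵗ z(S²_u) du`, where `S²` is the second (ℤ^d-valued)
component of the walk on `ℤ^{1+d}`. -/
def clock (d : ℕ) {Ωz Ωw : Type*} (z : (Fin d → ℤ) → Ωz → ℝ)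
    (S : ℝ → Ωw → (Fin (d + 1) → ℤ)) (t : ℝ) (ζ : Ωz) (ω : Ωw) : ℝ :=
  ∫ u in Set.Ioc (0 : ℝ) t, z (fun i => S u ω i.succ) ζ

/-- The variable-speed random walk `X_t = (S¹_{A²(t)}, S²_t)` in the layered conductance
field `ω(x, x±e₁) = z(x₂)`, `ω(x, x±e_i) = 1` for `i ≥ 2` (coordinate `0` of the walk on
`ℤ^{1+d}` is the ℤ-coordinate, coordinates `1,…,d` form the ℤ^d-coordinate). -/
def layeredWalk (d : ℕ) {Ωz Ωw : Type*} (z : (Fin d → ℤ) → Ωz → ℝ)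
    (S : ℝ → Ωw → (Fin (d + 1) → ℤ)) (t : ℝ) (ζ : Ωz) (ω : Ωw) : ℤ × (Fin d → ℤ) :=
  (S (clock d z S t ζ ω) ω 0, fun i => S t ω i.succ)

/-- Euclidean norm of a point of `ℤ^{1+d} = ℤ × ℤ^d`. -/
def euclNormProd (d : ℕ) (x : ℤ × (Fin d → ℤ)) : ℝ :=
  Real.sqrt ((x.1 : ℝ) ^ 2 + ∑ i, (x.2 i : ℝ) ^ 2)

end

/-- The exponent `r(d,α,δ)` of the power-law decay regime of the layered random
conductance model. -/
noncomputable def rExp (d : ℕ) (α δ : ℝ) : ℝ :=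
  if δ ≤ max (1 / (2 * α)) (1 / 2) then max (1 / (2 * α)) (1 / 2) + d / 2
  else δ * (1 + 2 * α) - 1 + d / 2



namespace LRC

/-! ### The one-dimensional kernel and the product formula -/

/-- Fourier representation of the one-dimensional heat kernel. -/
noncomputable def h1 (s : ℝ) (k : ℤ) : ℝ :=
  (2 * Real.pi)⁻¹ * ∫ θ in (-Real.pi)..Real.pi,
    Real.exp (-(2 * s * (1 - Real.cos θ))) * Real.cos (k * θ)

/-- Normalised Lebesgue measure on `(-π, π]`. -/
noncomputable def lam : Measure ℝ :=
  (ENNReal.ofReal (2 * Real.pi)⁻¹) • volume.restrict (Set.Ioc (-Real.pi) Real.pi)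

lemma integral_lam (f : ℝ → ℂ) :
    ∫ θ, f θ ∂lam = (2 * Real.pi : ℂ)⁻¹ * ∫ θ in (-Real.pi)..Real.pi, f θ := by
  rw [lam, integral_smul_measure, intervalIntegral.integral_of_le (by linarith [Real.pi_pos])]
  rw [ENNReal.toReal_ofReal (by positivity)]
  simp

instance : IsProbabilityMeasure lam := by
  constructor
  have : (0:ℝ) < 2 * Real.pi := by positivity
  simp only [lam, Measure.smul_apply, Measure.restrict_apply MeasurableSet.univ, univ_inter,
    Real.volume_Ioc, smul_eq_mul]
  rw [← ENNReal.ofReal_mul (by positivity)]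
  rw [show (2 * Real.pi)⁻¹ * (Real.pi - -Real.pi) = 1 by field_simp; ring]
  simp

lemma integral_lam_h1 (s : ℝ) (k : ℤ) :
    ∫ θ, Complex.exp (-(2 * s * (1 - Real.cos θ)) : ℝ) * Complex.exp (Complex.I * k * θ) ∂lam
      = (h1 s k : ℂ) := by
  rw [integral_lam]
  have e : ∀ θ : ℝ, Complex.exp (-(2 * s * (1 - Real.cos θ)) : ℝ) * Complex.exp (Complex.I * k * θ)
      = ((Real.exp (-(2 * s * (1 - Real.cos θ))) * Real.cos (k * θ) : ℝ) : ℂ)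
        + Complex.I * ((Real.exp (-(2 * s * (1 - Real.cos θ))) * Real.sin (k * θ) : ℝ) : ℂ) := by
    intro θ
    have : Complex.I * k * θ = ((k * θ : ℝ) : ℂ) * Complex.I := by push_cast; ring
    rw [this, Complex.exp_mul_I]
    push_cast
    ring
  simp_rw [e]
  have hc : Continuous fun θ : ℝ => Real.exp (-(2 * s * (1 - Real.cos θ))) * Real.cos (k * θ) := by
    fun_prop
  have hs : Continuous fun θ : ℝ => Real.exp (-(2 * s * (1 - Real.cos θ))) * Real.sin (k * θ) := by
    fun_prop
  rw [intervalIntegral.integral_add, intervalIntegral.integral_const_mul,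
    intervalIntegral.integral_ofReal, intervalIntegral.integral_ofReal]
  · have odd : ∫ θ in (-Real.pi)..Real.pi,
        Real.exp (-(2 * s * (1 - Real.cos θ))) * Real.sin (k * θ) = 0 := by
      have := intervalIntegral.integral_comp_neg (a := -Real.pi) (b := Real.pi)
        (fun θ => Real.exp (-(2 * s * (1 - Real.cos θ))) * Real.sin (k * θ))
      simp only [Real.cos_neg, mul_neg, Real.sin_neg, neg_neg,
        intervalIntegral.integral_neg] at this
      linarith
    rw [odd, h1]
    push_cast
    ring
  · exact (Complex.continuous_ofReal.comp hc).intervalIntegrable _ _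
  · exact (continuous_const.mul (Complex.continuous_ofReal.comp hs)).intervalIntegrable _ _

lemma integral_lam_exp (k : ℤ) :
    ∫ θ, Complex.exp (Complex.I * k * θ) ∂lam = if k = 0 then 1 else 0 := by
  split_ifs with h
  · subst h; simp
  · rw [integral_lam]
    have hk : Complex.I * k ≠ 0 := by simp [h]
    rw [integral_exp_mul_complex hk]
    have : Complex.exp (Complex.I * k * (Real.pi : ℝ)) = Complex.exp (Complex.I * k * ((-Real.pi : ℝ) : ℂ)) := by
      rw [Complex.exp_eq_exp_iff_exists_int]
      exact ⟨k, by push_cast; ring⟩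
    rw [this]; simp

/-- The character. -/
noncomputable def chi (m : ℕ) (k : Fin m → ℤ) (θ : Fin m → ℝ) : ℂ :=
  ∏ i, Complex.exp (Complex.I * k i * θ i)

lemma chi_norm (m : ℕ) (k : Fin m → ℤ) (θ : Fin m → ℝ) : ‖chi m k θ‖ = 1 := by
  rw [chi, norm_prod]
  apply Finset.prod_eq_one
  intro i _
  rw [show Complex.I * k i * θ i = ((k i * θ i : ℝ) : ℂ) * Complex.I by push_cast; ring]
  exact Complex.norm_exp_ofReal_mul_I _

lemma chi_cont (m : ℕ) (k : Fin m → ℤ) : Continuous (chi m k) := by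
  unfold chi; fun_prop

lemma chi_update (m : ℕ) (x y : Fin m → ℤ) (i : Fin m) (c : ℤ) (θ : Fin m → ℝ) :
    chi m (fun j => y j - Function.update x i (x i + c) j) θ
      = Complex.exp (-(Complex.I * c * θ i)) * chi m (fun j => y j - x j) θ := by
  unfold chi
  rw [← Finset.mul_prod_erase Finset.univ _ (Finset.mem_univ i),
    ← Finset.mul_prod_erase Finset.univ (fun j => Complex.exp (Complex.I * ((y j - x j : ℤ):ℂ) * θ j))
      (Finset.mem_univ i), ← mul_assoc, ← Complex.exp_add]
  congr 1
  · congr 1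
    simp only [Function.update_self]
    push_cast; ring
  · apply Finset.prod_congr rfl
    intro j hj
    simp only [Function.update_of_ne (Finset.ne_of_mem_erase hj)]

/-- Average of cosines. -/
noncomputable def avc (m : ℕ) (θ : Fin m → ℝ) : ℝ := (∑ i, Real.cos (θ i)) / m

lemma avc_abs (m : ℕ) (θ : Fin m → ℝ) : |avc m θ| ≤ 1 := by
  unfold avc
  rw [abs_div, Nat.abs_cast]
  apply div_le_one_of_le₀ _ (by positivity)
  calc |∑ i, Real.cos (θ i)| ≤ ∑ i : Fin m, |Real.cos (θ i)| := Finset.abs_sum_le_sum_abs _ _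
    _ ≤ ∑ i : Fin m, (1:ℝ) := Finset.sum_le_sum fun i _ => Real.abs_cos_le_one _
    _ = m := by simp

lemma avc_cont (m : ℕ) : Continuous (avc m) := by
  unfold avc; fun_prop

lemma integrable_srw (m : ℕ) (k : Fin m → ℤ) (g : (Fin m → ℝ) → ℂ) (hg : Continuous g)
    (C : ℝ) (hC : ∀ θ, ‖g θ‖ ≤ C) :
    Integrable (fun θ => g θ * chi m k θ) (Measure.pi fun _ : Fin m => lam) := by
  apply Integrable.of_bound (C := C)
  · exact (hg.mul (chi_cont m k)).aestronglyMeasurable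
  · refine Eventually.of_forall fun θ => ?_
    rw [norm_mul, chi_norm, mul_one]; exact hC θ

lemma srw_fourier (m : ℕ) (hm : 0 < m) (n : ℕ) (x y : Fin m → ℤ) :
    (srwKernel m n x y : ℂ)
      = ∫ θ, ((avc m θ ^ n : ℝ) : ℂ) * chi m (fun j => y j - x j) θ
          ∂(Measure.pi fun _ : Fin m => lam) := by
  induction n generalizing x with
  | zero =>
    simp only [srwKernel, pow_zero, Complex.ofReal_one, one_mul, chi]
    rw [integral_fintype_prod_eq_prod (fun i (θ : ℝ) => Complex.exp (Complex.I * ((y i - x i : ℤ) : ℂ) * θ))]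
    simp_rw [integral_lam_exp]
    by_cases h : x = y
    · subst h; simp
    · rw [if_neg h]
      obtain ⟨i, hi⟩ := Function.ne_iff.mp h
      symm
      rw [Complex.ofReal_zero]
      apply Finset.prod_eq_zero (Finset.mem_univ i)
      rw [if_neg]; omega
  | succ n ih =>
    simp only [srwKernel]
    push_cast
    have hb : ∀ θ, ‖((avc m θ ^ n : ℝ) : ℂ)‖ ≤ 1 := by
      intro θ
      rw [Complex.norm_real, Real.norm_eq_abs, abs_pow]
      exact pow_le_one₀ (abs_nonneg _) (avc_abs m θ)
    have hcont : Continuous fun θ : Fin m → ℝ => ((avc m θ ^ n : ℝ) : ℂ) :=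
      Complex.continuous_ofReal.comp ((avc_cont m).pow n)
    have hi := fun k => integrable_srw m k _ hcont 1 hb
    simp_rw [ih]
    have e2 : ∀ i, (∫ θ, ((avc m θ ^ n : ℝ) : ℂ) * chi m (fun j => y j - Function.update x i (x i + 1) j) θ
          ∂(Measure.pi fun _ : Fin m => lam))
        + (∫ θ, ((avc m θ ^ n : ℝ) : ℂ) * chi m (fun j => y j - Function.update x i (x i - 1) j) θ
          ∂(Measure.pi fun _ : Fin m => lam))
        = ∫ θ, ((2 * Real.cos (θ i) * avc m θ ^ n : ℝ) : ℂ) * chi m (fun j => y j - x j) θ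
          ∂(Measure.pi fun _ : Fin m => lam) := by
      intro i
      rw [← integral_add (hi _) (hi _)]
      congr 1
      ext θ
      rw [chi_update, show x i - 1 = x i + (-1) by ring, chi_update]
      push_cast
      rw [Complex.cos]
      have e3 : Complex.exp (-(Complex.I * 1 * (θ i : ℂ))) = Complex.exp (-(θ i : ℂ) * Complex.I) := by
        congr 1; ring
      have e4 : Complex.exp (-(Complex.I * (-1) * (θ i : ℂ))) = Complex.exp ((θ i : ℂ) * Complex.I) := by
        congr 1; ring
      rw [e3, e4]
      ring
    rw [Finset.sum_congr rfl fun i _ => e2 i]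
    have hi2 : ∀ i ∈ (Finset.univ : Finset (Fin m)), Integrable
        (fun θ => ((2 * Real.cos (θ i) * avc m θ ^ n : ℝ) : ℂ) * chi m (fun j => y j - x j) θ)
        (Measure.pi fun _ : Fin m => lam) := by
      intro i _
      apply integrable_srw m _ _ _ 2
      · intro θ
        rw [Complex.norm_real, Real.norm_eq_abs, abs_mul, abs_mul, abs_pow]
        have h1 := pow_le_one₀ (n := n) (abs_nonneg _) (avc_abs m θ)
        have h2 := Real.abs_cos_le_one (θ i)
        have : |(2:ℝ)| = 2 := by norm_num
        rw [this]
        have := mul_le_one₀ h2 (by positivity) h1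
        linarith
      · apply Complex.continuous_ofReal.comp
        have := avc_cont m
        fun_prop
    rw [← integral_finsetSum _ hi2, ← integral_div]
    congr 1
    ext θ
    rw [← Finset.sum_mul, ← Complex.ofReal_sum, ← Finset.sum_mul, ← Finset.mul_sum]
    have hm' : (m : ℂ) ≠ 0 := by exact_mod_cast hm.ne'
    have : avc m θ * m = ∑ i, Real.cos (θ i) := by
      unfold avc; have : (m:ℝ) ≠ 0 := by exact_mod_cast hm.ne'
      field_simp
    rw [← this]
    push_cast
    field_simp
    ring

theorem heat_eq_prod (m : ℕ) (hm : 0 < m) (t : ℝ) (x y : Fin m → ℤ) :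
    heatKernel m t x y = ∏ i, h1 t (y i - x i) := by
  have key : ((heatKernel m t x y : ℝ) : ℂ) = ((∏ i, h1 t (y i - x i) : ℝ) : ℂ) := by
    unfold heatKernel
    rw [Complex.ofReal_tsum]
    set K := fun j => y j - x j with hK
    set F : ℕ → (Fin m → ℝ) → ℂ := fun n θ =>
      ((Real.exp (-(2 * m) * t) * ((2 * m) * t) ^ n / n.factorial : ℝ) : ℂ)
        * (((avc m θ ^ n : ℝ) : ℂ) * chi m K θ) with hF
    have e1 : ∀ n, ((Real.exp (-(2 * m) * t) * ((2 * m) * t) ^ n / n.factorial * srwKernel m n x y : ℝ) : ℂ)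
        = ∫ θ, F n θ ∂(Measure.pi fun _ : Fin m => lam) := by
      intro n
      rw [Complex.ofReal_mul, srw_fourier m hm, ← integral_const_mul]
    simp_rw [e1]
    have hb : ∀ n θ, ‖((avc m θ ^ n : ℝ) : ℂ) * chi m K θ‖ ≤ 1 := by
      intro n θ
      rw [norm_mul, chi_norm, mul_one, Complex.norm_real, Real.norm_eq_abs, abs_pow]
      exact pow_le_one₀ (abs_nonneg _) (avc_abs m θ)
    have hint : ∀ n, Integrable (F n) (Measure.pi fun _ : Fin m => lam) := by
      intro n
      apply Integrable.const_mul
      apply integrable_srw m _ _ _ 1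
      · intro θ
        have := hb n θ
        rwa [norm_mul, chi_norm, mul_one] at this
      · exact Complex.continuous_ofReal.comp ((avc_cont m).pow n)
    have hsum := hasSum_integral_of_summable_integral_norm hint ?_
    · rw [hsum.tsum_eq]
      have e5 : ∀ θ, ∑' n, F n θ = ∏ i, (Complex.exp (-(2 * t * (1 - Real.cos (θ i))) : ℝ)
          * Complex.exp (Complex.I * K i * θ i)) := by
        intro θ
        simp only [hF]
        rw [Finset.prod_mul_distrib, ← Complex.exp_sum]
        simp_rw [← mul_assoc]
        rw [tsum_mul_right]
        congr 1
        rw [← Complex.ofReal_sum, ← Complex.ofReal_exp]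
        have : ∀ n : ℕ, ((Real.exp (-(2 * m) * t) * ((2 * m) * t) ^ n / n.factorial : ℝ) : ℂ) * ((avc m θ ^ n : ℝ) : ℂ)
            = ((Real.exp (-(2 * m) * t) * ((2 * m * t * avc m θ) ^ n / n.factorial) : ℝ) : ℂ) := by
          intro n; push_cast; ring
        simp_rw [this]
        rw [← Complex.ofReal_tsum, tsum_mul_left, Complex.ofReal_inj]
        have hx := (NormedSpace.expSeries_div_hasSum_exp (2 * m * t * avc m θ)).tsum_eq
        rw [hx, ← Real.exp_eq_exp_ℝ, ← Real.exp_add]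
        congr 1
        rw [Finset.sum_neg_distrib, ← Finset.mul_sum, Finset.sum_sub_distrib]
        unfold avc
        have : (m:ℝ) ≠ 0 := by exact_mod_cast hm.ne'
        simp
        field_simp
        ring
      simp_rw [e5]
      rw [integral_fintype_prod_eq_prod (fun i (θ : ℝ) => Complex.exp (-(2 * t * (1 - Real.cos θ)) : ℝ)
          * Complex.exp (Complex.I * K i * θ))]
      simp_rw [integral_lam_h1]
      push_cast
      rfl
    · have hs : Summable fun n : ℕ => Real.exp (-(2 * m) * t) * (|2 * m * t| ^ n / n.factorial) :=
        (NormedSpace.expSeries_div_hasSum_exp (|2 * m * t|)).summable.mul_left _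
      apply Summable.of_nonneg_of_le _ _ hs
      · intro n; positivity
      · intro n
        have : ∀ θ, ‖F n θ‖ ≤ Real.exp (-(2 * m) * t) * (|2 * m * t| ^ n / n.factorial) := by
          intro θ
          simp only [hF]
          rw [norm_mul, Complex.norm_real, Real.norm_eq_abs, abs_div, abs_mul, abs_pow,
            Real.abs_exp, Nat.abs_cast]
          calc _ ≤ Real.exp (-(2 * m) * t) * |2 * m * t| ^ n / n.factorial * 1 := by
                gcongr; exact hb n θ
            _ = _ := by ring
        have := norm_integral_le_of_norm_le_const (μ := Measure.pi fun _ : Fin m => lam)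
          (f := fun θ => ‖F n θ‖) (C := Real.exp (-(2 * m) * t) * (|2 * m * t| ^ n / n.factorial))
          (Eventually.of_forall fun θ => by simpa using this θ)
        simp only [probReal_univ, mul_one] at this
        exact (le_abs_self _).trans this
  exact_mod_cast key

end LRC


namespace LRC

/-! ### Elementary properties of the kernels -/

lemma srw_nonneg (m n : ℕ) (x y : Fin m → ℤ) : 0 ≤ srwKernel m n x y := by
  induction n generalizing x with
  | zero => simp only [srwKernel]; split_ifs <;> norm_num
  | succ n ih =>
    simp only [srwKernel]
    apply div_nonneg _ (by positivity)
    exact Finset.sum_nonneg fun i _ => add_nonneg (ih _) (ih _)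

lemma srw_hasSum (m : ℕ) (hm : 0 < m) (n : ℕ) (x : Fin m → ℤ) :
    HasSum (fun y => srwKernel m n x y) 1 := by
  induction n generalizing x with
  | zero =>
    simp only [srwKernel]
    convert hasSum_ite_eq x (1:ℝ) using 2 with y
    simp [eq_comm]
  | succ n ih =>
    simp only [srwKernel]
    have := (hasSum_sum (s := Finset.univ) fun i (_ : i ∈ Finset.univ) =>
      (ih (Function.update x i (x i + 1))).add (ih (Function.update x i (x i - 1)))).div_const (2 * (m:ℝ))
    have e : (∑ i : Fin m, ((1:ℝ) + 1)) / (2 * (m:ℝ)) = 1 := by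
      have : (m:ℝ) ≠ 0 := by exact_mod_cast hm.ne'
      rw [Finset.sum_const, Finset.card_univ, Fintype.card_fin, nsmul_eq_mul]
      field_simp
      norm_num
    rw [e] at this
    exact this

lemma pois_summable (c t : ℝ) : Summable fun n : ℕ => Real.exp (-c * t) * (c * t) ^ n / n.factorial := by
  have := (NormedSpace.expSeries_div_hasSum_exp (c * t)).summable.mul_left (Real.exp (-c * t))
  refine this.congr fun n => ?_
  ring

lemma pois_sum (c t a : ℝ) : HasSum (fun n : ℕ => Real.exp (-c * t) * (c * t) ^ n / n.factorial * a ^ n)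
    (Real.exp (c * t * (a - 1))) := by
  have := (NormedSpace.expSeries_div_hasSum_exp (c * t * a)).mul_left (Real.exp (-c * t))
  rw [← Real.exp_eq_exp_ℝ, ← Real.exp_add] at this
  have e : -c * t + c * t * a = c * t * (a - 1) := by ring
  rw [e] at this
  have e2 : (fun n : ℕ => Real.exp (-c * t) * (c * t) ^ n / n.factorial * a ^ n)
      = fun i : ℕ => Real.exp (-c * t) * ((c * t * a) ^ i / i.factorial) := by
    funext n; rw [mul_pow (c * t) a n]; ring
  rw [e2]
  exact this

lemma srw_le_one (m : ℕ) (hm : 0 < m) (n : ℕ) (x y : Fin m → ℤ) : srwKernel m n x y ≤ 1 :=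
  le_hasSum (srw_hasSum m hm n x) y fun _ _ => srw_nonneg m n x _

lemma heat_term_nonneg (m : ℕ) {t : ℝ} (ht : 0 ≤ t) (x y : Fin m → ℤ) (n : ℕ) :
    0 ≤ Real.exp (-(2 * m) * t) * ((2 * m) * t) ^ n / n.factorial * srwKernel m n x y :=
  mul_nonneg (by positivity) (srw_nonneg m n x y)

lemma heat_summable (m : ℕ) (hm : 0 < m) {t : ℝ} (ht : 0 ≤ t) (x y : Fin m → ℤ) :
    Summable fun n : ℕ => Real.exp (-(2 * m) * t) * ((2 * m) * t) ^ n / n.factorial * srwKernel m n x y := by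
  apply Summable.of_nonneg_of_le (heat_term_nonneg m ht x y) _ (pois_summable (2 * m) t)
  intro n
  exact mul_le_of_le_one_right (by positivity) (srw_le_one m hm n x y)

lemma heat_nonneg (m : ℕ) {t : ℝ} (ht : 0 ≤ t) (x y : Fin m → ℤ) : 0 ≤ heatKernel m t x y :=
  tsum_nonneg (heat_term_nonneg m ht x y)

lemma heat_tsum (m : ℕ) (hm : 0 < m) {t : ℝ} (ht : 0 ≤ t) (x : Fin m → ℤ) :
    ∑' y, ENNReal.ofReal (heatKernel m t x y) = 1 := by
  have e : ∀ y, ENNReal.ofReal (heatKernel m t x y) = ∑' n : ℕ,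
      ENNReal.ofReal (Real.exp (-(2 * m) * t) * ((2 * m) * t) ^ n / n.factorial) *
        ENNReal.ofReal (srwKernel m n x y) := by
    intro y
    rw [heatKernel, ENNReal.ofReal_tsum_of_nonneg (heat_term_nonneg m ht x y) (heat_summable m hm ht x y)]
    congr 1; ext n
    rw [ENNReal.ofReal_mul (by positivity)]
  simp_rw [e]
  rw [ENNReal.tsum_comm]
  simp_rw [ENNReal.tsum_mul_left]
  have e2 : ∀ n, ∑' y, ENNReal.ofReal (srwKernel m n x y) = 1 := by
    intro n
    rw [← ENNReal.ofReal_tsum_of_nonneg (fun y => srw_nonneg m n x y) (srw_hasSum m hm n x).summable,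
      (srw_hasSum m hm n x).tsum_eq, ENNReal.ofReal_one]
  simp_rw [e2, mul_one]
  rw [← ENNReal.ofReal_tsum_of_nonneg (fun n => by positivity) (pois_summable (2 * m) t)]
  have := (pois_sum (2 * m) t 1).tsum_eq
  simp at this
  simp [this]

lemma heat_diag (m : ℕ) (hm : 0 < m) {t : ℝ} (ht : 0 ≤ t) (x : Fin m → ℤ) :
    Real.exp (-(2 * m * t)) ≤ heatKernel m t x x := by
  have := (heat_summable m hm ht x x).le_tsum 0 (fun n _ => heat_term_nonneg m ht x x n)
  simpa [srwKernel, heatKernel] using this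

lemma h1_eq (t : ℝ) (k : ℤ) : h1 t k = heatKernel 1 t 0 (fun _ => k) := by
  rw [heat_eq_prod 1 one_pos]; simp

lemma h1_nonneg {t : ℝ} (ht : 0 ≤ t) (k : ℤ) : 0 ≤ h1 t k := by
  rw [h1_eq]; exact heat_nonneg 1 ht _ _

lemma h1_neg (t : ℝ) (k : ℤ) : h1 t (-k) = h1 t k := by
  unfold h1
  simp [Real.cos_neg]

lemma heat_symm (m : ℕ) (hm : 0 < m) (t : ℝ) (x y : Fin m → ℤ) :
    heatKernel m t x y = heatKernel m t y x := by
  rw [heat_eq_prod m hm, heat_eq_prod m hm]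
  apply Finset.prod_congr rfl
  intro i _
  rw [← h1_neg, neg_sub]

lemma h1_continuous (k : ℤ) : Continuous fun s => h1 s k := by
  unfold h1
  apply continuous_const.mul
  apply intervalIntegral.continuous_parametric_intervalIntegral_of_continuous'
  fun_prop

lemma h1_intble (s : ℝ) (k : ℤ) : IntervalIntegrable (fun θ : ℝ =>
    Real.exp (-(2 * s * (1 - Real.cos θ))) * Real.cos (k * θ)) volume (-Real.pi) Real.pi := by
  apply Continuous.intervalIntegrable; fun_prop

lemma h1_le_zero (s : ℝ) (k : ℤ) : h1 s k ≤ h1 s 0 := by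
  unfold h1
  apply mul_le_mul_of_nonneg_left _ (by positivity)
  apply intervalIntegral.integral_mono_on (by linarith [Real.pi_pos]) (h1_intble s k) (h1_intble s 0)
  intro θ _
  apply mul_le_mul_of_nonneg_left _ (by positivity)
  simpa using Real.cos_le_one _

lemma gauss_le {s θ : ℝ} (hs : 0 ≤ s) (h : θ ∈ Set.Icc (-Real.pi) Real.pi) :
    Real.exp (-(2 * s * (1 - Real.cos θ))) ≤ Real.exp (-(4 * s / Real.pi ^ 2) * θ ^ 2) := by
  apply Real.exp_le_exp.mpr
  have hc : Real.cos θ ≤ 1 - 2 / Real.pi ^ 2 * θ ^ 2 :=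
    Real.cos_le_one_sub_mul_cos_sq (abs_le.mpr h)
  have : 2 * s * (2 / Real.pi ^ 2 * θ ^ 2) ≤ 2 * s * (1 - Real.cos θ) := by
    apply mul_le_mul_of_nonneg_left _ (by positivity); linarith
  have e : 4 * s / Real.pi ^ 2 * θ ^ 2 = 2 * s * (2 / Real.pi ^ 2 * θ ^ 2) := by ring
  linarith

lemma interval_gauss_le {b : ℝ} (hb : 0 < b) :
    ∫ θ in (-Real.pi)..Real.pi, Real.exp (-b * θ ^ 2) ≤ Real.sqrt (Real.pi / b) := by
  rw [← integral_gaussian b, intervalIntegral.integral_of_le (by linarith [Real.pi_pos])]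
  exact setIntegral_le_integral (integrable_exp_neg_mul_sq hb)
    (Eventually.of_forall fun θ => by positivity)

lemma h1_zero_le {s : ℝ} (hs : 0 < s) : h1 s 0 ≤ 1 / Real.sqrt s := by
  have hpi := Real.pi_pos
  have hb : 0 < 4 * s / Real.pi ^ 2 := by positivity
  have h2 : ∫ θ in (-Real.pi)..Real.pi, Real.exp (-(2 * s * (1 - Real.cos θ))) * Real.cos ((0:ℤ) * θ)
      ≤ Real.sqrt (Real.pi / (4 * s / Real.pi ^ 2)) := by
    refine le_trans ?_ (interval_gauss_le hb)
    apply intervalIntegral.integral_mono_on (by linarith [Real.pi_pos]) (h1_intble s 0)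
    · apply Continuous.intervalIntegrable; fun_prop
    · intro θ hθ
      simpa using gauss_le hs.le hθ
  unfold h1
  calc _ ≤ (2 * Real.pi)⁻¹ * Real.sqrt (Real.pi / (4 * s / Real.pi ^ 2)) := by gcongr
    _ ≤ (2 * Real.pi)⁻¹ * (2 * Real.pi / Real.sqrt s) := by
        gcongr
        rw [Real.sqrt_le_left (by positivity), div_pow, Real.sq_sqrt hs.le]
        rw [div_div_eq_mul_div, div_le_div_iff₀ (by positivity) hs]
        nlinarith [Real.pi_le_four, mul_pos hs (pow_pos hpi 2)]
    _ = _ := by field_simp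

lemma h1_le {s : ℝ} (hs : 0 < s) (k : ℤ) : h1 s k ≤ 1 / Real.sqrt s :=
  (h1_le_zero s k).trans (h1_zero_le hs)

lemma heat_le_one (m : ℕ) (hm : 0 < m) {t : ℝ} (ht : 0 ≤ t) (x y : Fin m → ℤ) :
    heatKernel m t x y ≤ 1 := by
  have := ENNReal.le_tsum (f := fun y => ENNReal.ofReal (heatKernel m t x y)) y
  rw [heat_tsum m hm ht] at this
  simpa using this

lemma h1_le_one {t : ℝ} (ht : 0 ≤ t) (k : ℤ) : h1 t k ≤ 1 := by
  rw [h1_eq]; exact heat_le_one 1 one_pos ht _ _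

lemma heat_le (m : ℕ) (hm : 0 < m) {t : ℝ} (ht : 0 < t) (x y : Fin m → ℤ) :
    heatKernel m t x y ≤ t ^ (-(m:ℝ) / 2) := by
  rw [heat_eq_prod m hm]
  calc _ ≤ ∏ i : Fin m, (1 / Real.sqrt t) :=
        Finset.prod_le_prod (fun i _ => h1_nonneg ht.le _) fun i _ => h1_le ht _
    _ = _ := by
        rw [Finset.prod_const, Finset.card_univ, Fintype.card_fin, Real.sqrt_eq_rpow, one_div,
          ← Real.rpow_neg ht.le, ← Real.rpow_natCast, ← Real.rpow_mul ht.le]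
        congr 1; ring

lemma h1_zero_ge {s : ℝ} (hs : 1 ≤ s) : Real.exp (-1) / Real.pi / Real.sqrt s ≤ h1 s 0 := by
  have hpi := Real.pi_pos
  have hs0 : 0 < s := by linarith
  have hsq : 0 < Real.sqrt s := Real.sqrt_pos.mpr hs0
  set r := 1 / Real.sqrt s with hr
  have hr0 : 0 < r := by positivity
  have hr1 : r ≤ 1 := by
    rw [hr, div_le_one hsq]; exact Real.one_le_sqrt.mpr hs
  have hpi3 := Real.pi_gt_three
  unfold h1
  have hg : ∀ θ, 0 ≤ Real.exp (-(2 * s * (1 - Real.cos θ))) * Real.cos ((0:ℤ) * θ) := by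
    intro θ; simp; positivity
  have : ∫ θ in (-r)..r, Real.exp (-1) ≤ ∫ θ in (-Real.pi)..Real.pi,
      Real.exp (-(2 * s * (1 - Real.cos θ))) * Real.cos ((0:ℤ) * θ) := by
    calc _ ≤ ∫ θ in (-r)..r, Real.exp (-(2 * s * (1 - Real.cos θ))) * Real.cos ((0:ℤ) * θ) := by
          apply intervalIntegral.integral_mono_on (by linarith) (by simp)
          · apply Continuous.intervalIntegrable; fun_prop
          · intro θ hθ
            simp only [Int.cast_zero, zero_mul, Real.cos_zero, mul_one]
            apply Real.exp_le_exp.mpr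
            have h2 := Real.one_sub_sq_div_two_le_cos (x := θ)
            have h3 : θ ^ 2 ≤ r ^ 2 := by
              apply sq_le_sq.mpr; rw [abs_of_pos hr0]; exact abs_le.mpr hθ
            have h4 : r ^ 2 = 1 / s := by rw [hr, div_pow, Real.sq_sqrt hs0.le, one_pow]
            have : 2 * s * (1 - Real.cos θ) ≤ 2 * s * (r ^ 2 / 2) := by
              apply mul_le_mul_of_nonneg_left _ (by positivity); linarith
            have e : 2 * s * (r ^ 2 / 2) = 1 := by rw [h4]; field_simp
            linarith
      _ ≤ _ := by
          apply intervalIntegral.integral_mono_interval (by linarith) (by linarith) (by linarith)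
          · exact Eventually.of_forall hg
          · exact h1_intble s 0
  rw [intervalIntegral.integral_const] at this
  calc _ = (2 * Real.pi)⁻¹ * ((r - -r) • Real.exp (-1)) := by
        rw [hr, smul_eq_mul]; field_simp; ring
    _ ≤ _ := by gcongr

lemma h1_diff {s : ℝ} (hs : 0 < s) (k : ℤ) : h1 s 0 - h1 s k ≤ 8 * k ^ 2 / (s * Real.sqrt s) := by
  have hpi := Real.pi_pos
  have hpi4 := Real.pi_le_four
  set b := 2 * s / Real.pi ^ 2 with hb'
  have hb : 0 < b := by positivity
  unfold h1
  rw [← mul_sub, ← intervalIntegral.integral_sub (h1_intble s 0) (h1_intble s k)]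
  have h2 : ∫ θ in (-Real.pi)..Real.pi, (Real.exp (-(2 * s * (1 - Real.cos θ))) * Real.cos ((0:ℤ) * θ)
      - Real.exp (-(2 * s * (1 - Real.cos θ))) * Real.cos (k * θ))
      ≤ ∫ θ in (-Real.pi)..Real.pi, (k ^ 2 / (2 * b)) * Real.exp (-b * θ ^ 2) := by
    apply intervalIntegral.integral_mono_on (by linarith [Real.pi_pos]) ((h1_intble s 0).sub (h1_intble s k))
    · apply Continuous.intervalIntegrable; fun_prop
    · intro θ hθ
      have g := gauss_le hs.le hθ
      have h3 := Real.one_sub_sq_div_two_le_cos (x := k * θ)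
      have e1 : Real.exp (-(4 * s / Real.pi ^ 2) * θ ^ 2) = Real.exp (-b * θ ^ 2) * Real.exp (-b * θ ^ 2) := by
        rw [← Real.exp_add]; congr 1; rw [hb']; ring
      have e2 : b * θ ^ 2 * Real.exp (-b * θ ^ 2) ≤ 1 := by
        have := Real.add_one_le_exp (b * θ ^ 2)
        have hp := Real.exp_pos (-b * θ ^ 2)
        have e3 : Real.exp (b * θ ^ 2) * Real.exp (-b * θ ^ 2) = 1 := by
          rw [← Real.exp_add]; simp
        nlinarith
      calc _ = Real.exp (-(2 * s * (1 - Real.cos θ))) * (1 - Real.cos (k * θ)) := by simp; ring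
        _ ≤ Real.exp (-(4 * s / Real.pi ^ 2) * θ ^ 2) * ((k * θ) ^ 2 / 2) := by
            apply mul_le_mul g (by linarith) (by linarith [Real.cos_le_one (k * θ)]) (by positivity)
        _ = (k ^ 2 / (2 * b)) * Real.exp (-b * θ ^ 2) * (b * θ ^ 2 * Real.exp (-b * θ ^ 2)) := by
            rw [e1]; field_simp
        _ ≤ _ := mul_le_of_le_one_right (by positivity) e2
  rw [intervalIntegral.integral_const_mul] at h2
  have h3 := interval_gauss_le hb
  have hsq : 0 < Real.sqrt s := Real.sqrt_pos.mpr hs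
  have h4 : Real.sqrt (Real.pi / b) ≤ 2 * Real.pi / Real.sqrt s := by
    rw [Real.sqrt_le_left (by positivity), div_pow, Real.sq_sqrt hs.le, hb']
    rw [div_div_eq_mul_div, div_le_div_iff₀ (by positivity) hs]
    nlinarith [mul_pos hs (pow_pos hpi 2)]
  have h5 : (k:ℝ) ^ 2 / (2 * b) ≤ 8 * k ^ 2 / s := by
    rw [hb', div_le_div_iff₀ (by positivity) hs]
    have : (k:ℝ)^2 * s * Real.pi ^ 2 ≤ (k:ℝ)^2 * s * 16 := by
      apply mul_le_mul_of_nonneg_left _ (by positivity); nlinarith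
    have e : 8 * (k:ℝ) ^ 2 * (2 * (2 * s / Real.pi ^ 2)) = (32 * k ^ 2 * s) / Real.pi ^ 2 := by ring
    rw [e, le_div_iff₀ (by positivity)]
    nlinarith [mul_nonneg (sq_nonneg (k:ℝ)) hs.le]
  calc _ ≤ (2 * Real.pi)⁻¹ * (8 * k ^ 2 / s * (2 * Real.pi / Real.sqrt s)) := by
        apply mul_le_mul_of_nonneg_left _ (by positivity)
        refine h2.trans ?_
        apply mul_le_mul h5 (h3.trans h4) _ (by positivity)
        exact intervalIntegral.integral_nonneg (by linarith) fun θ _ => by positivity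
    _ = _ := by field_simp

/-- Near-diagonal lower bound. -/
lemma h1_ge_near : ∃ c > (0:ℝ), ∀ s : ℝ, 1 ≤ s → ∀ k : ℤ, |(k:ℝ)| ≤ c * Real.sqrt s →
    c / Real.sqrt s ≤ h1 s k := by
  have hpi := Real.pi_pos
  set a := Real.exp (-1) / Real.pi with ha
  have ha0 : 0 < a := by positivity
  have ha1 : a ≤ 1 := by
    rw [ha, div_le_one hpi]
    have : Real.exp (-1) ≤ 1 := Real.exp_le_one_iff.mpr (by norm_num)
    linarith [Real.pi_gt_three]
  refine ⟨a / 16, by positivity, fun s hs k hk => ?_⟩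
  have hs0 : 0 < s := by linarith
  have hsq : 0 < Real.sqrt s := Real.sqrt_pos.mpr hs0
  have h1' := h1_zero_ge hs
  have h2 := h1_diff hs0 k
  have h3 : (k:ℝ) ^ 2 ≤ (a / 16) ^ 2 * s := by
    have e : (a / 16) ^ 2 * s = (a / 16 * Real.sqrt s) ^ 2 := by
      rw [mul_pow, Real.sq_sqrt hs0.le]
    rw [← sq_abs, e]
    exact pow_le_pow_left₀ (abs_nonneg _) hk 2
  have h4 : 8 * (k:ℝ) ^ 2 / (s * Real.sqrt s) ≤ (a / 2) / Real.sqrt s := by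
    rw [div_le_div_iff₀ (by positivity) hsq]
    have : 8 * (k:ℝ) ^ 2 ≤ a / 2 * s := by nlinarith [mul_nonneg ha0.le hs0.le]
    nlinarith
  have h5 : a / Real.sqrt s - (a / 2) / Real.sqrt s = (a / 2) / Real.sqrt s := by ring
  have h6 : a / 16 / Real.sqrt s ≤ (a / 2) / Real.sqrt s := by gcongr; norm_num
  linarith

lemma srw_exp (n : ℕ) (a : ℝ) (x y : Fin 1 → ℤ) :
    srwKernel 1 n x y * Real.exp (a * (y 0 - x 0)) ≤ Real.cosh a ^ n := by
  induction n generalizing x with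
  | zero =>
    simp only [srwKernel, pow_zero]
    split_ifs with h
    · subst h; simp
    · simp
  | succ n ih =>
    simp only [srwKernel, Finset.univ_unique, Fin.default_eq_zero, Finset.sum_singleton]
    have h1 := ih (Function.update x 0 (x 0 + 1))
    have h2 := ih (Function.update x 0 (x 0 - 1))
    simp only [Function.update_self, Int.cast_add, Int.cast_sub, Int.cast_one] at h1 h2
    have e1 : Real.exp (a * (y 0 - x 0)) = Real.exp (a * (y 0 - (x 0 + 1))) * Real.exp a := by
      rw [← Real.exp_add]; congr 1; ring
    have e2 : Real.exp (a * (y 0 - x 0)) = Real.exp (a * (y 0 - (x 0 - 1))) * Real.exp (-a) := by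
      rw [← Real.exp_add]; congr 1; ring
    have h1' := mul_le_mul_of_nonneg_right h1 (Real.exp_pos a).le
    have h2' := mul_le_mul_of_nonneg_right h2 (Real.exp_pos (-a)).le
    rw [mul_assoc, ← e1] at h1'
    rw [mul_assoc, ← e2] at h2'
    rw [pow_succ]
    nth_rewrite 2 [Real.cosh_eq]
    push_cast
    linarith

/-- Exponential upper bound. -/
lemma h1_exp_le {s : ℝ} (hs : 0 ≤ s) (a : ℝ) (k : ℤ) :
    h1 s k ≤ Real.exp (2 * s * (Real.cosh a - 1)) * Real.exp (-(a * k)) := by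
  have e : h1 s k * Real.exp (a * k) ≤ Real.exp (2 * s * (Real.cosh a - 1)) := by
    rw [h1_eq, heatKernel, ← tsum_mul_right]
    have hp := pois_sum 2 s (Real.cosh a)
    rw [← hp.tsum_eq]
    have hle : ∀ n : ℕ, Real.exp (-(2 * (1:ℕ)) * s) * (2 * (1:ℕ) * s) ^ n / n.factorial *
        srwKernel 1 n 0 (fun _ => k) * Real.exp (a * k) ≤
        Real.exp (-2 * s) * (2 * s) ^ n / n.factorial * Real.cosh a ^ n := by
      intro n
      have := srw_exp n a 0 (fun _ => k)
      simp only [Pi.zero_apply, Int.cast_zero, sub_zero] at this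
      rw [mul_assoc]
      simp only [Nat.cast_one, mul_one]
      apply mul_le_mul_of_nonneg_left this (by positivity)
    apply Summable.tsum_le_tsum hle _ hp.summable
    exact Summable.of_nonneg_of_le (fun n => mul_nonneg (heat_term_nonneg 1 hs _ _ n) (by positivity)) hle hp.summable
  rw [Real.exp_neg, ← div_eq_mul_inv, le_div_iff₀ (Real.exp_pos _)]
  exact e

lemma cosh_sub_one_le {a : ℝ} (h0 : 0 ≤ a) (h1 : a ≤ 1) : Real.cosh a - 1 ≤ a ^ 2 := by
  have h2 := Real.cosh_le_exp_half_sq a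
  have h3 : a ^ 2 / 2 ≤ 1 := by nlinarith
  have h4 := Real.exp_bound_div_one_sub_of_interval (x := a ^ 2 / 2) (by positivity) (by nlinarith)
  have h5 : 1 / (1 - a ^ 2 / 2) ≤ 1 + a ^ 2 := by
    rw [div_le_iff₀ (by nlinarith)]; nlinarith [mul_nonneg (sq_nonneg a) (show 0 ≤ 1 - a ^ 2 by nlinarith)]
  linarith

/-- For `0 ≤ s ≤ R²`, `1 ≤ R`: `h1 s k ≤ e² exp(-k/R)`. -/
lemma h1_tail {s R : ℝ} (hs : 0 ≤ s) (hR : 1 ≤ R) (hsR : s ≤ R ^ 2) (k : ℤ) :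
    h1 s k ≤ Real.exp 2 * Real.exp (-(k / R)) := by
  have h := h1_exp_le hs (1 / R) k
  have hR0 : 0 < R := by linarith
  refine h.trans ?_
  have e : 1 / R * (k:ℝ) = k / R := by ring
  rw [e]
  gcongr
  have h2 := cosh_sub_one_le (a := 1 / R) (by positivity) (by rw [div_le_one hR0]; exact hR)
  calc 2 * s * (Real.cosh (1 / R) - 1) ≤ 2 * s * (1 / R) ^ 2 := by gcongr
    _ ≤ 2 * R ^ 2 * (1 / R) ^ 2 := by gcongr
    _ = 2 := by field_simp

/-- Lower bound of the `m`-dimensional kernel. -/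
lemma heat_ge_near (m : ℕ) (hm : 0 < m) : ∃ c > (0:ℝ), c ≤ 1 ∧ ∀ t : ℝ, 1 ≤ t → ∀ x y : Fin m → ℤ,
    (∀ i, |((y i - x i : ℤ):ℝ)| ≤ c * Real.sqrt t) → c * t ^ (-(m:ℝ) / 2) ≤ heatKernel m t x y := by
  obtain ⟨c, hc, H⟩ := h1_ge_near
  refine ⟨min c (min 1 (c ^ m)), by positivity, (min_le_right _ _).trans (min_le_left _ _),
    fun t ht x y hxy => ?_⟩
  have ht0 : 0 < t := by linarith
  rw [heat_eq_prod m hm]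
  calc _ ≤ c ^ m * t ^ (-(m:ℝ) / 2) := by
        gcongr; exact (min_le_right _ _).trans (min_le_right _ _)
    _ = ∏ i : Fin m, (c / Real.sqrt t) := by
        rw [Finset.prod_const, Finset.card_univ, Fintype.card_fin, div_pow, div_eq_mul_inv]
        congr 1
        rw [Real.sqrt_eq_rpow, ← Real.rpow_natCast, ← Real.rpow_mul ht0.le, ← Real.rpow_neg ht0.le]
        congr 1; ring
    _ ≤ _ := by
        apply Finset.prod_le_prod (fun i _ => by positivity)
        intro i _
        apply H t ht
        refine (hxy i).trans ?_
        gcongr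
        exact min_le_left _ _

end LRC


set_option linter.all false
set_option linter.deprecated false

namespace LRC

/-! ### Markov property and independence of the coordinates -/

open Classical in
/-- Indicator of a proposition, with values in `ENNReal`. -/
noncomputable def ind (p : Prop) : ENNReal := if p then 1 else 0

lemma ind_true {p : Prop} (h : p) : ind p = 1 := by simp [ind, h]
lemma ind_false {p : Prop} (h : ¬ p) : ind p = 0 := by simp [ind, h]
lemma ind_le_one (p : Prop) : ind p ≤ 1 := by unfold ind; split_ifs <;> simp
lemma ind_mono {p q : Prop} (h : p → q) : ind p ≤ ind q := by
  by_cases hp : p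
  · rw [ind_true hp, ind_true (h hp)]
  · rw [ind_false hp]; exact zero_le
lemma ind_and (p q : Prop) : ind (p ∧ q) = ind p * ind q := by
  by_cases hp : p <;> by_cases hq : q <;> simp [ind, hp, hq]

variable {Ω : Type*} [MeasurableSpace Ω]

lemma ind_eq_indicator {A : Set Ω} (ω : Ω) : ind (ω ∈ A) = A.indicator (fun _ => 1) ω := by
  by_cases h : ω ∈ A <;> simp [ind, h]

lemma measurable_ind {p : Ω → Prop} (h : MeasurableSet {ω | p ω}) : Measurable fun ω => ind (p ω) := by
  have : (fun ω => ind (p ω)) = {ω | p ω}.indicator (fun _ => 1) := by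
    funext ω; exact ind_eq_indicator (A := {ω | p ω}) ω
  rw [this]; exact measurable_const.indicator h

lemma lintegral_ind (P : Measure Ω) {p : Ω → Prop} (h : MeasurableSet {ω | p ω}) :
    ∫⁻ ω, ind (p ω) ∂P = P {ω | p ω} := by
  have : (fun ω => ind (p ω)) = {ω | p ω}.indicator (fun _ => 1) := by
    funext ω; exact ind_eq_indicator (A := {ω | p ω}) ω
  rw [this, lintegral_indicator_const h, one_mul]

lemma tsum_ind_mul {V : Type*} (F : V → ENNReal) (v : V) : ∑' y, F y * ind (v = y) = F v := by
  rw [tsum_eq_single v]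
  · rw [ind_true rfl, mul_one]
  · intro y hy; rw [ind_false (Ne.symm hy), mul_zero]

lemma tsum_ind {V : Type*} (v : V) : ∑' y, ind (v = y) = 1 := by
  simpa using tsum_ind_mul (fun _ => 1) v

/-- `f` is determined by the values of `S` at the times `t 0, …, t n`. -/
def Det {V : Type*} {β : Type*} (S : ℝ → Ω → V) (t : ℕ → ℝ) (n : ℕ) (f : Ω → β) : Prop :=
  ∀ ω ω', (∀ i ≤ n, S (t i) ω = S (t i) ω') → f ω = f ω'

section generic
variable {V : Type*} [Countable V] [MeasurableSpace V] [MeasurableSingletonClass V]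

lemma Det.exists {S : ℝ → Ω → V} {t : ℕ → ℝ} {n : ℕ} {f : Ω → ENNReal} (hf : Det S t n f) :
    ∃ F : (Fin (n + 1) → V) → ENNReal, ∀ ω, f ω = F (fun i => S (t i) ω) := by
  have : Function.FactorsThrough f (fun ω (i : Fin (n+1)) => S (t i) ω) := by
    intro ω ω' h
    apply hf
    intro i hi
    exact congrFun h ⟨i, by omega⟩
  exact ⟨_, fun ω => (this.extend_apply (fun _ => 0) ω).symm⟩

lemma hist_meas {S : ℝ → Ω → V} (hm : ∀ t, Measurable (S t)) (t : ℕ → ℝ) (n : ℕ) :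
    Measurable (fun ω (i : Fin (n+1)) => S (t i) ω) := measurable_pi_lambda _ fun _ => hm _

lemma Det.measurable {S : ℝ → Ω → V} (hm : ∀ t, Measurable (S t)) {t : ℕ → ℝ} {n : ℕ}
    {f : Ω → ENNReal} (hf : Det S t n f) : Measurable f := by
  obtain ⟨F, hF⟩ := hf.exists
  rw [show f = F ∘ (fun ω (i : Fin (n+1)) => S (t i) ω) from funext hF]
  exact (measurable_of_countable F).comp (hist_meas hm t n)

lemma markov_generic (P : Measure Ω) (S : ℝ → Ω → V) (hm : ∀ t, Measurable (S t))
    (q : V → ENNReal) (t : ℕ → ℝ) (n : ℕ) (u : ℝ) (w : V)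
    (h : ∀ y : Fin (n + 1) → V, P {ω | (∀ i : Fin (n+1), S (t i) ω = y i) ∧ S u ω = w} =
      P {ω | ∀ i : Fin (n+1), S (t i) ω = y i} * q (y (Fin.last n)))
    {f : Ω → ENNReal} (hf : Det S t n f) :
    ∫⁻ ω, f ω * ind (S u ω = w) ∂P = ∫⁻ ω, f ω * q (S (t n) ω) ∂P := by
  obtain ⟨F, hF⟩ := hf.exists
  set H := fun ω (i : Fin (n+1)) => S (t i) ω with hH
  have hHm : Measurable H := hist_meas hm t n
  have m1 : ∀ y, MeasurableSet {ω | H ω = y} := fun y => hHm (measurableSet_singleton y)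
  have m2 : MeasurableSet {ω | S u ω = w} := hm u (measurableSet_singleton w)
  have m3 : ∀ y, MeasurableSet {ω | H ω = y ∧ S u ω = w} := fun y => (m1 y).inter m2
  have e1 : ∀ ω, f ω * ind (S u ω = w) = ∑' y, F y * ind (H ω = y ∧ S u ω = w) := by
    intro ω
    have : ∀ y, F y * ind (H ω = y ∧ S u ω = w) = F y * ind (H ω = y) * ind (S u ω = w) := by
      intro y; rw [ind_and, mul_assoc]
    simp_rw [this]
    rw [ENNReal.tsum_mul_right, tsum_ind_mul, hF]
  have e2 : ∀ ω, f ω * q (S (t n) ω) = ∑' y, F y * q (y (Fin.last n)) * ind (H ω = y) := by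
    intro ω
    rw [tsum_ind_mul (fun y : Fin (n+1) → V => F y * q (y (Fin.last n))), hF]
    simp [hH]
  simp_rw [e1, e2]
  rw [lintegral_tsum, lintegral_tsum]
  · congr 1; funext y
    rw [lintegral_const_mul _ (measurable_ind (m3 y)), lintegral_const_mul _ (measurable_ind (m1 y)),
      lintegral_ind _ (m3 y), lintegral_ind _ (m1 y)]
    have := h y
    simp only [hH, funext_iff]
    rw [this]; ring
  · intro y; exact ((measurable_ind (m1 y)).const_mul _).aemeasurable
  · intro y; exact ((measurable_ind (m3 y)).const_mul _).aemeasurable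

end generic

section walk
variable {m : ℕ} {P : (Fin m → ℤ) → Measure Ω} {S : ℝ → Ω → (Fin m → ℤ)}

lemma S_meas (hS : IsCTSRW m P S) (t : ℝ) : Measurable (S t) :=
  hS.meas.comp (measurable_const.prodMk measurable_id)

lemma fdd' (hS : IsCTSRW m P S) (x : Fin m → ℤ) {t : ℕ → ℝ} (h0 : 0 ≤ t 0) (ht : Monotone t) (n : ℕ)
    (y : Fin (n + 1) → Fin m → ℤ) :
    P x {ω | ∀ i : Fin (n+1), S (t i) ω = y i} = ENNReal.ofReal (heatKernel m (t 0) x (y 0)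
      * ∏ i : Fin n, heatKernel m (t (i + 1) - t i) (y i.castSucc) (y i.succ)) := by
  have := hS.prob x
  have h := hS.fdd x n (fun i => t i) (by simpa using h0) (fun i => ht (by simp)) y
  simp only [Fin.val_zero, Fin.val_castSucc, Fin.val_succ] at h
  rw [← h, ENNReal.ofReal_toReal (measure_ne_top _ _)]

lemma markov_S (hS : IsCTSRW m P S) (x : Fin m → ℤ) {t : ℕ → ℝ} (h0 : 0 ≤ t 0) (ht : Monotone t)
    (n : ℕ) {u : ℝ} (hu : t n ≤ u) (w : Fin m → ℤ) {f : Ω → ENNReal} (hf : Det S t n f) :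
    ∫⁻ ω, f ω * ind (S u ω = w) ∂(P x) =
      ∫⁻ ω, f ω * ENNReal.ofReal (heatKernel m (u - t n) (S (t n) ω) w) ∂(P x) := by
  apply markov_generic (P x) S (S_meas hS) (fun v => ENNReal.ofReal (heatKernel m (u - t n) v w)) t n u w _ hf
  intro y
  set t' : ℕ → ℝ := fun i => if i ≤ n then t i else u with ht'
  have ht'm : Monotone t' := by
    intro i j hij
    simp only [ht']
    split_ifs with h1 h2 h3
    · exact ht hij
    · exact (ht h1).trans hu
    · omega
    · exact le_rfl
  have A := fdd' hS x (t := t') (by simpa [ht'] using h0) ht'm (n+1) (Fin.snoc y w)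
  have B := fdd' hS x h0 ht n y
  have eA : {ω | ∀ i : Fin (n+1+1), S (t' i) ω = (Fin.snoc y w : Fin (n+2) → Fin m → ℤ) i} =
      {ω | (∀ i : Fin (n+1), S (t i) ω = y i) ∧ S u ω = w} := by
    ext ω
    simp only [mem_setOf_eq, Fin.forall_fin_succ', Fin.snoc_castSucc, Fin.snoc_last]
    simp only [ht', Fin.val_castSucc, Fin.val_last]
    have h1 : ∀ i : Fin n, ((i:ℕ) ≤ n) := fun i => by omega
    simp [h1]
  rw [eA] at A
  rw [A, B, ← ENNReal.ofReal_mul']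
  swap
  · exact heat_nonneg m (by linarith) _ _
  congr 1
  rw [Fin.prod_univ_castSucc, ← mul_assoc]
  congr 1
  · congr 1
    · apply Finset.prod_congr rfl
      intro i _
      have h1 : ((i:ℕ) ≤ n) := by omega
      have h2 : ((i:ℕ)+1 ≤ n) := by omega
      rw [← Fin.castSucc_succ, Fin.snoc_castSucc, Fin.snoc_castSucc]
      simp [ht', h1, h2]
  · rw [Fin.snoc_castSucc, Fin.succ_last, Fin.snoc_last]
    simp [ht']

end walk
end LRC

set_option linter.all false

namespace LRC

/-- Last `d` coordinates of the walk. -/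
def tlp (d : ℕ) {Ω : Type*} (S : ℝ → Ω → (Fin (d+1) → ℤ)) : ℝ → Ω → (Fin d → ℤ) :=
  fun u ω i => S u ω i.succ

/-- First coordinate of the walk. -/
def hdp (d : ℕ) {Ω : Type*} (S : ℝ → Ω → (Fin (d+1) → ℤ)) : ℝ → Ω → ℤ :=
  fun u ω => S u ω 0

lemma heat_split (d : ℕ) (hd : 0 < d) (t : ℝ) (x : Fin (d+1) → ℤ) (a : ℤ) (y : Fin d → ℤ) :
    heatKernel (d+1) t x (Fin.cons a y : Fin (d+1) → ℤ) =
      h1 t (a - x 0) * heatKernel d t (fun i => x i.succ) y := by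
  rw [heat_eq_prod _ (Nat.succ_pos d), heat_eq_prod d hd, Fin.prod_univ_succ]
  simp

lemma h1_tsum {t : ℝ} (ht : 0 ≤ t) (b : ℤ) : ∑' a : ℤ, ENNReal.ofReal (h1 t (a - b)) = 1 := by
  rw [← heat_tsum 1 one_pos ht (fun _ => b), ← (Equiv.funUnique (Fin 1) ℤ).symm.tsum_eq]
  congr 1; funext a
  rw [heat_eq_prod 1 one_pos]; simp

variable {Ω : Type*} [MeasurableSpace Ω]

section
variable {d : ℕ} {P : (Fin (d+1) → ℤ) → Measure Ω} {S : ℝ → Ω → (Fin (d+1) → ℤ)}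

lemma tlp_meas (hS : IsCTSRW (d+1) P S) (t : ℝ) : Measurable (tlp d S t) :=
  measurable_pi_lambda _ fun i => (measurable_pi_apply i.succ).comp (S_meas hS t)

lemma hdp_meas (hS : IsCTSRW (d+1) P S) (t : ℝ) : Measurable (hdp d S t) :=
  (measurable_pi_apply 0).comp (S_meas hS t)

lemma Det.of_tlp {β : Type*} {t : ℕ → ℝ} {n : ℕ} {f : Ω → β} (h : Det (tlp d S) t n f) : Det S t n f :=
  fun ω ω' hh => h ω ω' fun i hi => by unfold tlp; rw [hh i hi]

lemma Det.of_hdp {β : Type*} {t : ℕ → ℝ} {n : ℕ} {f : Ω → β} (h : Det (hdp d S) t n f) : Det S t n f :=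
  fun ω ω' hh => h ω ω' fun i hi => by unfold hdp; rw [hh i hi]

lemma eq_cons_iff (v : Fin (d+1) → ℤ) (a : ℤ) (y : Fin d → ℤ) :
    v = Fin.cons a y ↔ v 0 = a ∧ (fun i : Fin d => v i.succ) = y := by
  constructor
  · rintro rfl; simp
  · rintro ⟨rfl, rfl⟩; exact (Fin.cons_self_tail v).symm

lemma sing_meas {V : Type*} [MeasurableSpace V] [MeasurableSingletonClass V] {f : Ω → V}
    (hf : Measurable f) (v : V) : MeasurableSet {ω | f ω = v} := hf (measurableSet_singleton v)

lemma markov_Y (hd : 0 < d) (hS : IsCTSRW (d+1) P S) (x : Fin (d+1) → ℤ) {t : ℕ → ℝ} (h0 : 0 ≤ t 0)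
    (ht : Monotone t) (n : ℕ) {u : ℝ} (hu : t n ≤ u) (w : Fin d → ℤ) {f : Ω → ENNReal}
    (hf : Det (tlp d S) t n f) :
    ∫⁻ ω, f ω * ind (tlp d S u ω = w) ∂(P x) =
      ∫⁻ ω, f ω * ENNReal.ofReal (heatKernel d (u - t n) (tlp d S (t n) ω) w) ∂(P x) := by
  have fm := hf.of_tlp.measurable (S_meas hS)
  have e1 : ∀ ω, f ω * ind (tlp d S u ω = w) = ∑' a : ℤ, f ω * ind (S u ω = Fin.cons a w) := by
    intro ω
    rw [ENNReal.tsum_mul_left]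
    congr 1
    simp_rw [eq_cons_iff, ind_and]
    rw [ENNReal.tsum_mul_right, tsum_ind, one_mul]; rfl
  have e2 : ∀ ω, f ω * ENNReal.ofReal (heatKernel d (u - t n) (tlp d S (t n) ω) w) =
      ∑' a : ℤ, f ω * ENNReal.ofReal (heatKernel (d+1) (u - t n) (S (t n) ω) (Fin.cons a w : Fin (d+1) → ℤ)) := by
    intro ω
    rw [ENNReal.tsum_mul_left]
    congr 1
    simp_rw [heat_split d hd]
    have : ∀ a : ℤ, ENNReal.ofReal (h1 (u - t n) (a - S (t n) ω 0) * heatKernel d (u - t n) (fun i => S (t n) ω i.succ) w)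
      = ENNReal.ofReal (h1 (u - t n) (a - S (t n) ω 0)) * ENNReal.ofReal (heatKernel d (u - t n) (fun i => S (t n) ω i.succ) w) := by
      intro a; rw [ENNReal.ofReal_mul (h1_nonneg (by linarith) _)]
    simp_rw [this]
    rw [ENNReal.tsum_mul_right, h1_tsum (by linarith), one_mul]; rfl
  simp_rw [e1, e2]
  rw [lintegral_tsum, lintegral_tsum]
  · congr 1; funext a
    exact markov_S hS x h0 ht n hu _ hf.of_tlp
  · intro a
    apply (fm.mul _).aemeasurable
    exact (measurable_of_countable (fun v => ENNReal.ofReal (heatKernel (d+1) (u - t n) v (Fin.cons a w : Fin (d+1) → ℤ)))).comp (S_meas hS _)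
  · intro a
    exact (fm.mul (measurable_ind (sing_meas (S_meas hS u) _))).aemeasurable

lemma markov_X (hd : 0 < d) (hS : IsCTSRW (d+1) P S) (x : Fin (d+1) → ℤ) {t : ℕ → ℝ} (h0 : 0 ≤ t 0)
    (ht : Monotone t) (n : ℕ) {u : ℝ} (hu : t n ≤ u) (a : ℤ) {f : Ω → ENNReal}
    (hf : Det (hdp d S) t n f) :
    ∫⁻ ω, f ω * ind (hdp d S u ω = a) ∂(P x) =
      ∫⁻ ω, f ω * ENNReal.ofReal (h1 (u - t n) (a - hdp d S (t n) ω)) ∂(P x) := by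
  have fm := hf.of_hdp.measurable (S_meas hS)
  have e1 : ∀ ω, f ω * ind (hdp d S u ω = a) = ∑' w : Fin d → ℤ, f ω * ind (S u ω = Fin.cons a w) := by
    intro ω
    rw [ENNReal.tsum_mul_left]
    congr 1
    simp_rw [eq_cons_iff, ind_and]
    rw [ENNReal.tsum_mul_left, tsum_ind, mul_one]; rfl
  have e2 : ∀ ω, f ω * ENNReal.ofReal (h1 (u - t n) (a - hdp d S (t n) ω)) =
      ∑' w : Fin d → ℤ, f ω * ENNReal.ofReal (heatKernel (d+1) (u - t n) (S (t n) ω) (Fin.cons a w : Fin (d+1) → ℤ)) := by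
    intro ω
    rw [ENNReal.tsum_mul_left]
    congr 1
    simp_rw [heat_split d hd]
    have : ∀ w : Fin d → ℤ, ENNReal.ofReal (h1 (u - t n) (a - S (t n) ω 0) * heatKernel d (u - t n) (fun i => S (t n) ω i.succ) w)
      = ENNReal.ofReal (h1 (u - t n) (a - S (t n) ω 0)) * ENNReal.ofReal (heatKernel d (u - t n) (fun i => S (t n) ω i.succ) w) := by
      intro w; rw [ENNReal.ofReal_mul (h1_nonneg (by linarith) _)]
    simp_rw [this]
    rw [ENNReal.tsum_mul_left, heat_tsum d hd (by linarith), mul_one]; rfl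
  simp_rw [e1, e2]
  rw [lintegral_tsum, lintegral_tsum]
  · congr 1; funext w
    exact markov_S hS x h0 ht n hu _ hf.of_hdp
  · intro w
    apply (fm.mul _).aemeasurable
    exact (measurable_of_countable (fun v => ENNReal.ofReal (heatKernel (d+1) (u - t n) v (Fin.cons a w : Fin (d+1) → ℤ)))).comp (S_meas hS _)
  · intro w
    exact (fm.mul (measurable_ind (sing_meas (S_meas hS u) _))).aemeasurable

lemma marg_Y (hd : 0 < d) (hS : IsCTSRW (d+1) P S) {u : ℝ} (hu : 0 ≤ u) (w : Fin d → ℤ) :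
    P 0 {ω | tlp d S u ω = w} = ENNReal.ofReal (heatKernel d u 0 w) := by
  have := hS.prob 0
  have h := markov_Y hd hS 0 (t := fun _ => 0) le_rfl (fun _ _ _ => le_rfl) 0 hu w (f := fun _ => 1)
    (fun _ _ _ => rfl)
  simp only [one_mul, sub_zero] at h
  rw [lintegral_ind _ (sing_meas (tlp_meas hS u) w)] at h
  rw [h]
  have : ∀ᵐ ω ∂(P 0), ENNReal.ofReal (heatKernel d u (tlp d S 0 ω) w) = ENNReal.ofReal (heatKernel d u 0 w) := by
    filter_upwards [hS.start 0] with ω hω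
    have : tlp d S 0 ω = 0 := by unfold tlp; rw [hω]; rfl
    rw [this]
  rw [lintegral_congr_ae this]; simp

lemma marg_X (hd : 0 < d) (hS : IsCTSRW (d+1) P S) {u : ℝ} (hu : 0 ≤ u) (k : ℤ) :
    P 0 {ω | hdp d S u ω = k} = ENNReal.ofReal (h1 u k) := by
  have := hS.prob 0
  have h := markov_X hd hS 0 (t := fun _ => 0) le_rfl (fun _ _ _ => le_rfl) 0 hu k (f := fun _ => 1)
    (fun _ _ _ => rfl)
  simp only [one_mul, sub_zero] at h
  rw [lintegral_ind _ (sing_meas (hdp_meas hS u) k)] at h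
  rw [h]
  have : ∀ᵐ ω ∂(P 0), ENNReal.ofReal (h1 u (k - hdp d S 0 ω)) = ENNReal.ofReal (h1 u k) := by
    filter_upwards [hS.start 0] with ω hω
    have : hdp d S 0 ω = 0 := by unfold hdp; rw [hω]; rfl
    rw [this, sub_zero]
  rw [lintegral_congr_ae this]; simp

/-- Joint factorization of the histories of the two components. -/
lemma joint_fact (hd : 0 < d) (hS : IsCTSRW (d+1) P S) {t : ℕ → ℝ} (h0 : 0 ≤ t 0)
    (ht : Monotone t) (n : ℕ) (y : ℕ → Fin d → ℤ) (a : ℕ → ℤ) :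
    P 0 {ω | (∀ i ≤ n, tlp d S (t i) ω = y i) ∧ (∀ i ≤ n, hdp d S (t i) ω = a i)} =
    P 0 {ω | ∀ i ≤ n, tlp d S (t i) ω = y i} * P 0 {ω | ∀ i ≤ n, hdp d S (t i) ω = a i} := by
  have mY : ∀ n, MeasurableSet {ω | ∀ i ≤ n, tlp d S (t i) ω = y i} := by
    intro n
    simp only [setOf_forall]
    exact MeasurableSet.iInter fun i => MeasurableSet.iInter fun _ => sing_meas (tlp_meas hS _) _
  have mX : ∀ n, MeasurableSet {ω | ∀ i ≤ n, hdp d S (t i) ω = a i} := by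
    intro n
    simp only [setOf_forall]
    exact MeasurableSet.iInter fun i => MeasurableSet.iInter fun _ => sing_meas (hdp_meas hS _) _
  have mXY : ∀ n, MeasurableSet {ω | (∀ i ≤ n, tlp d S (t i) ω = y i) ∧ (∀ i ≤ n, hdp d S (t i) ω = a i)} :=
    fun n => (mY n).inter (mX n)
  induction n with
  | zero =>
    simp only [Nat.le_zero, forall_eq]
    have e : {ω | tlp d S (t 0) ω = y 0 ∧ hdp d S (t 0) ω = a 0} = {ω | S (t 0) ω = Fin.cons (a 0) (y 0)} := by
      ext ω; simp only [mem_setOf_eq, eq_cons_iff, tlp, hdp]; tauto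
    have h := fdd' hS 0 h0 ht 0 (fun _ => (Fin.cons (a 0) (y 0) : Fin (d+1) → ℤ))
    simp only [zero_add, Finset.univ_eq_empty, Finset.prod_empty, mul_one] at h
    have e2 : {ω | ∀ i : Fin 1, S (t i) ω = (Fin.cons (a 0) (y 0) : Fin (d+1) → ℤ)} = {ω | S (t 0) ω = (Fin.cons (a 0) (y 0) : Fin (d+1) → ℤ)} := by
      ext ω; simp
    rw [e2] at h
    rw [e, h, marg_Y hd hS h0, marg_X hd hS h0, heat_split d hd, ENNReal.ofReal_mul (h1_nonneg h0 _), mul_comm]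
    simp; rfl
  | succ n ih =>
    have hle : t n ≤ t (n+1) := ht (Nat.le_succ n)
    have hs : 0 ≤ t (n+1) - t n := by linarith
    have split : ∀ p : ℕ → Prop, (∀ i ≤ n+1, p i) ↔ (∀ i ≤ n, p i) ∧ p (n+1) := by
      intro p
      constructor
      · intro h; exact ⟨fun i hi => h i (by omega), h _ le_rfl⟩
      · rintro ⟨h, h'⟩ i hi
        rcases Nat.lt_or_ge i (n+1) with h2 | h2
        · exact h i (by omega)
        · have : i = n+1 := by omega
          rw [this]; exact h'
    -- left
    have L := markov_S hS 0 h0 ht n hle (Fin.cons (a (n+1)) (y (n+1)) : Fin (d+1) → ℤ)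
      (f := fun ω => ind ((∀ i ≤ n, tlp d S (t i) ω = y i) ∧ (∀ i ≤ n, hdp d S (t i) ω = a i))) (by
        intro ω ω' h
        refine congrArg ind (propext ?_)
        have hY : ∀ i ≤ n, tlp d S (t i) ω = tlp d S (t i) ω' := fun i hi => by unfold tlp; rw [h i hi]
        have hX : ∀ i ≤ n, hdp d S (t i) ω = hdp d S (t i) ω' := fun i hi => by unfold hdp; rw [h i hi]
        constructor <;> rintro ⟨h1, h2⟩ <;> refine ⟨fun i hi => ?_, fun i hi => ?_⟩
        · rw [← hY i hi]; exact h1 i hi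
        · rw [← hX i hi]; exact h2 i hi
        · rw [hY i hi]; exact h1 i hi
        · rw [hX i hi]; exact h2 i hi)
    have LY := markov_Y hd hS 0 h0 ht n hle (y (n+1)) (f := fun ω => ind (∀ i ≤ n, tlp d S (t i) ω = y i)) (by
        intro ω ω' h
        refine congrArg ind (propext ?_)
        constructor <;> intro h1 i hi
        · rw [← h i hi]; exact h1 i hi
        · rw [h i hi]; exact h1 i hi)
    have LX := markov_X hd hS 0 h0 ht n hle (a (n+1)) (f := fun ω => ind (∀ i ≤ n, hdp d S (t i) ω = a i)) (by
        intro ω ω' h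
        refine congrArg ind (propext ?_)
        constructor <;> intro h1 i hi
        · rw [← h i hi]; exact h1 i hi
        · rw [h i hi]; exact h1 i hi)
    have c1 : ∀ ω, ind ((∀ i ≤ n, tlp d S (t i) ω = y i) ∧ (∀ i ≤ n, hdp d S (t i) ω = a i)) *
        ENNReal.ofReal (heatKernel (d+1) (t (n+1) - t n) (S (t n) ω) (Fin.cons (a (n+1)) (y (n+1)) : Fin (d+1) → ℤ))
        = ind ((∀ i ≤ n, tlp d S (t i) ω = y i) ∧ (∀ i ≤ n, hdp d S (t i) ω = a i)) *
        (ENNReal.ofReal (h1 (t (n+1) - t n) (a (n+1) - a n)) * ENNReal.ofReal (heatKernel d (t (n+1) - t n) (y n) (y (n+1)))) := by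
      intro ω
      by_cases h : ((∀ i ≤ n, tlp d S (t i) ω = y i) ∧ (∀ i ≤ n, hdp d S (t i) ω = a i))
      · rw [heat_split d hd, ENNReal.ofReal_mul (h1_nonneg hs _)]
        have h1 := h.1 n le_rfl
        have h2 := h.2 n le_rfl
        unfold tlp at h1; unfold hdp at h2
        rw [h1, h2]
      · rw [ind_false h, zero_mul, zero_mul]
    have c2 : ∀ ω, ind (∀ i ≤ n, tlp d S (t i) ω = y i) *
        ENNReal.ofReal (heatKernel d (t (n+1) - t n) (tlp d S (t n) ω) (y (n+1)))
        = ind (∀ i ≤ n, tlp d S (t i) ω = y i) * ENNReal.ofReal (heatKernel d (t (n+1) - t n) (y n) (y (n+1))) := by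
      intro ω
      by_cases h : (∀ i ≤ n, tlp d S (t i) ω = y i)
      · rw [h n le_rfl]
      · rw [ind_false h, zero_mul, zero_mul]
    have c3 : ∀ ω, ind (∀ i ≤ n, hdp d S (t i) ω = a i) *
        ENNReal.ofReal (h1 (t (n+1) - t n) (a (n+1) - hdp d S (t n) ω))
        = ind (∀ i ≤ n, hdp d S (t i) ω = a i) * ENNReal.ofReal (h1 (t (n+1) - t n) (a (n+1) - a n)) := by
      intro ω
      by_cases h : (∀ i ≤ n, hdp d S (t i) ω = a i)
      · rw [h n le_rfl]
      · rw [ind_false h, zero_mul, zero_mul]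
    simp only [c1] at L
    simp only [c2] at LY
    simp only [c3] at LX
    rw [lintegral_mul_const _ (measurable_ind (mXY n)), lintegral_ind _ (mXY n), ih] at L
    rw [lintegral_mul_const _ (measurable_ind (mY n)), lintegral_ind _ (mY n)] at LY
    rw [lintegral_mul_const _ (measurable_ind (mX n)), lintegral_ind _ (mX n)] at LX
    have e1 : ∀ ω, ind ((∀ i ≤ n, tlp d S (t i) ω = y i) ∧ (∀ i ≤ n, hdp d S (t i) ω = a i)) *
        ind (S (t (n+1)) ω = Fin.cons (a (n+1)) (y (n+1))) =
        ind ((∀ i ≤ n+1, tlp d S (t i) ω = y i) ∧ (∀ i ≤ n+1, hdp d S (t i) ω = a i)) := by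
      intro ω
      rw [← ind_and, split (fun i => tlp d S (t i) ω = y i), split (fun i => hdp d S (t i) ω = a i), eq_cons_iff]
      congr 1
      apply propext
      simp only [tlp, hdp]
      tauto
    simp only [e1] at L
    rw [lintegral_ind _ (mXY (n+1))] at L
    simp only [← ind_and, ← split (fun i => tlp d S (t i) _ = y i)] at LY
    simp only [← ind_and, ← split (fun i => hdp d S (t i) _ = a i)] at LX
    rw [lintegral_ind _ (mY (n+1))] at LY
    rw [lintegral_ind _ (mX (n+1))] at LX
    rw [L, LY, LX]
    ring
end
end LRC

set_option linter.all false

namespace LRC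
open scoped NNReal

variable {Ω : Type*} [MeasurableSpace Ω]

section
variable {d : ℕ} {P : (Fin (d+1) → ℤ) → Measure Ω} {S : ℝ → Ω → (Fin (d+1) → ℤ)}

lemma hist_indep (hd : 0 < d) (hS : IsCTSRW (d+1) P S) {t : ℕ → ℝ} (h0 : 0 ≤ t 0)
    (ht : Monotone t) (n : ℕ) :
    IndepFun (fun ω (i : Fin (n+1)) => tlp d S (t i) ω) (fun ω (i : Fin (n+1)) => hdp d S (t i) ω) (P 0) := by
  have := hS.prob 0
  have m1 := hist_meas (tlp_meas hS) t n
  have m2 := hist_meas (hdp_meas hS) t n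
  rw [indepFun_iff_map_prod_eq_prod_map_map m1.aemeasurable m2.aemeasurable]
  apply Measure.ext_of_singleton
  rintro ⟨y, a⟩
  have := (P 0).isProbabilityMeasure_map m2.aemeasurable
  rw [← Set.singleton_prod_singleton, Measure.prod_prod, Measure.map_apply m1 (measurableSet_singleton _),
    Measure.map_apply m2 (measurableSet_singleton _), Measure.map_apply (m1.prodMk m2) ((measurableSet_singleton _).prod (measurableSet_singleton _))]
  have h := joint_fact hd hS h0 ht n (fun i => if h : i ≤ n then y ⟨i, by omega⟩ else 0) (fun i => if h : i ≤ n then a ⟨i, by omega⟩ else 0)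
  have cv : ∀ (V : Type) (z : V) (S : ℝ → Ω → V) (y : Fin (n+1) → V) (ω : Ω), (∀ i ≤ n, S (t i) ω = (if h : i ≤ n then y ⟨i, by omega⟩ else z)) ↔
      (fun (i : Fin (n+1)) => S (t i) ω) = y := by
    intro V z S y ω
    rw [funext_iff]
    constructor
    · intro h i
      have := h i (by omega)
      rwa [dif_pos (by omega)] at this
    · intro h i hi
      rw [dif_pos hi]; exact h ⟨i, by omega⟩
  simp only [cv] at h
  exact h

lemma exists_grid (K : Finset ℝ≥0) : ∃ (t : ℕ → ℝ) (n : ℕ), 0 ≤ t 0 ∧ Monotone t ∧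
    ∀ s ∈ K, ∃ i : Fin (n+1), t i = s := by
  rcases K.eq_empty_or_nonempty with rfl | hK
  · exact ⟨fun _ => 0, 0, le_rfl, fun _ _ _ => le_rfl, by simp⟩
  have hc : 0 < K.card := hK.card_pos
  set e := K.orderEmbOfFin rfl
  refine ⟨fun j => e ⟨min j (K.card - 1), by omega⟩, K.card - 1, by positivity, ?_, ?_⟩
  · intro i j hij
    have : e ⟨min i (K.card - 1), by omega⟩ ≤ e ⟨min j (K.card - 1), by omega⟩ := e.monotone (by
      rw [Fin.mk_le_mk]; omega)
    exact_mod_cast this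
  · intro s hs
    have : s ∈ Set.range e := by rw [Finset.range_orderEmbOfFin]; exact hs
    obtain ⟨i, rfl⟩ := this
    refine ⟨⟨i, by omega⟩, ?_⟩
    have h2 : min (i:ℕ) (K.card - 1) = i := by omega
    simp only [h2]

lemma process_indep (hd : 0 < d) (hS : IsCTSRW (d+1) P S) :
    IndepFun (fun ω (s : ℝ≥0) => tlp d S s ω) (fun ω (s : ℝ≥0) => hdp d S s ω) (P 0) := by
  have := hS.prob 0
  apply IndepFun.process_indepFun_process (fun i => tlp_meas hS _) (fun i => hdp_meas hS _)
  intro I J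
  obtain ⟨t, n, h0, ht, hK⟩ := exists_grid (I ∪ J)
  choose! g hg using hK
  have h := (hist_indep hd hS h0 ht n).comp (φ := fun (v : Fin (n+1) → Fin d → ℤ) (i : I) => v (g i))
    (ψ := fun (v : Fin (n+1) → ℤ) (i : J) => v (g i)) (by fun_prop) (by fun_prop)
  convert h using 1
  · funext ω i
    simp only [Function.comp]
    rw [hg i (Finset.mem_union_left _ i.2)]
  · funext ω i
    simp only [Function.comp]
    rw [hg i (Finset.mem_union_right _ i.2)]

/-- The clock as an extended nonnegative integral along a path. -/
noncomputable def Acl {d : ℕ} (g : (Fin d → ℤ) → ENNReal) (Y : ℝ → Ω → (Fin d → ℤ)) (t : ℝ) (ω : Ω) : ENNReal :=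
  ∫⁻ u in Set.Ioc (0:ℝ) t, g (Y u ω)

/-- Riemann approximation as a functional of the path at countably many times. -/
noncomputable def Rie {d : ℕ} (g : (Fin d → ℤ) → ENNReal) (t : ℝ) (y : ℝ≥0 → (Fin d → ℤ)) : ENNReal :=
  ⨆ M : ℕ, limsup (fun m : ℕ => ∫⁻ u in Set.Ioc (0:ℝ) t, min (g (y (⌈u * (m+1)⌉₊ / (m+1)))) M) atTop

lemma Rie_meas {d : ℕ} (g : (Fin d → ℤ) → ENNReal) (t : ℝ) : Measurable (Rie g t) := by
  unfold Rie
  apply Measurable.iSup; intro M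
  apply Measurable.limsup; intro m
  apply Measurable.lintegral_prod_right' (f := fun p : (ℝ≥0 → (Fin d → ℤ)) × ℝ => min (g (p.1 (⌈p.2 * (m+1)⌉₊ / (m+1)))) M)
  apply Measurable.min _ measurable_const
  apply (measurable_of_countable g).comp
  have h : Measurable fun p : (ℝ≥0 → (Fin d → ℤ)) × ℕ => p.1 ((p.2 : ℝ≥0) / (m+1)) :=
    measurable_from_prod_countable_left fun n => measurable_pi_apply ((n : ℝ≥0) / (m+1))
  exact h.comp (measurable_fst.prodMk (Nat.measurable_ceil.comp (measurable_snd.mul_const _)))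

lemma ceil_tendsto (u : ℝ) (hu : 0 ≤ u) {ε : ℝ} (hε : 0 < ε) : ∀ᶠ m : ℕ in atTop, u ≤ (⌈u * (m+1)⌉₊ : ℝ) / (m+1) ∧
    (⌈u * (m+1)⌉₊ : ℝ) / (m+1) < u + ε := by
  have h : Tendsto (fun m : ℕ => (1:ℝ) / (m+1)) atTop (nhds 0) := tendsto_one_div_add_atTop_nhds_zero_nat
  filter_upwards [h.eventually (gt_mem_nhds hε)] with m hm
  have hm0 : (0:ℝ) < m + 1 := by positivity
  constructor
  · rw [le_div_iff₀ hm0]; exact Nat.le_ceil _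
  · rw [div_lt_iff₀ hm0]
    have h1 := Nat.ceil_lt_add_one (a := u * (m+1)) (by positivity)
    have h2 : 1 < ε * (m+1) := by rwa [div_lt_iff₀ hm0] at hm
    nlinarith

lemma Acl_eq_Rie {d : ℕ} (g : (Fin d → ℤ) → ENNReal) (Y : ℝ → Ω → (Fin d → ℤ)) (hm : Measurable fun p : ℝ × Ω => Y p.1 p.2)
    (t : ℝ) (ω : Ω)
    (hr : ∀ t : ℝ, 0 ≤ t → ∃ ε > (0 : ℝ), ∀ u, t ≤ u → u < t + ε → Y u ω = Y t ω) :
    Acl g Y t ω = Rie g t (fun s => Y s ω) := by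
  have hY : Measurable fun u => Y u ω := hm.comp (measurable_id.prodMk measurable_const)
  have gm := measurable_of_countable g
  unfold Acl Rie
  have h1 : ∀ v, g v = ⨆ M : ℕ, min (g v) M := by
    intro v
    have : (⨆ M : ℕ, min (g v) (M:ENNReal)) = min (g v) (⨆ M : ℕ, (M:ENNReal)) := by
      exact (inf_iSup_eq (g v) (fun M : ℕ => (M:ENNReal))).symm
    rw [this, ENNReal.iSup_natCast, min_eq_left le_top]
  calc _ = ∫⁻ u in Set.Ioc (0:ℝ) t, ⨆ M : ℕ, min (g (Y u ω)) M := by simp_rw [← h1]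
    _ = ⨆ M : ℕ, ∫⁻ u in Set.Ioc (0:ℝ) t, min (g (Y u ω)) M := by
      apply lintegral_iSup
      · intro M; exact (gm.comp hY).min measurable_const
      · intro M M' h u
        exact min_le_min le_rfl (by exact_mod_cast h)
    _ = _ := by
      congr 1; funext M
      symm
      apply Tendsto.limsup_eq
      apply tendsto_lintegral_of_dominated_convergence (fun _ => (M:ENNReal))
      · intro m
        apply Measurable.min _ measurable_const
        apply gm.comp
        apply hY.comp
        simp only [NNReal.coe_div]
        fun_prop
      · intro m; exact Eventually.of_forall fun u => min_le_right _ _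
      · simp [ENNReal.mul_eq_top]
      · rw [ae_restrict_iff' measurableSet_Ioc]
        refine Eventually.of_forall fun u hu => ?_
        obtain ⟨ε, hε, h⟩ := hr u hu.1.le
        apply tendsto_const_nhds.congr'
        filter_upwards [ceil_tendsto u hu.1.le hε] with m hm
        have : Y (((⌈u * (m+1)⌉₊ : ℝ≥0) / ((m:ℝ≥0)+1) : ℝ≥0) : ℝ) ω = Y u ω := by
          push_cast
          exact h _ hm.1 hm.2
        rw [this]

lemma tlp_jmeas (hS : IsCTSRW (d+1) P S) : Measurable fun p : ℝ × Ω => tlp d S p.1 p.2 :=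
  measurable_pi_lambda _ fun i => (measurable_pi_apply i.succ).comp hS.meas

lemma Acl_meas {d : ℕ} (g : (Fin d → ℤ) → ENNReal) {Y : ℝ → Ω → (Fin d → ℤ)} (hm : Measurable fun p : ℝ × Ω => Y p.1 p.2)
    (t : ℝ) : Measurable (Acl g Y t) := by
  unfold Acl
  apply Measurable.lintegral_prod_right' (f := fun p : Ω × ℝ => g (Y p.2 p.1))
  exact (measurable_of_countable g).comp (hm.comp measurable_swap)

lemma tlp_rc (hS : IsCTSRW (d+1) P S) : ∀ᵐ ω ∂(P 0), ∀ t : ℝ, 0 ≤ t →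
    ∃ ε > (0 : ℝ), ∀ u, t ≤ u → u < t + ε → tlp d S u ω = tlp d S t ω := by
  filter_upwards [hS.rightCont 0] with ω h t ht
  obtain ⟨ε, hε, h⟩ := h t ht
  exact ⟨ε, hε, fun u h1 h2 => by unfold tlp; rw [h u h1 h2]⟩

lemma hdp_rc (hS : IsCTSRW (d+1) P S) : ∀ᵐ ω ∂(P 0), ∀ t : ℝ, 0 ≤ t →
    ∃ ε > (0 : ℝ), ∀ u, t ≤ u → u < t + ε → hdp d S u ω = hdp d S t ω := by
  filter_upwards [hS.rightCont 0] with ω h t ht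
  obtain ⟨ε, hε, h⟩ := h t ht
  exact ⟨ε, hε, fun u h1 h2 => by unfold hdp; rw [h u h1 h2]⟩

lemma clock_eq {Ωz : Type*} (z : (Fin d → ℤ) → Ωz → ℝ) (hz : ∀ x ζ, 0 ≤ z x ζ)
    (hS : IsCTSRW (d+1) P S) (t : ℝ) (ζ : Ωz) (ω : Ω) :
    clock d z S t ζ ω = (Acl (fun v => ENNReal.ofReal (z v ζ)) (tlp d S) t ω).toReal := by
  unfold clock Acl
  rw [integral_eq_lintegral_of_nonneg_ae]
  · rfl
  · exact Eventually.of_forall fun u => hz _ _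
  · apply Measurable.aestronglyMeasurable
    apply (measurable_of_countable (fun v => z v ζ)).comp
    exact (tlp_jmeas hS).comp (measurable_id.prodMk (measurable_const (a := ω)))

/-- For fixed grid size, the representation formula. -/
lemma repr_grid (hd : 0 < d) (hS : IsCTSRW (d+1) P S) {t : ℝ} (ht : 0 ≤ t) (A : (ℝ≥0 → (Fin d → ℤ)) → ℝ)
    (hA : Measurable A) (k : ℤ) (w : Fin d → ℤ) (m : ℕ) :
    ∫⁻ ω, ind (tlp d S t ω = w) * ind (hdp d S ((⌈A (fun s => tlp d S s ω) * (m+1)⌉₊ : ℝ) / (m+1)) ω = k) ∂(P 0) =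
    ∫⁻ ω, ind (tlp d S t ω = w) * ENNReal.ofReal (h1 ((⌈A (fun s => tlp d S s ω) * (m+1)⌉₊ : ℝ) / (m+1)) k) ∂(P 0) := by
  set J : Ω → ℕ := fun ω => ⌈A (fun s => tlp d S s ω) * (m+1)⌉₊ with hJ
  have hYm : Measurable (fun ω (s : ℝ≥0) => tlp d S s ω) := measurable_pi_lambda _ fun s => tlp_meas hS _
  have hXm : Measurable (fun ω (s : ℝ≥0) => hdp d S s ω) := measurable_pi_lambda _ fun s => hdp_meas hS _
  have hJm : Measurable J := Nat.measurable_ceil.comp ((hA.comp hYm).mul_const _)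
  have mj : ∀ j, MeasurableSet {ω | J ω = j} := fun j => sing_meas hJm j
  have mY := sing_meas (tlp_meas hS t) w
  have mX : ∀ s, MeasurableSet {ω | hdp d S s ω = k} := fun s => sing_meas (hdp_meas hS s) k
  have e1 : ∀ ω, ind (tlp d S t ω = w) * ind (hdp d S ((J ω : ℝ) / (m+1)) ω = k) =
      ∑' j : ℕ, ind ((tlp d S t ω = w ∧ J ω = j) ∧ hdp d S ((j : ℝ) / (m+1)) ω = k) := by
    intro ω
    rw [← tsum_ind_mul (fun j : ℕ => ind (tlp d S t ω = w) * ind (hdp d S ((j : ℝ) / (m+1)) ω = k))]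
    congr 1; funext j
    rw [ind_and, ind_and]; ring
  have e2 : ∀ ω, ind (tlp d S t ω = w) * ENNReal.ofReal (h1 ((J ω : ℝ) / (m+1)) k) =
      ∑' j : ℕ, ind (tlp d S t ω = w ∧ J ω = j) * ENNReal.ofReal (h1 ((j : ℝ) / (m+1)) k) := by
    intro ω
    rw [← tsum_ind_mul (fun j : ℕ => ind (tlp d S t ω = w) * ENNReal.ofReal (h1 ((j : ℝ) / (m+1)) k))]
    congr 1; funext j
    rw [ind_and]; ring
  have m1 : ∀ j, MeasurableSet {ω | tlp d S t ω = w ∧ J ω = j} := fun j => mY.inter (mj j)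
  have m2 : ∀ j : ℕ, MeasurableSet {ω | (tlp d S t ω = w ∧ J ω = j) ∧ hdp d S ((j : ℝ) / (m+1)) ω = k} :=
    fun j => (m1 j).inter (mX _)
  refine (lintegral_congr e1).trans (Eq.trans ?_ (lintegral_congr e2).symm)
  rw [lintegral_tsum fun j => (measurable_ind (m2 j)).aemeasurable,
    lintegral_tsum fun j => ((measurable_ind (m1 j)).mul_const _).aemeasurable]
  congr 1; funext j
  rw [lintegral_ind _ (m2 j), lintegral_mul_const _ (measurable_ind (m1 j)), lintegral_ind _ (m1 j)]
  rw [← marg_X hd hS (by positivity)]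
  have hI := process_indep hd hS
  have := hI.measure_inter_preimage_eq_mul {y | y ⟨t, ht⟩ = w ∧ ⌈A y * (m+1)⌉₊ = j} {x | x ((j:ℝ≥0) / (m+1)) = k} ?_ ?_
  · simp only [preimage_setOf_eq, NNReal.coe_mk, NNReal.coe_div, NNReal.coe_natCast, NNReal.coe_add, NNReal.coe_one] at this
    exact this
  · exact (sing_meas (measurable_pi_apply _) w).inter (sing_meas (Nat.measurable_ceil.comp (hA.mul_const _)) j)
  · exact sing_meas (f := fun x : ℝ≥0 → ℤ => x ((j:ℝ≥0) / (m+1))) (measurable_pi_apply _) k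

theorem repr_formula {Ωz : Type*} (hd : 0 < d) (z : (Fin d → ℤ) → Ωz → ℝ) (hz : ∀ x ζ, 0 ≤ z x ζ)
    (hS : IsCTSRW (d+1) P S) {t : ℝ} (ht : 0 ≤ t) (ζ : Ωz) (k : ℤ) :
    P 0 {ω | layeredWalk d z S t ζ ω = (k, 0)} =
    ∫⁻ ω, ind (tlp d S t ω = 0) *
      ENNReal.ofReal (h1 (Acl (fun v => ENNReal.ofReal (z v ζ)) (tlp d S) t ω).toReal k) ∂(P 0) := by
  have := hS.prob 0
  set g : (Fin d → ℤ) → ENNReal := fun v => ENNReal.ofReal (z v ζ)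
  set A : (ℝ≥0 → (Fin d → ℤ)) → ℝ := fun y => (Rie g t y).toReal with hA
  have hAm : Measurable A := (Rie_meas g t).ennreal_toReal
  have hA0 : ∀ y, 0 ≤ A y := fun y => ENNReal.toReal_nonneg
  have hYm : Measurable (fun ω (s : ℝ≥0) => tlp d S s ω) := measurable_pi_lambda _ fun s => tlp_meas hS _
  have mY := sing_meas (tlp_meas hS t) 0
  have hae : ∀ᵐ ω ∂(P 0), A (fun s => tlp d S s ω) = (Acl g (tlp d S) t ω).toReal := by
    filter_upwards [tlp_rc hS] with ω h
    rw [Acl_eq_Rie g (tlp d S) (tlp_jmeas hS) t ω h]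
  have cm : Measurable fun ω => A (fun s => tlp d S s ω) := hAm.comp hYm
  have jm : Measurable fun p : ℝ × Ω => hdp d S p.1 p.2 := (measurable_pi_apply 0).comp hS.meas
  have am : Measurable fun ω => (Acl g (tlp d S) t ω).toReal := (Acl_meas g (tlp_jmeas hS) t).ennreal_toReal
  have tm : ∀ m : ℕ, Measurable fun ω => (⌈A (fun s => tlp d S s ω) * (m+1)⌉₊ : ℝ) / (m+1) := by
    intro m
    apply Measurable.div_const
    exact measurable_from_nat.comp (Nat.measurable_ceil.comp (cm.mul_const _))
  have L : Tendsto (fun m : ℕ => ∫⁻ ω, ind (tlp d S t ω = 0) * ind (hdp d S ((⌈A (fun s => tlp d S s ω) * (m+1)⌉₊ : ℝ) / (m+1)) ω = k) ∂(P 0)) atTop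
      (nhds (∫⁻ ω, ind (tlp d S t ω = 0) * ind (hdp d S (Acl g (tlp d S) t ω).toReal ω = k) ∂(P 0))) := by
    apply tendsto_lintegral_of_dominated_convergence (fun _ => 1)
    · intro m
      exact (measurable_ind mY).mul (measurable_ind (sing_meas (jm.comp ((tm m).prodMk measurable_id)) k))
    · intro m
      exact Eventually.of_forall fun ω => mul_le_one' (ind_le_one _) (ind_le_one _)
    · simp
    · filter_upwards [hae, hdp_rc hS] with ω h1 h2
      obtain ⟨ε, hε, h⟩ := h2 _ (hA0 (fun s => tlp d S s ω))
      apply tendsto_const_nhds.congr'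
      filter_upwards [ceil_tendsto _ (hA0 (fun s => tlp d S s ω)) hε] with m hm
      rw [h _ hm.1 hm.2, h1]
  have R : Tendsto (fun m : ℕ => ∫⁻ ω, ind (tlp d S t ω = 0) * ENNReal.ofReal (h1 ((⌈A (fun s => tlp d S s ω) * (m+1)⌉₊ : ℝ) / (m+1)) k) ∂(P 0)) atTop
      (nhds (∫⁻ ω, ind (tlp d S t ω = 0) * ENNReal.ofReal (h1 (Acl g (tlp d S) t ω).toReal k) ∂(P 0))) := by
    apply tendsto_lintegral_of_dominated_convergence (fun _ => 1)
    · intro m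
      exact (measurable_ind mY).mul ((h1_continuous k).measurable.comp (tm m)).ennreal_ofReal
    · intro m
      refine Eventually.of_forall fun ω => mul_le_one' (ind_le_one _) ?_
      simpa using h1_le_one (by positivity) _
    · simp
    · filter_upwards [hae] with ω e1
      apply ENNReal.Tendsto.const_mul _ (Or.inr (ind_le_one _ |>.trans_lt ENNReal.one_lt_top).ne)
      apply ENNReal.tendsto_ofReal
      apply ((h1_continuous k).tendsto _).comp
      rw [← e1]
      rw [Metric.tendsto_atTop]
      intro ε hε
      obtain ⟨N, hN⟩ := eventually_atTop.mp (ceil_tendsto _ (hA0 (fun s => tlp d S s ω)) hε)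
      refine ⟨N, fun m hm => ?_⟩
      have := hN m hm
      rw [Real.dist_eq, abs_lt]
      constructor <;> linarith [this.1, this.2]
  simp_rw [repr_grid hd hS ht A hAm] at L
  have E := tendsto_nhds_unique L R
  rw [← E]
  simp_rw [← ind_and]
  rw [lintegral_ind]
  · congr 1
    ext ω
    simp only [mem_setOf_eq, layeredWalk, Prod.mk.injEq, clock_eq z hz hS]
    unfold hdp tlp
    tauto
  · exact mY.inter (sing_meas (jm.comp (am.prodMk measurable_id)) k)
end
end LRC

set_option linter.all false

namespace LRC
open scoped NNReal

variable {Ω : Type*} [MeasurableSpace Ω]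

/-- The facts about the `d`-dimensional walk started from the origin that are used below. -/
structure Wk (d : ℕ) (P : Measure Ω) (Y : ℝ → Ω → (Fin d → ℤ)) : Prop where
  prob : IsProbabilityMeasure P
  jm : Measurable fun p : ℝ × Ω => Y p.1 p.2
  rc : ∀ᵐ ω ∂P, ∀ t : ℝ, 0 ≤ t → ∃ ε > (0 : ℝ), ∀ u, t ≤ u → u < t + ε → Y u ω = Y t ω
  markov : ∀ {t : ℕ → ℝ}, 0 ≤ t 0 → Monotone t → ∀ (n : ℕ) {u : ℝ}, t n ≤ u → ∀ (w : Fin d → ℤ)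
    {f : Ω → ENNReal}, Det Y t n f →
    ∫⁻ ω, f ω * ind (Y u ω = w) ∂P =
      ∫⁻ ω, f ω * ENNReal.ofReal (heatKernel d (u - t n) (Y (t n) ω) w) ∂P
  marg : ∀ {u : ℝ}, 0 ≤ u → ∀ w, P {ω | Y u ω = w} = ENNReal.ofReal (heatKernel d u 0 w)

lemma wk_of {d : ℕ} (hd : 0 < d) {P : (Fin (d+1) → ℤ) → Measure Ω} {S : ℝ → Ω → (Fin (d+1) → ℤ)}
    (hS : IsCTSRW (d+1) P S) : Wk d (P 0) (tlp d S) where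
  prob := hS.prob 0
  jm := tlp_jmeas hS
  rc := tlp_rc hS
  markov h0 ht n u hu w f hf := markov_Y hd hS 0 h0 ht n hu w hf
  marg hu w := marg_Y hd hS hu w

section
variable {d : ℕ} {P : Measure Ω} {Y : ℝ → Ω → (Fin d → ℤ)}

lemma Wk.meas (W : Wk d P Y) (t : ℝ) : Measurable (Y t) :=
  W.jm.comp (measurable_const.prodMk measurable_id)

/-- Two-point function. -/
lemma Wk.two (W : Wk d P Y) {s u : ℝ} (hs : 0 ≤ s) (hu : s ≤ u) (x w : Fin d → ℤ) :
    P {ω | Y s ω = x ∧ Y u ω = w} =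
      ENNReal.ofReal (heatKernel d s 0 x) * ENNReal.ofReal (heatKernel d (u - s) x w) := by
  have h := W.markov (t := fun _ => s) hs (fun _ _ _ => le_rfl) 0 hu w (f := fun ω => ind (Y s ω = x))
    (fun ω ω' h => congrArg (fun v => ind (v = x)) (h 0 le_rfl))
  have e : ∀ ω, ind (Y s ω = x) * ENNReal.ofReal (heatKernel d (u - s) (Y s ω) w) =
      ind (Y s ω = x) * ENNReal.ofReal (heatKernel d (u - s) x w) := by
    intro ω
    by_cases h : Y s ω = x
    · rw [h]
    · rw [ind_false h, zero_mul, zero_mul]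
  simp only [e, ← ind_and] at h
  have m3 : MeasurableSet {ω | Y s ω = x ∧ Y u ω = w} := (sing_meas (W.meas s) x).inter (sing_meas (W.meas u) w)
  rw [lintegral_ind _ m3,
    lintegral_mul_const _ (measurable_ind (sing_meas (W.meas s) x)), lintegral_ind _ (sing_meas (W.meas s) x), W.marg hs] at h
  exact h

lemma heat_shift (hd : 0 < d) (t : ℝ) (x y : Fin d → ℤ) : heatKernel d t x y = heatKernel d t 0 (y - x) := by
  rw [heat_eq_prod d hd, heat_eq_prod d hd]; simp

lemma Wk.heat_add (hd : 0 < d) (W : Wk d P Y) {s r : ℝ} (hs : 0 ≤ s) (hr : 0 ≤ r) (x y w : Fin d → ℤ) :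
    heatKernel d s x y * heatKernel d r y w ≤ heatKernel d (s + r) x w := by
  have := W.prob
  rw [heat_shift hd s, heat_shift hd (s+r), heat_shift hd r]
  have h := W.two hs (u := s + r) (by linarith) (y - x) (w - x)
  have h2 : P {ω | Y s ω = y - x ∧ Y (s+r) ω = w - x} ≤ P {ω | Y (s+r) ω = w - x} := measure_mono fun ω h => h.2
  rw [h, W.marg (by linarith), ← ENNReal.ofReal_mul (heat_nonneg d hs _ _)] at h2
  have h3 := (ENNReal.ofReal_le_ofReal_iff (heat_nonneg d (by linarith) _ _)).mp h2
  rw [add_sub_cancel_left, heat_shift hd r (y - x)] at h3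
  convert h3 using 3
  simp

lemma Wk.heat_hold (hd : 0 < d) (W : Wk d P Y) {s r : ℝ} (hs : 0 ≤ s) (hr : 0 ≤ r) (hr1 : r ≤ 1) (x y : Fin d → ℤ) :
    heatKernel d s x y ≤ Real.exp (2 * d) * heatKernel d (s + r) x y := by
  have h := W.heat_add hd hs hr x y y
  have h2 := heat_diag d hd hr y
  have h3 : Real.exp (-(2*d)) ≤ heatKernel d r y y := (Real.exp_le_exp.mpr (by
    have : (0:ℝ) ≤ d := Nat.cast_nonneg d
    nlinarith)).trans h2
  have h4 : heatKernel d s x y * Real.exp (-(2*d)) ≤ heatKernel d (s+r) x y :=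
    (mul_le_mul_of_nonneg_left h3 (heat_nonneg d hs _ _)).trans h
  have h5 : Real.exp (2 * (d:ℝ)) * Real.exp (-(2*d)) = 1 := by rw [← Real.exp_add]; simp
  calc heatKernel d s x y = Real.exp (2 * d) * (heatKernel d s x y * Real.exp (-(2*d))) := by
        rw [mul_comm (heatKernel d s x y), ← mul_assoc, h5, one_mul]
    _ ≤ _ := mul_le_mul_of_nonneg_left h4 (Real.exp_pos _).le

lemma Wk.hit_grid (hd : 0 < d) (W : Wk d P Y) {s : ℕ → ℝ} (h0 : 0 ≤ s 0) (hs : Monotone s) (m : ℕ)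
    (hm : s m ≤ s 0 + 1) {t : ℝ} (ht : s m ≤ t) (x w : Fin d → ℤ) :
    P {ω | (∃ i ≤ m, Y (s i) ω = x) ∧ Y t ω = w} ≤
      ENNReal.ofReal (Real.exp (4*d) * heatKernel d (s 0 + 1) 0 x * heatKernel d (t - s 0) x w) := by
  have := W.prob
  set F : ℕ → Ω → Prop := fun i ω => Y (s i) ω = x ∧ ∀ j < i, Y (s j) ω ≠ x with hF
  have Fd : ∀ i, Det Y s i (fun ω => ind (F i ω)) := by
    intro i ω ω' h
    refine congrArg ind (propext ?_)
    simp only [hF]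
    rw [h i le_rfl]
    refine and_congr Iff.rfl (forall₂_congr fun j hj => ?_)
    rw [h j hj.le]
  have Fm : ∀ i, MeasurableSet {ω | F i ω} := by
    intro i
    have h2 : MeasurableSet {ω | ∀ j < i, Y (s j) ω ≠ x} := by
      simp only [setOf_forall]
      exact MeasurableSet.iInter fun j => MeasurableSet.iInter fun _ => (sing_meas (W.meas _) x).compl
    exact (sing_meas (W.meas _) x).inter h2
  set f : ℕ → ENNReal := fun i => P {ω | F i ω} with hf
  have key : ∀ i ≤ m, ∀ u, s i ≤ u → ∀ v, P {ω | F i ω ∧ Y u ω = v} = f i * ENNReal.ofReal (heatKernel d (u - s i) x v) := by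
    intro i hi u hu v
    have h := W.markov h0 hs i hu v (Fd i)
    have e : ∀ ω, ind (F i ω) * ENNReal.ofReal (heatKernel d (u - s i) (Y (s i) ω) v) =
        ind (F i ω) * ENNReal.ofReal (heatKernel d (u - s i) x v) := by
      intro ω
      by_cases hh : F i ω
      · rw [hh.1]
      · rw [ind_false hh, zero_mul, zero_mul]
    simp only [e, ← ind_and] at h
    have m3 : MeasurableSet {ω | F i ω ∧ Y u ω = v} := (Fm i).inter (sing_meas (W.meas u) v)
    rwa [lintegral_ind _ m3, lintegral_mul_const _ (measurable_ind (Fm i)), lintegral_ind _ (Fm i)] at h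
  -- sum of first hit probabilities
  have hsum : ∑ i ∈ Finset.range (m+1), f i ≤ ENNReal.ofReal (Real.exp (2*d) * heatKernel d (s 0 + 1) 0 x) := by
    have h1 : ∀ i ∈ Finset.range (m+1), f i ≤ ENNReal.ofReal (Real.exp (2*d)) * P {ω | F i ω ∧ Y (s 0 + 1) ω = x} := by
      intro i hi
      have hi' : i ≤ m := by simpa [Nat.lt_succ_iff] using hi
      have hsi : s i ≤ s 0 + 1 := (hs hi').trans hm
      have hs0 : s 0 ≤ s i := hs (Nat.zero_le i)
      rw [key i hi' _ hsi, mul_left_comm, ← ENNReal.ofReal_mul (Real.exp_pos _).le]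
      have hdg := heat_diag d hd (t := s 0 + 1 - s i) (by linarith) x
      have : 1 ≤ Real.exp (2*d) * heatKernel d (s 0 + 1 - s i) x x := by
        calc (1:ℝ) ≤ Real.exp (2*d) * Real.exp (-(2*d*(s 0 + 1 - s i))) := by
              rw [← Real.exp_add]
              apply Real.one_le_exp
              have : (0:ℝ) ≤ d := Nat.cast_nonneg d
              nlinarith
          _ ≤ _ := mul_le_mul_of_nonneg_left hdg (Real.exp_pos _).le
      calc f i = f i * 1 := (mul_one _).symm
        _ ≤ _ := by gcongr; exact ENNReal.one_le_ofReal.mpr this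
    refine (Finset.sum_le_sum h1).trans ?_
    rw [← Finset.mul_sum, ENNReal.ofReal_mul (Real.exp_pos _).le, ← W.marg (by linarith)]
    gcongr
    rw [← measure_biUnion_finset]
    · apply measure_mono
      intro ω hω
      simp only [mem_iUnion] at hω
      obtain ⟨i, _, h⟩ := hω
      exact h.2
    · intro i _ j _ hij
      simp only [Function.onFun]
      rw [Set.disjoint_left]
      rintro ω ⟨h1, _⟩ ⟨h2, _⟩
      rcases lt_or_gt_of_ne hij with h | h
      · exact h2.2 i h h1.1
      · exact h1.2 j h h2.1
    · intro i _
      exact (Fm i).inter (sing_meas (W.meas _) _)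
  calc P {ω | (∃ i ≤ m, Y (s i) ω = x) ∧ Y t ω = w} ≤ P (⋃ i ∈ Finset.range (m+1), {ω | F i ω ∧ Y t ω = w}) := by
        apply measure_mono
        rintro ω ⟨⟨i, hi, h⟩, h2⟩
        classical
        have hex : ∃ i, Y (s i) ω = x := ⟨i, h⟩
        simp only [mem_iUnion]
        refine ⟨Nat.find hex, ?_, ⟨Nat.find_spec hex, fun j hj => Nat.find_min hex hj⟩, h2⟩
        have := Nat.find_min' hex h
        exact Finset.mem_range.mpr (by omega)
    _ ≤ ∑ i ∈ Finset.range (m+1), P {ω | F i ω ∧ Y t ω = w} := measure_biUnion_finset_le _ _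
    _ ≤ ∑ i ∈ Finset.range (m+1), f i * ENNReal.ofReal (Real.exp (2*d) * heatKernel d (t - s 0) x w) := by
        apply Finset.sum_le_sum
        intro i hi
        have hi' : i ≤ m := by simpa [Nat.lt_succ_iff] using hi
        have hsi : s i ≤ s 0 + 1 := (hs hi').trans hm
        have hs0 : s 0 ≤ s i := hs (Nat.zero_le i)
        have hst : s i ≤ t := (hs hi').trans ht
        rw [key i hi' t hst]
        gcongr
        have := W.heat_hold hd (s := t - s i) (r := s i - s 0) (by linarith) (by linarith) (by linarith) x w
        rwa [show t - s i + (s i - s 0) = t - s 0 by ring] at this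
    _ ≤ _ := by
        rw [← Finset.sum_mul]
        refine (mul_le_mul_left hsum _).trans ?_
        rw [← ENNReal.ofReal_mul]
        · apply le_of_eq; congr 1
          rw [show (4:ℝ)*d = 2*d+2*d by ring, Real.exp_add]; ring
        · exact mul_nonneg (Real.exp_pos _).le (heat_nonneg d (by linarith) _ _)

lemma Wk.hit (hd : 0 < d) (W : Wk d P Y) {a b t : ℝ} (ha : 0 ≤ a) (hab : a ≤ b) (hb : b ≤ a + 1) (hbt : b ≤ t)
    (x w : Fin d → ℤ) :
    P {ω | (∃ u ∈ Icc a b, Y u ω = x) ∧ Y t ω = w} ≤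
      ENNReal.ofReal (Real.exp (4*d) * heatKernel d (a + 1) 0 x * heatKernel d (t - a) x w) := by
  have := W.prob
  set s : ℕ → ℕ → ℝ := fun m i => a + i * (b - a) / 2 ^ m with hs
  have hs0 : ∀ m, s m 0 = a := by intro m; simp [hs]
  have hsl : ∀ m, s m (2^m) = b := by
    intro m; simp only [hs]; push_cast
    field_simp; ring
  have hsm : ∀ m, Monotone (s m) := by
    intro m i j hij
    simp only [hs]
    have : (i:ℝ) ≤ j := by exact_mod_cast hij
    have : 0 ≤ b - a := by linarith
    gcongr
  set E : ℕ → Set Ω := fun m => {ω | (∃ i ≤ 2^m, Y (s m i) ω = x) ∧ Y t ω = w} with hE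
  have hEm : Monotone E := by
    apply monotone_nat_of_le_succ
    rintro m ω ⟨⟨i, hi, h⟩, h2⟩
    refine ⟨⟨2*i, by rw [pow_succ]; omega, ?_⟩, h2⟩
    rw [← h]
    congr 1
    simp only [hs]; push_cast; rw [pow_succ]
    congr 1
    field_simp
  have sub : ∀ᵐ ω ∂P, ω ∈ {ω | (∃ u ∈ Icc a b, Y u ω = x) ∧ Y t ω = w} → ω ∈ ⋃ m, E m := by
    filter_upwards [W.rc] with ω hω
    rintro ⟨⟨u, hu, h⟩, h2⟩
    simp only [mem_iUnion]
    obtain ⟨ε, hε, hr⟩ := hω u (ha.trans hu.1)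
    rcases eq_or_lt_of_le hab with rfl | hlt
    · have : u = a := le_antisymm hu.2 hu.1
      exact ⟨0, ⟨0, by simp, by rw [hs0, ← this]; exact h⟩, h2⟩
    have hba : 0 < b - a := by linarith
    obtain ⟨m, hm⟩ := pow_unbounded_of_one_lt ((b - a) / ε) (one_lt_two)
    have hm' : (b - a) / 2 ^ m < ε := by
      rw [div_lt_iff₀ hε] at hm
      rw [div_lt_iff₀ (by positivity)]; linarith
    set i := ⌈(u - a) * 2 ^ m / (b - a)⌉₊ with hi
    have hq : 0 ≤ (u - a) * 2 ^ m / (b - a) := div_nonneg (mul_nonneg (by linarith [hu.1]) (by positivity)) hba.le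
    have i1 : i ≤ 2^m := by
      apply Nat.ceil_le.mpr
      push_cast
      rw [div_le_iff₀ hba]
      have : u - a ≤ b - a := by linarith [hu.2]
      rw [mul_comm]
      gcongr
    have i2 : u ≤ s m i := by
      have := Nat.le_ceil ((u - a) * 2 ^ m / (b - a))
      rw [← hi, div_le_iff₀ hba] at this
      have h3 : u - a ≤ i * (b - a) / 2 ^ m := by
        rw [le_div_iff₀ (by positivity)]; exact this
      simp only [hs]; linarith
    have i3 : s m i < u + ε := by
      have := Nat.ceil_lt_add_one hq
      rw [← hi] at this
      have h3 : (i:ℝ) * (b - a) / 2 ^ m < (u - a) + (b - a) / 2 ^ m := by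
        rw [div_lt_iff₀ (by positivity), add_mul, div_mul_cancel₀ _ (by positivity)]
        have := mul_lt_mul_of_pos_right this hba
        rw [add_mul, div_mul_cancel₀ _ hba.ne'] at this
        linarith
      simp only [hs]; linarith
    exact ⟨m, ⟨i, i1, by rw [hr _ i2 i3]; exact h⟩, h2⟩
  have hle : P {ω | (∃ u ∈ Icc a b, Y u ω = x) ∧ Y t ω = w} ≤ P (⋃ m, E m) := measure_mono_ae sub
  refine hle.trans ?_
  rw [hEm.measure_iUnion]
  apply iSup_le
  intro m
  have := W.hit_grid hd (s := s m) (by rw [hs0]; exact ha) (hsm m) (2^m) (by rw [hsl, hs0]; exact hb) (t := t)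
    (by rw [hsl]; exact hbt) x w
  rwa [hs0] at this

lemma Wk.hit' (hd : 0 < d) (W : Wk d P Y) {a b : ℝ} (ha : 0 ≤ a) (hab : a ≤ b) (hb : b ≤ a + 1)
    (x : Fin d → ℤ) :
    P {ω | ∃ u ∈ Icc a b, Y u ω = x} ≤ ENNReal.ofReal (Real.exp (4*d)) * ENNReal.ofReal (heatKernel d (a + 1) 0 x) := by
  calc _ ≤ P (⋃ w, {ω | (∃ u ∈ Icc a b, Y u ω = x) ∧ Y b ω = w}) := by
        apply measure_mono
        intro ω h
        simp only [mem_iUnion]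
        exact ⟨Y b ω, h, rfl⟩
    _ ≤ ∑' w, P {ω | (∃ u ∈ Icc a b, Y u ω = x) ∧ Y b ω = w} := measure_iUnion_le _
    _ ≤ ∑' w, ENNReal.ofReal (Real.exp (4*d) * heatKernel d (a + 1) 0 x) * ENNReal.ofReal (heatKernel d (b - a) x w) := by
        apply ENNReal.tsum_le_tsum
        intro w
        rw [← ENNReal.ofReal_mul (mul_nonneg (Real.exp_pos _).le (heat_nonneg d (by linarith) _ _))]
        exact W.hit hd ha hab hb le_rfl x w
    _ = _ := by
        rw [ENNReal.tsum_mul_left, heat_tsum d hd (by linarith), mul_one, ENNReal.ofReal_mul (Real.exp_pos _).le]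

/-- A.s. only finitely many sites are visited in bounded time. -/
lemma Wk.finite_range (hd : 0 < d) (W : Wk d P Y) (N : ℕ) :
    ∀ᵐ ω ∂P, {x | ∃ u ∈ Icc (0:ℝ) N, Y u ω = x}.Finite := by
  have := W.prob
  have h : ∀ j : ℕ, ∀ᵐ ω ∂P, {x | ∃ u ∈ Icc (j:ℝ) (j+1), Y u ω = x}.Finite := by
    intro j
    have := ae_finite_setOf_mem (μ := P) (s := fun x : Fin d → ℤ => {ω | ∃ u ∈ Icc (j:ℝ) (j+1), Y u ω = x}) (by
      have hle : ∑' x, P {ω | ∃ u ∈ Icc (j:ℝ) (j+1), Y u ω = x} ≤ ∑' x, ENNReal.ofReal (Real.exp (4*d)) * ENNReal.ofReal (heatKernel d (j + 1) 0 x) :=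
        ENNReal.tsum_le_tsum fun x => W.hit' hd (Nat.cast_nonneg j) (by linarith) le_rfl x
      rw [ENNReal.tsum_mul_left, heat_tsum d hd (by positivity), mul_one] at hle
      exact (hle.trans_lt ENNReal.ofReal_lt_top).ne)
    exact this
  filter_upwards [ae_all_iff.mpr h] with ω hω
  refine ((Set.finite_Iic N).biUnion fun j _ => hω j).subset ?_
  rintro x ⟨u, hu, hx⟩
  simp only [mem_iUnion]
  have h1 := Nat.floor_le hu.1
  have h2 := Nat.lt_floor_add_one u
  refine ⟨⌊u⌋₊, ?_, u, ⟨h1, h2.le⟩, hx⟩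
  exact_mod_cast h1.trans hu.2

lemma Wk.Acl_lt_top (hd : 0 < d) (W : Wk d P Y) (g : (Fin d → ℤ) → ENNReal) (hg : ∀ v, g v ≠ ⊤) :
    ∀ᵐ ω ∂P, ∀ t, Acl g Y t ω < ⊤ := by
  filter_upwards [ae_all_iff.mpr fun N => W.finite_range hd N] with ω hω t
  obtain ⟨N, hN⟩ := exists_nat_ge t
  set F := (hω N).toFinset
  have : Acl g Y t ω ≤ ∫⁻ u in Ioc (0:ℝ) t, ∑ v ∈ F, g v := by
    unfold Acl
    apply setLIntegral_mono' measurableSet_Ioc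
    intro u hu
    apply Finset.single_le_sum (f := g) (fun _ _ => zero_le)
    simp only [F, Set.Finite.mem_toFinset]
    exact ⟨u, ⟨hu.1.le, hu.2.trans hN⟩, rfl⟩
  refine this.trans_lt ?_
  simp only [lintegral_const]
  apply ENNReal.mul_lt_top
  · exact ENNReal.sum_lt_top.mpr fun v _ => (hg v).lt_top
  · simp

end
end LRC

set_option linter.all false

namespace LRC
open scoped NNReal

section
variable {Ω : Type*} [MeasurableSpace Ω]

lemma h1_ck {d : ℕ} (hd : 0 < d) {P : (Fin (d+1) → ℤ) → Measure Ω} {S : ℝ → Ω → (Fin (d+1) → ℤ)}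
    (hS : IsCTSRW (d+1) P S) {s r : ℝ} (hs : 0 ≤ s) (hr : 0 ≤ r) (k : ℤ) (F : Finset ℤ) :
    ∑ j ∈ F, h1 s j * h1 r (k - j) ≤ h1 (s + r) k := by
  have := hS.prob 0
  have two : ∀ j, P 0 {ω | hdp d S s ω = j ∧ hdp d S (s+r) ω = k} = ENNReal.ofReal (h1 s j * h1 r (k - j)) := by
    intro j
    have h := markov_X hd hS 0 (t := fun _ => s) hs (fun _ _ _ => le_rfl) 0 (u := s + r) (by linarith) k
      (f := fun ω => ind (hdp d S s ω = j)) (fun ω ω' h => congrArg (fun v => ind (v = j)) (h 0 le_rfl))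
    have e : ∀ ω, ind (hdp d S s ω = j) * ENNReal.ofReal (h1 (s + r - s) (k - hdp d S s ω)) =
        ind (hdp d S s ω = j) * ENNReal.ofReal (h1 r (k - j)) := by
      intro ω
      by_cases h : hdp d S s ω = j
      · rw [h]; simp
      · rw [ind_false h, zero_mul, zero_mul]
    simp only [e, ← ind_and] at h
    have m3 : MeasurableSet {ω | hdp d S s ω = j ∧ hdp d S (s+r) ω = k} :=
      (sing_meas (hdp_meas hS s) j).inter (sing_meas (hdp_meas hS _) k)
    rw [lintegral_ind _ m3, lintegral_mul_const _ (measurable_ind (sing_meas (hdp_meas hS s) j)),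
      lintegral_ind _ (sing_meas (hdp_meas hS s) j), marg_X hd hS hs, ← ENNReal.ofReal_mul (h1_nonneg hs _)] at h
    exact h
  rw [← ENNReal.ofReal_le_ofReal_iff (h1_nonneg (by linarith) _), ENNReal.ofReal_sum_of_nonneg
    (fun j _ => mul_nonneg (h1_nonneg hs _) (h1_nonneg hr _)), ← marg_X hd hS (by linarith)]
  simp only [← two]
  rw [← measure_biUnion_finset]
  · apply measure_mono
    intro ω hω
    simp only [mem_iUnion] at hω
    obtain ⟨j, _, h⟩ := hω
    exact h.2
  · intro i _ j _ hij
    simp only [Function.onFun]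
    rw [Set.disjoint_left]
    rintro ω ⟨h1, _⟩ ⟨h2, _⟩
    exact hij (h1.symm.trans h2)
  · intro j _
    exact (sing_meas (hdp_meas hS s) j).inter (sing_meas (hdp_meas hS _) k)

lemma h1_ge_far {d : ℕ} (hd : 0 < d) {P : (Fin (d+1) → ℤ) → Measure Ω} {S : ℝ → Ω → (Fin (d+1) → ℤ)}
    (hS : IsCTSRW (d+1) P S) (C : ℝ) (hC : 0 < C) :
    ∃ c > 0, ∃ s0 > (0:ℝ), ∀ s ≥ s0, ∀ k : ℤ, |(k:ℝ)| ≤ C * √s → c / √s ≤ h1 s k := by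
  obtain ⟨c, hc, hnear⟩ := h1_ge_near
  set s0 : ℝ := max 1 ((4 / c)^2) with hs0
  have hs0p : 0 < s0 := lt_of_lt_of_le one_pos (le_max_left _ _)
  have hs1 : ∀ s ≥ s0, 1 ≤ s := fun s hs => (le_max_left _ _).trans hs
  have hs2 : ∀ s ≥ s0, 1 ≤ c * √s / 4 := by
    intro s hs
    have : 4 / c ≤ √s := Real.le_sqrt_of_sq_le ((le_max_right _ _).trans hs)
    rw [div_le_iff₀ hc] at this
    linarith
  have main : ∀ j : ℕ, ∃ e > 0, ∀ s ≥ s0, ∀ k : ℤ, |(k:ℝ)| ≤ c * (1 + j / 2) * √s → e / √s ≤ h1 ((j+1) * s) k := by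
    intro j
    induction j with
    | zero =>
      refine ⟨c, hc, fun s hs k hk => ?_⟩
      have := hnear s (hs1 s hs) k (by simpa using hk)
      simpa using this
    | succ j ih =>
      obtain ⟨e, he, ih⟩ := ih
      refine ⟨c^2 * e / 4, by positivity, ?_⟩
      have pos : ∀ s ≥ s0, ∀ k : ℤ, 0 ≤ k → |(k:ℝ)| ≤ c * (1 + (j+1:ℕ) / 2) * √s →
          (c^2 * e / 4) / √s ≤ h1 (((j+1:ℕ)+1) * s) k := by
        intro s hs k hk0 hk
        have hsp : 0 < s := lt_of_lt_of_le one_pos (hs1 s hs)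
        have hq := Real.sqrt_pos.mpr hsp
        have hk0' : (0:ℝ) ≤ k := by exact_mod_cast hk0
        rw [abs_of_nonneg hk0'] at hk
        have hck := h1_ck hd hS hsp.le (r := (j+1) * s) (by positivity) k (Finset.Icc ⌈c*√s/2⌉ ⌊c*√s⌋)
        have hcard : c * √s / 4 ≤ ((Finset.Icc ⌈c*√s/2⌉ ⌊c*√s⌋).card : ℝ) := by
          rw [Int.card_Icc]
          have h1 := Int.ceil_lt_add_one (c*√s/2)
          have h2 := Int.lt_floor_add_one (c*√s)
          have h3 := hs2 s hs
          have h4 : (((⌊c*√s⌋ + 1 - ⌈c*√s/2⌉ : ℤ)) : ℝ) ≤ ((⌊c*√s⌋ + 1 - ⌈c*√s/2⌉).toNat : ℝ) := by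
            exact_mod_cast Int.self_le_toNat _
          push_cast at h4
          linarith
        have hterm : ∀ i ∈ Finset.Icc ⌈c*√s/2⌉ ⌊c*√s⌋, (c / √s) * (e / √s) ≤ h1 s i * h1 ((j+1)*s) (k - i) := by
          intro i hi
          rw [Finset.mem_Icc, Int.ceil_le, Int.le_floor] at hi
          have hj : (0:ℝ) ≤ j := Nat.cast_nonneg j
          have a0 : 0 ≤ c * √s := by positivity
          have a1 : c / √s ≤ h1 s i := hnear s (hs1 s hs) i (by rw [abs_of_nonneg (by linarith [hi.1])]; exact hi.2)
          have a2 : e / √s ≤ h1 ((j+1)*s) (k - i) := by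
            apply ih s hs
            push_cast at hk ⊢
            rw [abs_le]
            constructor
            · have : 0 ≤ c * √s * j := by positivity
              nlinarith
            · nlinarith [hi.1]
          exact mul_le_mul a1 a2 (by positivity) (h1_nonneg hsp.le _)
        have hsum := Finset.card_nsmul_le_sum _ _ _ hterm
        rw [nsmul_eq_mul] at hsum
        have : (c^2 * e / 4) / √s ≤ ((Finset.Icc ⌈c*√s/2⌉ ⌊c*√s⌋).card : ℝ) * ((c / √s) * (e / √s)) := by
          calc (c^2 * e / 4) / √s = (c * √s / 4) * ((c / √s) * (e / √s)) := by field_simp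
            _ ≤ _ := mul_le_mul_of_nonneg_right hcard (by positivity)
        refine this.trans (hsum.trans (hck.trans (le_of_eq ?_)))
        congr 1; push_cast; ring
      intro s hs k hk
      rcases le_total 0 k with h | h
      · exact pos s hs k h hk
      · rw [← h1_neg]
        exact pos s hs (-k) (by omega) (by simpa using hk)
  obtain ⟨j, hj⟩ := exists_nat_ge ((2 * C / c)^2)
  obtain ⟨e, he, hm⟩ := main j
  have hjp : (0:ℝ) < j + 1 := by positivity
  refine ⟨e, he, (j+1) * s0, by positivity, fun s hs k hk => ?_⟩
  have hss : s / (j+1) ≥ s0 := by rw [ge_iff_le, le_div_iff₀ hjp]; linarith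
  have hsp : 0 < s / (j+1) := lt_of_lt_of_le hs0p hss
  have hsp' : 0 < s := (div_pos_iff_of_pos_right hjp).mp hsp
  have h := hm (s / (j+1)) hss k (by
    refine hk.trans ?_
    have e1 : √s = √((j:ℝ)+1) * √(s/(j+1)) := by
      rw [← Real.sqrt_mul hjp.le]; congr 1; field_simp
    rw [e1, ← mul_assoc]
    refine mul_le_mul_of_nonneg_right ?_ (Real.sqrt_nonneg _)
    have e2 : 2 * C / c ≤ √((j:ℝ)+1) := Real.le_sqrt_of_sq_le (by linarith)
    rw [div_le_iff₀ hc] at e2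
    have e3 : √((j:ℝ)+1) * √((j:ℝ)+1) = j + 1 := Real.mul_self_sqrt hjp.le
    have e4 := Real.sqrt_nonneg ((j:ℝ)+1)
    nlinarith)
  have e5 : ((j:ℝ)+1) * (s / (j+1)) = s := by field_simp
  rw [e5] at h
  refine le_trans ?_ h
  apply div_le_div_of_nonneg_left he.le (Real.sqrt_pos.mpr hsp)
  apply Real.sqrt_le_sqrt
  apply div_le_self hsp'.le
  linarith [Nat.cast_nonneg (α := ℝ) j]

end
end LRC

set_option linter.all false

namespace LRC
open scoped NNReal

section
variable {Ω : Type*} [MeasurableSpace Ω]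
variable {d : ℕ} {P : Measure Ω} {Y : ℝ → Ω → (Fin d → ℤ)}

lemma Wk.vis_one (hd : 0 < d) (W : Wk d P Y) {t : ℝ} (ht : 2 ≤ t) (x : Fin d → ℤ) :
    P {ω | (∃ u ∈ Icc 0 t, Y u ω = x) ∧ Y t ω = 0} ≤
      ENNReal.ofReal (2 * Real.exp (6*d) * (t/2)^(-(d:ℝ)/2)) *
        ∑ j ∈ Finset.range (⌊t⌋₊+1), ENNReal.ofReal (heatKernel d (j+1) 0 x) := by
  set n := ⌊t⌋₊ with hn
  have hnt : (n:ℝ) ≤ t := Nat.floor_le (by linarith)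
  have htn : t < n + 1 := Nat.lt_floor_add_one t
  set T := (t/2)^(-(d:ℝ)/2) with hT
  have hT0 : 0 ≤ T := Real.rpow_nonneg (by linarith) _
  have hTle : ∀ s, t / 2 ≤ s → ∀ a b, heatKernel d s a b ≤ T := by
    intro s hs a b
    refine (heat_le d hd (by linarith) a b).trans ?_
    apply Real.rpow_le_rpow_of_nonpos (by linarith) hs
    have : (0:ℝ) ≤ d := Nat.cast_nonneg d
    linarith
  have e1 : 1 ≤ Real.exp (2*(d:ℝ)) := Real.one_le_exp (by positivity)
  have term : ∀ j ∈ Finset.range (n+1), P {ω | (∃ u ∈ Icc (j:ℝ) (min (j+1) t), Y u ω = x) ∧ Y t ω = 0} ≤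
      ENNReal.ofReal (Real.exp (6*d) * T * (heatKernel d (j+1) 0 x + heatKernel d ((n-j:ℕ)+1) 0 x)) := by
    intro j hj
    have hjn : j ≤ n := by simpa [Nat.lt_succ_iff] using hj
    have hjn' : (j:ℝ) ≤ n := by exact_mod_cast hjn
    refine (W.hit hd (Nat.cast_nonneg j) (b := min (j+1) t) (le_min (by linarith) (by linarith)) (min_le_left _ _) (min_le_right _ _) x 0).trans ?_
    apply ENNReal.ofReal_le_ofReal
    have q1 : 0 ≤ heatKernel d (j+1) 0 x := heat_nonneg d (by positivity) _ _
    have q2 : 0 ≤ heatKernel d (t-j) x 0 := heat_nonneg d (by linarith) _ _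
    have q3 : 0 ≤ heatKernel d ((n-j:ℕ)+1) 0 x := heat_nonneg d (by positivity) _ _
    have q4 : heatKernel d (t-j) x 0 ≤ Real.exp (2*d) * heatKernel d ((n-j:ℕ)+1) 0 x := by
      rw [heat_symm d hd]
      have := W.heat_hold hd (s := t - j) (r := n + 1 - t) (by linarith) (by linarith) (by linarith) 0 x
      rw [show t - j + (n + 1 - t) = ((n-j:ℕ):ℝ)+1 by push_cast [hjn]; ring] at this
      exact this
    have e6 : Real.exp (6*(d:ℝ)) = Real.exp (4*d) * Real.exp (2*d) := by rw [← Real.exp_add]; ring_nf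
    rw [e6, mul_assoc, mul_assoc, mul_assoc]
    apply mul_le_mul_of_nonneg_left _ (Real.exp_pos _).le
    rcases le_total (t/2) (j+1) with h | h
    · have := hTle _ h 0 x
      calc _ ≤ T * (Real.exp (2*d) * heatKernel d ((n-j:ℕ)+1) 0 x) := mul_le_mul this q4 q2 hT0
        _ ≤ T * (Real.exp (2*d) * (heatKernel d (j+1) 0 x + heatKernel d ((n-j:ℕ)+1) 0 x)) := by gcongr; linarith
        _ = _ := by ring
    · have := hTle (t - j) (by linarith) x 0
      calc _ ≤ heatKernel d (j+1) 0 x * T := mul_le_mul_of_nonneg_left this q1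
        _ = 1 * (T * heatKernel d (j+1) 0 x) := by ring
        _ ≤ Real.exp (2*d) * (T * (heatKernel d (j+1) 0 x + heatKernel d ((n-j:ℕ)+1) 0 x)) := by
            gcongr
            linarith
  calc _ ≤ P (⋃ j ∈ Finset.range (n+1), {ω | (∃ u ∈ Icc (j:ℝ) (min (j+1) t), Y u ω = x) ∧ Y t ω = 0}) := by
        apply measure_mono
        rintro ω ⟨⟨u, hu, h⟩, h2⟩
        simp only [mem_iUnion]
        refine ⟨⌊u⌋₊, Finset.mem_range.mpr (Nat.lt_succ_of_le (Nat.floor_le_floor hu.2)), ⟨u, ⟨Nat.floor_le hu.1, le_min (Nat.lt_floor_add_one u).le hu.2⟩, h⟩, h2⟩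
    _ ≤ ∑ j ∈ Finset.range (n+1), P {ω | (∃ u ∈ Icc (j:ℝ) (min (j+1) t), Y u ω = x) ∧ Y t ω = 0} :=
        measure_biUnion_finset_le _ _
    _ ≤ _ := Finset.sum_le_sum term
    _ = _ := by
        rw [← ENNReal.ofReal_sum_of_nonneg, ← ENNReal.ofReal_sum_of_nonneg, ← ENNReal.ofReal_mul (by positivity)]
        · congr 1
          rw [← Finset.mul_sum, Finset.sum_add_distrib]
          have := Finset.sum_range_reflect (fun j => heatKernel d ((j:ℝ)+1) 0 x) (n+1)
          simp only [Nat.add_sub_cancel] at this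
          rw [this]; ring
        · intro j _; exact heat_nonneg d (by positivity) _ _
        · intro j _
          have q1 : 0 ≤ heatKernel d (j+1) 0 x := heat_nonneg d (by positivity) _ _
          have q3 : 0 ≤ heatKernel d ((n-j:ℕ)+1) 0 x := heat_nonneg d (by positivity) _ _
          positivity

/-- The probability of visiting a set `D` during a bridge. -/
lemma Wk.vis (hd : 0 < d) (W : Wk d P Y) {t : ℝ} (ht : 2 ≤ t) (D : (Fin d → ℤ) → Prop) :
    P {ω | (∃ u ∈ Icc 0 t, D (Y u ω)) ∧ Y t ω = 0} ≤
      ENNReal.ofReal (2 * Real.exp (6*d) * (t/2)^(-(d:ℝ)/2)) *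
        ∑' x, ind (D x) * ∑ j ∈ Finset.range (⌊t⌋₊+1), ENNReal.ofReal (heatKernel d (j+1) 0 x) := by
  calc _ ≤ P (⋃ x, {ω | D x ∧ ((∃ u ∈ Icc 0 t, Y u ω = x) ∧ Y t ω = 0)}) := by
        apply measure_mono
        rintro ω ⟨⟨u, hu, h⟩, h2⟩
        simp only [mem_iUnion]
        exact ⟨Y u ω, h, ⟨u, hu, rfl⟩, h2⟩
    _ ≤ ∑' x, P {ω | D x ∧ ((∃ u ∈ Icc 0 t, Y u ω = x) ∧ Y t ω = 0)} := measure_iUnion_le _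
    _ ≤ _ := by
        rw [← ENNReal.tsum_mul_left]
        apply ENNReal.tsum_le_tsum
        intro x
        by_cases h : D x
        · rw [ind_true h, one_mul]
          simp only [h, true_and]
          exact W.vis_one hd ht x
        · simp [h]

/-- Green-function type constant. -/
lemma green_fin (hd : 3 ≤ d) : ∃ G : ℝ≥0, 0 < G ∧ ∀ x : Fin d → ℤ, ∀ m : ℕ,
    ∑ j ∈ Finset.range m, ENNReal.ofReal (heatKernel d (j+1) x x) ≤ G := by
  have hs : Summable fun j : ℕ => ((j+1:ℕ):ℝ)^(-(3/2):ℝ) := by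
    rw [summable_nat_add_iff (f := fun j : ℕ => (j:ℝ)^(-(3/2):ℝ)) 1]
    exact Real.summable_nat_rpow.mpr (by norm_num)
  have hG0 : 0 ≤ ∑' j : ℕ, ((j+1:ℕ):ℝ)^(-(3/2):ℝ) := tsum_nonneg fun j => Real.rpow_nonneg (by positivity) _
  refine ⟨⟨∑' j : ℕ, ((j+1:ℕ):ℝ)^(-(3/2):ℝ), hG0⟩ + 1, by positivity, fun x m => ?_⟩
  rw [← ENNReal.ofReal_sum_of_nonneg (fun j _ => heat_nonneg d (by positivity) _ _)]
  calc _ ≤ ENNReal.ofReal (∑' j : ℕ, ((j+1:ℕ):ℝ)^(-(3/2):ℝ)) := by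
        apply ENNReal.ofReal_le_ofReal
        refine le_trans (Finset.sum_le_sum fun j _ => ?_) (hs.sum_le_tsum (Finset.range m) fun j _ => Real.rpow_nonneg (by positivity) _)
        push_cast
        refine (heat_le d (by omega) (by positivity) x x).trans ?_
        apply Real.rpow_le_rpow_of_exponent_le (by linarith [Nat.cast_nonneg (α := ℝ) j])
        have : (3:ℝ) ≤ d := by exact_mod_cast hd
        linarith
    _ ≤ _ := by
        rw [ENNReal.ofReal_eq_coe_nnreal hG0]
        exact_mod_cast le_self_add

/-- Exponential functional of the number of visits along a grid. -/
noncomputable def Vf (s : ENNReal) (Y : ℝ → Ω → (Fin d → ℤ)) (v : ℝ) (x : Fin d → ℤ) (m : ℕ) (ω : Ω) : ENNReal :=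
  ∏ i ∈ Finset.range m, (1 + s * ind (Y (v + i) ω = x))

lemma Vf_eq (s : ENNReal) (Y : ℝ → Ω → (Fin d → ℤ)) (v : ℝ) (x : Fin d → ℤ) (m : ℕ) (ω : Ω) :
    Vf s Y v x m ω = 1 + s * ∑ j ∈ Finset.range m, Vf s Y v x j ω * ind (Y (v + j) ω = x) := by
  induction m with
  | zero => simp [Vf]
  | succ m ih =>
    rw [Finset.sum_range_succ, mul_add, ← add_assoc, ← ih]
    unfold Vf
    rw [Finset.prod_range_succ]
    ring

lemma Vf_le (s : ENNReal) (Y : ℝ → Ω → (Fin d → ℤ)) (v : ℝ) (x : Fin d → ℤ) (m : ℕ) (ω : Ω) :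
    Vf s Y v x m ω ≤ (1 + s)^m := by
  unfold Vf
  calc _ ≤ ∏ i ∈ Finset.range m, (1 + s) := by
        apply Finset.prod_le_prod' 
        intro i _
        gcongr
        calc s * ind _ ≤ s * 1 := by gcongr; exact ind_le_one _
          _ = s := mul_one s
    _ = _ := by simp

lemma Vf_meas (W : Wk d P Y) (s : ENNReal) (v : ℝ) (x : Fin d → ℤ) (m : ℕ) :
    Measurable (Vf s Y v x m) := by
  unfold Vf
  apply Finset.measurable_prod
  intro i _
  exact ((measurable_ind (sing_meas (W.meas _) x)).const_mul s).const_add 1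

lemma Wk.Vf_int (W : Wk d P Y) {s : ENNReal} {G : ℝ≥0} (hs : s * G ≤ 1/2) (hs' : s ≠ ⊤)
    (hG : ∀ x : Fin d → ℤ, ∀ m : ℕ, ∑ j ∈ Finset.range m, ENNReal.ofReal (heatKernel d (j+1) x x) ≤ G)
    {v : ℝ} (hv : 0 ≤ v) (x : Fin d → ℤ) (m : ℕ) :
    ∑ j ∈ Finset.range m, ∫⁻ ω, Vf s Y v x j ω * ind (Y (v + j) ω = x) ∂P ≤
      2 * ∑ j ∈ Finset.range m, P {ω | Y (v + j) ω = x} := by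
  have := W.prob
  set b : ℕ → ENNReal := fun j => ∫⁻ ω, Vf s Y v x j ω * ind (Y (v + j) ω = x) ∂P with hb
  set p : ℕ → ENNReal := fun j => P {ω | Y (v + j) ω = x} with hp
  have mono : Monotone fun i : ℕ => v + (i:ℝ) := fun i j h => by
    have : (i:ℝ) ≤ j := by exact_mod_cast h
    simp only; linarith
  have mi : ∀ j : ℕ, Measurable fun ω => ind (Y (v + j) ω = x) := fun j => measurable_ind (sing_meas (W.meas _) x)
  have rec1 : ∀ j, b j = p j + s * ∑ i ∈ Finset.range j, b i * ENNReal.ofReal (heatKernel d ((j-i:ℕ)) x x) := by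
    intro j
    have e : ∀ ω, Vf s Y v x j ω * ind (Y (v + j) ω = x) = ind (Y (v + j) ω = x) +
        s * ∑ i ∈ Finset.range j, Vf s Y v x i ω * ind (Y (v + i) ω = x) * ind (Y (v + j) ω = x) := by
      intro ω
      rw [Vf_eq, add_mul, one_mul, mul_assoc, Finset.sum_mul]
    have hbj : b j = ∫⁻ ω, (ind (Y (v + j) ω = x) +
        s * ∑ i ∈ Finset.range j, Vf s Y v x i ω * ind (Y (v + i) ω = x) * ind (Y (v + j) ω = x)) ∂P := lintegral_congr e
    rw [hbj, lintegral_add_left (mi j), lintegral_ind _ (sing_meas (W.meas _) x), lintegral_const_mul, lintegral_finsetSum]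
    · congr 2
      apply Finset.sum_congr rfl
      intro i hi
      have hij : i < j := Finset.mem_range.mp hi
      have hij' : (i:ℝ) ≤ j := by exact_mod_cast hij.le
      have hdet : Det Y (fun i : ℕ => v + (i:ℝ)) i (fun ω => Vf s Y v x i ω * ind (Y (v + i) ω = x)) := by
        intro ω ω' h
        simp only
        have h1 := h i le_rfl
        simp only at h1
        rw [h1]
        congr 1
        unfold Vf
        apply Finset.prod_congr rfl
        intro k hk
        have h2 := h k (Finset.mem_range.mp hk).le
        simp only at h2
        rw [h2]
      have h := W.markov (t := fun i : ℕ => v + (i:ℝ)) (by simpa using hv) mono i (u := v + j) (by linarith) x hdet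
      rw [h]
      have hmc : b i * ENNReal.ofReal (heatKernel d ((j-i:ℕ)) x x) = ∫⁻ ω, Vf s Y v x i ω * ind (Y (v + i) ω = x) * ENNReal.ofReal (heatKernel d ((j-i:ℕ)) x x) ∂P :=
        (lintegral_mul_const _ ((Vf_meas W s v x i).mul (mi i))).symm
      rw [hmc]
      apply lintegral_congr
      intro ω
      by_cases hx : Y (v + i) ω = x
      · rw [hx]
        congr 3
        push_cast [hij.le]; ring
      · rw [ind_false hx]; simp
    · intro i _; exact ((Vf_meas W s v x i).mul (mi i)).mul (mi j)
    · exact Finset.measurable_sum _ fun i _ => ((Vf_meas W s v x i).mul (mi i)).mul (mi j)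
  have bfin : ∀ j, b j ≠ ⊤ := by
    intro j
    have : b j ≤ ∫⁻ ω, (1+s)^j ∂P := by
      apply lintegral_mono
      intro ω
      calc _ ≤ (1+s)^j * 1 := mul_le_mul' (Vf_le _ _ _ _ _ _) (ind_le_one _)
        _ = _ := mul_one _
    rw [lintegral_const, measure_univ, mul_one] at this
    exact ne_top_of_le_ne_top (ENNReal.pow_ne_top (by simp [hs'])) this
  have hB : ∑ j ∈ Finset.range m, b j ≤ ∑ j ∈ Finset.range m, p j + (1/2) * ∑ j ∈ Finset.range m, b j := by
    calc ∑ j ∈ Finset.range m, b j = ∑ j ∈ Finset.range m, p j + s * ∑ j ∈ Finset.range m, ∑ i ∈ Finset.range j, b i * ENNReal.ofReal (heatKernel d ((j-i:ℕ)) x x) := by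
          rw [Finset.mul_sum, ← Finset.sum_add_distrib]
          exact Finset.sum_congr rfl fun j _ => rec1 j
      _ ≤ ∑ j ∈ Finset.range m, p j + s * ∑ i ∈ Finset.range m, b i * G := by
          refine add_le_add le_rfl (mul_le_mul_right ?_ s)
          rw [Finset.sum_sigma', Finset.sum_bij' (t := (Finset.range m).sigma fun i => Finset.range (m - 1 - i))
            (g := fun q => b q.1 * ENNReal.ofReal (heatKernel d (q.2+1) x x))
            (fun q _ => ⟨q.2, q.1 - 1 - q.2⟩) (fun q _ => ⟨q.1 + 1 + q.2, q.1⟩), Finset.sum_sigma]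
          · apply Finset.sum_le_sum
            intro i _
            dsimp only
            rw [← Finset.mul_sum]
            gcongr
            exact hG x _
          · rintro ⟨j, i⟩ h; simp only [Finset.mem_sigma, Finset.mem_range] at h ⊢; omega
          · rintro ⟨j, i⟩ h; simp only [Finset.mem_sigma, Finset.mem_range] at h ⊢; omega
          · rintro ⟨j, i⟩ h; simp only [Finset.mem_sigma, Finset.mem_range] at h ⊢
            rw [show i + 1 + (j - 1 - i) = j by omega]
          · rintro ⟨j, i⟩ h; simp only [Finset.mem_sigma, Finset.mem_range] at h ⊢
            rw [show j + 1 + i - 1 - j = i by omega]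
          · rintro ⟨j, i⟩ h; simp only [Finset.mem_sigma, Finset.mem_range] at h ⊢
            congr 3
            rw [show j - i = (j - 1 - i) + 1 by omega]; push_cast; rfl
      _ = ∑ j ∈ Finset.range m, p j + (s * G) * ∑ j ∈ Finset.range m, b j := by rw [← Finset.sum_mul]; ring
      _ ≤ _ := by gcongr
  have hBfin : ∑ j ∈ Finset.range m, b j ≠ ⊤ := (ENNReal.sum_lt_top.mpr fun j _ => (bfin j).lt_top).ne
  set B := ∑ j ∈ Finset.range m, b j
  have hsplit : B = (1/2) * B + (1/2) * B := by rw [← add_mul]; simp [ENNReal.inv_two_add_inv_two]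
  have hle : (1/2) * B ≤ ∑ j ∈ Finset.range m, p j := by
    have h2 : (1/2) * B + (1/2) * B ≤ ∑ j ∈ Finset.range m, p j + (1/2) * B := by rw [← hsplit]; exact hB
    exact (ENNReal.add_le_add_iff_right (ENNReal.mul_ne_top (by simp) hBfin)).mp h2
  calc B = 2 * ((1/2) * B) := by
        rw [← mul_assoc]; simp [ENNReal.mul_inv_cancel]
    _ ≤ _ := by gcongr

end
end LRC

set_option linter.all false

namespace LRC
open scoped NNReal

section
variable {Ω : Type*} [MeasurableSpace Ω]
variable {d : ℕ} {P : Measure Ω} {Y : ℝ → Ω → (Fin d → ℤ)}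

/-- number of visits to `x` along the grid `v, v+1, …` -/
noncomputable def Nf (Y : ℝ → Ω → (Fin d → ℤ)) (v : ℝ) (x : Fin d → ℤ) (m : ℕ) (ω : Ω) : ENNReal :=
  ∑ j ∈ Finset.range m, ind (Y (v + j) ω = x)

lemma Vf_ge (s : ENNReal) (Y : ℝ → Ω → (Fin d → ℤ)) (v : ℝ) (x : Fin d → ℤ) (ω : Ω) (m : ℕ) :
    ∃ k : ℕ, Nf Y v x m ω = k ∧ Vf s Y v x m ω = (1+s)^k := by
  induction m with
  | zero => exact ⟨0, by simp [Nf], by simp [Vf]⟩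
  | succ m ih =>
    obtain ⟨k, h1, h2⟩ := ih
    unfold Nf at h1 ⊢
    unfold Vf at h2 ⊢
    rw [Finset.sum_range_succ, Finset.prod_range_succ, h1, h2]
    by_cases h : Y (v + m) ω = x
    · rw [ind_true h]
      exact ⟨k+1, by push_cast; rfl, by rw [mul_one, pow_succ]⟩
    · rw [ind_false h]
      exact ⟨k, by simp, by simp⟩

lemma Nf_imp (s : ENNReal) (Y : ℝ → Ω → (Fin d → ℤ)) (v : ℝ) (x : Fin d → ℤ) (ω : Ω) (L m : ℕ)
    (h : (L:ENNReal) < Nf Y v x m ω) :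
    (1+s)^L ≤ ∑ j ∈ Finset.range m, Vf s Y v x j ω * ind (Y (v + j) ω = x) := by
  induction m with
  | zero => simp [Nf] at h
  | succ m ih =>
    rw [Finset.sum_range_succ]
    by_cases hx : Y (v + m) ω = x
    · obtain ⟨k, h1, h2⟩ := Vf_ge s Y v x ω m
      refine le_trans ?_ le_add_self
      rw [ind_true hx, mul_one, h2]
      have : (L:ENNReal) < ((k+1:ℕ):ENNReal) := by
        unfold Nf at h h1
        rw [Finset.sum_range_succ, h1, ind_true hx] at h
        exact_mod_cast h
      have hLk : L ≤ k := Nat.lt_succ_iff.mp (by exact_mod_cast this)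
      exact pow_le_pow_right' le_self_add hLk
    · refine le_trans (ih ?_) le_self_add
      unfold Nf at h ⊢
      rwa [Finset.sum_range_succ, ind_false hx, add_zero] at h

lemma Nf_meas (W : Wk d P Y) (v : ℝ) (x : Fin d → ℤ) (m : ℕ) : Measurable (Nf Y v x m) := by
  unfold Nf
  exact Finset.measurable_sum _ fun i _ => measurable_ind (sing_meas (W.meas _) x)

lemma Nf_jmeas (W : Wk d P Y) (x : Fin d → ℤ) (m : ℕ) : Measurable fun p : Ω × ℝ => Nf Y p.2 x m p.1 := by
  unfold Nf
  refine Finset.measurable_sum _ fun i _ => measurable_ind (p := fun p : Ω × ℝ => Y (p.2 + i) p.1 = x) ?_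
  have : Measurable fun p : Ω × ℝ => Y (p.2 + i) p.1 :=
    W.jm.comp ((measurable_snd.add_const _).prodMk measurable_fst)
  exact sing_meas this x

lemma Wk.Nf_tail (hd : 0 < d) (W : Wk d P Y) {s : ENNReal} {G : ℝ≥0} (hs : s * G ≤ 1/2) (hs' : s ≠ ⊤)
    (hG : ∀ x : Fin d → ℤ, ∀ m : ℕ, ∑ j ∈ Finset.range m, ENNReal.ofReal (heatKernel d (j+1) x x) ≤ G)
    {v : ℝ} (hv : 0 ≤ v) (m L : ℕ) :
    (1+s)^L * ∑' x, P {ω | (L:ENNReal) < Nf Y v x m ω} ≤ 2 * m := by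
  have one : ∀ x, (1+s)^L * P {ω | (L:ENNReal) < Nf Y v x m ω} ≤ 2 * ∑ j ∈ Finset.range m, ENNReal.ofReal (heatKernel d (v + j) 0 x) := by
    intro x
    have mm : ∀ j : ℕ, Measurable fun ω => Vf s Y v x j ω * ind (Y (v + j) ω = x) := fun j =>
      (Vf_meas W s v x j).mul (measurable_ind (sing_meas (W.meas _) x))
    calc (1+s)^L * P {ω | (L:ENNReal) < Nf Y v x m ω}
        ≤ (1+s)^L * P {ω | (1+s)^L ≤ ∑ j ∈ Finset.range m, Vf s Y v x j ω * ind (Y (v + j) ω = x)} := by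
          gcongr with ω
          exact fun h => Nf_imp s Y v x ω L m h
      _ ≤ ∫⁻ ω, ∑ j ∈ Finset.range m, Vf s Y v x j ω * ind (Y (v + j) ω = x) ∂P :=
          mul_meas_ge_le_lintegral (Finset.measurable_sum _ fun j _ => mm j) _
      _ = ∑ j ∈ Finset.range m, ∫⁻ ω, Vf s Y v x j ω * ind (Y (v + j) ω = x) ∂P := lintegral_finsetSum _ fun j _ => mm j
      _ ≤ 2 * ∑ j ∈ Finset.range m, P {ω | Y (v + j) ω = x} := W.Vf_int hs hs' hG hv x m
      _ = _ := by
          congr 1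
          exact Finset.sum_congr rfl fun j _ => W.marg (by positivity) x
  rw [← ENNReal.tsum_mul_left]
  refine (ENNReal.tsum_le_tsum one).trans ?_
  rw [ENNReal.tsum_mul_left, Summable.tsum_finsetSum (fun _ _ => ENNReal.summable)]
  gcongr
  have : ∀ j ∈ Finset.range m, ∑' x, ENNReal.ofReal (heatKernel d (v + j) 0 x) = 1 := fun j _ => heat_tsum d hd (by positivity) 0
  rw [Finset.sum_congr rfl this]
  simp

/-- local time -/
noncomputable def lt (Y : ℝ → Ω → (Fin d → ℤ)) (n : ℕ) (x : Fin d → ℤ) (ω : Ω) : ENNReal :=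
  Acl (fun v => ind (v = x)) Y n ω

lemma lintegral_Ioc_nat (g : ℝ → ENNReal) (hg : Measurable g) (n : ℕ) :
    ∫⁻ u in Ioc (0:ℝ) n, g u = ∫⁻ v in Ioc (0:ℝ) 1, ∑ j ∈ Finset.range n, g (v + j) := by
  have hgm : ∀ j ∈ Finset.range n, Measurable fun v : ℝ => g (v + j) := fun j _ => hg.comp (measurable_id.add_const _)
  rw [lintegral_finsetSum _ hgm]
  clear hgm
  induction n with
  | zero => simp
  | succ n ih =>
    rw [Finset.sum_range_succ, ← ih]
    have hu : Ioc (0:ℝ) ((n+1:ℕ):ℝ) = Ioc (0:ℝ) n ∪ Ioc (n:ℝ) (n+1) := by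
      rw [Ioc_union_Ioc_eq_Ioc (by positivity) (by linarith)]; push_cast; rfl
    rw [hu, lintegral_union measurableSet_Ioc (by
      rw [Set.disjoint_left]; intro x h1 h2; exact absurd h1.2 (not_le.mpr h2.1))]
    congr 1
    have := (measurePreserving_add_right (volume : Measure ℝ) (n:ℝ)).setLIntegral_comp_preimage
      (s := Ioc (n:ℝ) (n+1)) measurableSet_Ioc hg
    rw [← this]
    congr 2
    ext v; simp [add_comm]

lemma Nf_le (Y : ℝ → Ω → (Fin d → ℤ)) (v : ℝ) (x : Fin d → ℤ) (m : ℕ) (ω : Ω) : Nf Y v x m ω ≤ m := by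
  unfold Nf
  calc _ ≤ ∑ j ∈ Finset.range m, (1:ENNReal) := Finset.sum_le_sum fun j _ => ind_le_one _
    _ = m := by simp

lemma Wk.lt_eq (W : Wk d P Y) (n : ℕ) (x : Fin d → ℤ) (ω : Ω) : lt Y n x ω = ∫⁻ v in Ioc (0:ℝ) 1, Nf Y v x n ω := by
  unfold lt Acl Nf
  apply lintegral_Ioc_nat (fun u => ind (Y u ω = x))
  have : Measurable fun u : ℝ => Y u ω := W.jm.comp (measurable_id.prodMk measurable_const)
  exact measurable_ind (sing_meas this x)

lemma Wk.lt_tail (hd : 3 ≤ d) (W : Wk d P Y) : ∃ ρ > (1:ℝ), ∀ n L : ℕ, 1 ≤ L →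
    P {ω | ∃ x, ((2*L:ℕ):ENNReal) < lt Y n x ω} ≤ ENNReal.ofReal (2 * n^2 * (ρ^L)⁻¹) := by
  have := W.prob
  obtain ⟨G, hG0, hG⟩ := green_fin hd
  set s : ℝ≥0 := 1 / (2 * G) with hs
  have hs0 : 0 < s := by positivity
  have hsG : (s:ENNReal) * G ≤ 1/2 := by
    have : s * G = 1/2 := by rw [hs]; field_simp
    rw [← ENNReal.coe_mul, this]; simp
  refine ⟨1 + s, by simpa using hs0, fun n L hL => ?_⟩
  have tail := fun v (hv : 0 ≤ v) => W.Nf_tail (by omega) hsG ENNReal.coe_ne_top hG (v := v) hv n L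
  have one : ∀ x, P {ω | ((2*L:ℕ):ENNReal) < lt Y n x ω} ≤ n * ∫⁻ v in Ioc (0:ℝ) 1, P {ω | (L:ENNReal) < Nf Y v x n ω} := by
    intro x
    have jm : Measurable fun p : Ω × ℝ => ind ((L:ENNReal) < Nf Y p.2 x n p.1) :=
      measurable_ind (measurableSet_lt measurable_const (Nf_jmeas W x n))
    have imp : ∀ ω, ((2*L:ℕ):ENNReal) < lt Y n x ω → (1:ENNReal) ≤ n * ∫⁻ v in Ioc (0:ℝ) 1, ind ((L:ENNReal) < Nf Y v x n ω) := by
      intro ω h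
      rw [W.lt_eq] at h
      have h2 : ∫⁻ v in Ioc (0:ℝ) 1, Nf Y v x n ω ≤ ∫⁻ v in Ioc (0:ℝ) 1, ((L:ENNReal) + n * ind ((L:ENNReal) < Nf Y v x n ω)) := by
        apply lintegral_mono
        intro v
        simp only
        by_cases hv : (L:ENNReal) < Nf Y v x n ω
        · rw [ind_true hv, mul_one]
          exact (Nf_le Y v x n ω).trans le_add_self
        · exact (not_lt.mp hv).trans le_self_add
      have jm1 : Measurable fun v : ℝ => ind ((L:ENNReal) < Nf Y v x n ω) := jm.comp (measurable_const.prodMk measurable_id)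
      rw [lintegral_add_left measurable_const, lintegral_const_mul _ jm1] at h2
      simp only [lintegral_const, MeasurableSet.univ, Measure.restrict_apply, univ_inter, Real.volume_Ioc, sub_zero, ENNReal.ofReal_one, mul_one] at h2
      have h3 := h.trans_le h2
      rw [show ((2*L:ℕ):ENNReal) = L + L by push_cast; ring] at h3
      have h4 := (ENNReal.add_lt_add_iff_left (ENNReal.natCast_ne_top L)).mp h3
      refine le_trans ?_ h4.le
      exact_mod_cast hL
    calc _ ≤ 1 * P {ω | (1:ENNReal) ≤ n * ∫⁻ v in Ioc (0:ℝ) 1, ind ((L:ENNReal) < Nf Y v x n ω)} := by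
          rw [one_mul]; exact measure_mono fun ω h => imp ω h
      _ ≤ ∫⁻ ω, n * ∫⁻ v in Ioc (0:ℝ) 1, ind ((L:ENNReal) < Nf Y v x n ω) ∂volume ∂P :=
          mul_meas_ge_le_lintegral (jm.lintegral_prod_right'.const_mul _) _
      _ = n * ∫⁻ ω, ∫⁻ v in Ioc (0:ℝ) 1, ind ((L:ENNReal) < Nf Y v x n ω) ∂volume ∂P :=
          lintegral_const_mul _ jm.lintegral_prod_right'
      _ = n * ∫⁻ v in Ioc (0:ℝ) 1, ∫⁻ ω, ind ((L:ENNReal) < Nf Y v x n ω) ∂P := by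
          rw [lintegral_lintegral_swap jm.aemeasurable]
      _ = _ := by
          congr 1
          apply lintegral_congr
          intro v
          exact lintegral_ind _ (measurableSet_lt measurable_const (Nf_meas W v x n))
  have hset : {ω | ∃ x, ((2*L:ℕ):ENNReal) < lt Y n x ω} = ⋃ x, {ω | ((2*L:ℕ):ENNReal) < lt Y n x ω} := by
    ext ω; simp
  have hmeas : ∀ x, Measurable fun v => P {ω | (L:ENNReal) < Nf Y v x n ω} := by
    intro x
    have jm : Measurable fun p : ℝ × Ω => ind ((L:ENNReal) < Nf Y p.1 x n p.2) :=
      measurable_ind (measurableSet_lt measurable_const ((Nf_jmeas W x n).comp measurable_swap))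
    have := jm.lintegral_prod_right' (ν := P)
    convert this using 1
    ext v
    exact (lintegral_ind _ (measurableSet_lt measurable_const (Nf_meas W v x n))).symm
  rw [hset]
  have hp0 : ((1:ENNReal) + s)^L ≠ 0 := pow_ne_zero _ (by simp)
  have hpt : ((1:ENNReal) + s)^L ≠ ⊤ := ENNReal.pow_ne_top (by simp)
  calc _ ≤ ∑' x, P {ω | ((2*L:ℕ):ENNReal) < lt Y n x ω} := measure_iUnion_le _
    _ ≤ ∑' x, n * ∫⁻ v in Ioc (0:ℝ) 1, P {ω | (L:ENNReal) < Nf Y v x n ω} := ENNReal.tsum_le_tsum one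
    _ = n * ∫⁻ v in Ioc (0:ℝ) 1, ∑' x, P {ω | (L:ENNReal) < Nf Y v x n ω} := by
        rw [ENNReal.tsum_mul_left, lintegral_tsum fun x => (hmeas x).aemeasurable]
    _ ≤ n * ∫⁻ v in Ioc (0:ℝ) 1, (2 * n * (((1:ENNReal) + s)^L)⁻¹) := by
        refine mul_le_mul_right ?_ _
        apply setLIntegral_mono' measurableSet_Ioc
        intro v hv
        rw [← div_eq_mul_inv, ENNReal.le_div_iff_mul_le (Or.inl hp0) (Or.inl hpt), mul_comm]
        exact tail v hv.1.le
    _ = _ := by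
        simp only [lintegral_const, MeasurableSet.univ, Measure.restrict_apply, univ_inter, Real.volume_Ioc, sub_zero, ENNReal.ofReal_one, mul_one]
        rw [ENNReal.ofReal_mul (by positivity), ENNReal.ofReal_mul (by positivity), ENNReal.ofReal_inv_of_pos (by positivity), ENNReal.ofReal_pow (by positivity), ENNReal.ofReal_pow (by positivity),
          ENNReal.ofReal_add (by positivity) (by positivity)]
        simp
        ring

end
end LRC

set_option linter.all false

namespace LRC
open scoped NNReal

section
variable {Ω : Type*} [MeasurableSpace Ω]
variable {d : ℕ} {P : Measure Ω} {Y : ℝ → Ω → (Fin d → ℤ)}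

lemma Wk.path_meas (W : Wk d P Y) (ω : Ω) : Measurable fun u : ℝ => Y u ω :=
  W.jm.comp (measurable_id.prodMk measurable_const)

lemma Wk.Acl_sum (hd : 0 < d) (W : Wk d P Y) (n : ℕ) : ∀ᵐ ω ∂P, ∃ F : Finset (Fin d → ℤ),
    ∀ g : (Fin d → ℤ) → ENNReal, Acl g Y n ω = ∑ x ∈ F, g x * lt Y n x ω := by
  classical
  filter_upwards [W.finite_range hd n] with ω hω
  refine ⟨hω.toFinset, fun g => ?_⟩
  have mi : ∀ x, Measurable fun u : ℝ => ind (Y u ω = x) := fun x => measurable_ind (sing_meas (W.path_meas ω) x)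
  unfold lt Acl
  have e : ∀ x ∈ hω.toFinset, g x * ∫⁻ u in Ioc (0:ℝ) n, ind (Y u ω = x) = ∫⁻ u in Ioc (0:ℝ) n, g x * ind (Y u ω = x) :=
    fun x _ => (lintegral_const_mul _ (mi x)).symm
  rw [Finset.sum_congr rfl e, ← lintegral_finsetSum _ (fun x _ => (mi x).const_mul _)]
  apply setLIntegral_congr_fun measurableSet_Ioc
  intro u hu
  simp only
  rw [Finset.sum_eq_single (Y u ω)]
  · rw [ind_true rfl, mul_one]
  · intro b _ hb
    rw [ind_false (Ne.symm hb), mul_zero]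
  · intro h
    exfalso; apply h
    simp only [Set.Finite.mem_toFinset]
    exact ⟨u, ⟨hu.1.le, hu.2⟩, rfl⟩

lemma Acl_one (Y : ℝ → Ω → (Fin d → ℤ)) (n : ℕ) (ω : Ω) : Acl (fun _ => 1) Y n ω = n := by
  unfold Acl; simp

variable {Ωz : Type*} [MeasurableSpace Ωz] {μ : Measure Ωz} {z : (Fin d → ℤ) → Ωz → ℝ} {α : ℝ}

lemma jensen_exp [IsProbabilityMeasure μ] {X : Ωz → ℝ} (hX : Measurable X) {p q : ℝ} (hp : 0 ≤ p) (hpq : p ≤ q) (hq : 0 < q) :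
    ∫⁻ ζ, ENNReal.ofReal (Real.exp (p * X ζ)) ∂μ ≤ (∫⁻ ζ, ENNReal.ofReal (Real.exp (q * X ζ)) ∂μ)^(p/q) := by
  rcases hp.eq_or_lt with rfl | hp
  · simp
  have h := eLpNorm'_le_eLpNorm'_of_exponent_le (f := fun ζ => Real.exp (X ζ)) hp hpq μ
    (Real.measurable_exp.comp hX).aestronglyMeasurable
  unfold eLpNorm' at h
  have e : ∀ r : ℝ, 0 < r → ∀ ζ, ‖Real.exp (X ζ)‖ₑ^r = ENNReal.ofReal (Real.exp (r * X ζ)) := by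
    intro r hr ζ
    rw [Real.enorm_eq_ofReal (Real.exp_pos _).le, ENNReal.ofReal_rpow_of_pos (Real.exp_pos _), ← Real.exp_mul, mul_comm]
  simp only [e p hp, e q hq] at h
  have h2 := ENNReal.rpow_le_rpow h hp.le
  rw [← ENNReal.rpow_mul, ← ENNReal.rpow_mul, one_div_mul_cancel hp.ne', ENNReal.rpow_one, one_div_mul_eq_div] at h2
  exact h2

lemma prod_bound (hz : IsScenery d α μ z) {φ : ℝ → ℝ} (hφ : Measurable φ) (B : Finset (Fin d → ℤ))
    {l : (Fin d → ℤ) → ℝ} {L : ℝ} (hL : 0 < L) (hl0 : ∀ x ∈ B, 0 ≤ l x) (hlL : ∀ x ∈ B, l x ≤ L) :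
    ∫⁻ ζ, ENNReal.ofReal (Real.exp (∑ x ∈ B, l x * φ (z x ζ))) ∂μ ≤
      (∫⁻ ζ, ENNReal.ofReal (Real.exp (L * φ (z 0 ζ))) ∂μ)^((∑ x ∈ B, l x)/L) := by
  have := hz.prob
  have e : ∀ ζ, ENNReal.ofReal (Real.exp (∑ x ∈ B, l x * φ (z x ζ))) = ∏ x ∈ B, ENNReal.ofReal (Real.exp (l x * φ (z x ζ))) := by
    intro ζ
    rw [Real.exp_sum, ENNReal.ofReal_prod_of_nonneg fun _ _ => (Real.exp_pos _).le]
  simp only [e]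
  have mf : ∀ x, Measurable fun y : ℝ => ENNReal.ofReal (Real.exp (l x * φ y)) := fun x =>
    (Real.measurable_exp.comp (hφ.const_mul _)).ennreal_ofReal
  rw [lintegral_prod_eq_prod_lintegral_of_indepFun B (fun x ζ => ENNReal.ofReal (Real.exp (l x * φ (z x ζ))))
    (hz.indep.comp (fun x y => ENNReal.ofReal (Real.exp (l x * φ y))) mf) (fun x => (mf x).comp (hz.meas x))]
  have h1 : ∀ x ∈ B, ∫⁻ ζ, ENNReal.ofReal (Real.exp (l x * φ (z x ζ))) ∂μ ≤
      (∫⁻ ζ, ENNReal.ofReal (Real.exp (L * φ (z 0 ζ))) ∂μ)^(l x/L) := by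
    intro x hx
    have h2 : ∫⁻ ζ, ENNReal.ofReal (Real.exp (l x * φ (z x ζ))) ∂μ = ∫⁻ ζ, ENNReal.ofReal (Real.exp (l x * φ (z 0 ζ))) ∂μ :=
      ((hz.ident x).comp (mf x)).lintegral_eq
    rw [h2]
    exact jensen_exp (hφ.comp (hz.meas 0)) (hl0 x hx) (hlL x hx) hL
  refine (Finset.prod_le_prod' h1).trans ?_
  rw [Finset.sum_div]
  apply le_of_eq
  clear e h1
  classical
  have hnn : ∀ x ∈ B, 0 ≤ l x / L := fun x hx => div_nonneg (hl0 x hx) hL.le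
  clear hl0 hlL
  induction B using Finset.induction_on with
  | empty => simp
  | insert a s ha ih =>
    rw [Finset.prod_insert ha, Finset.sum_insert ha, ih fun x hx => hnn x (Finset.mem_insert_of_mem hx), ENNReal.rpow_add_of_nonneg]
    · exact hnn a (Finset.mem_insert_self _ _)
    · exact Finset.sum_nonneg fun x hx => hnn x (Finset.mem_insert_of_mem hx)

lemma chernoff (hz : IsScenery d α μ z) {φ : ℝ → ℝ} (hφ : Measurable φ) (B : Finset (Fin d → ℤ))
    {l : (Fin d → ℤ) → ℝ} {L : ℝ} (hL : 0 < L) (hl0 : ∀ x ∈ B, 0 ≤ l x) (hlL : ∀ x ∈ B, l x ≤ L)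
    {m a : ℝ} (hm : ∫⁻ ζ, ENNReal.ofReal (Real.exp (L * φ (z 0 ζ))) ∂μ ≤ ENNReal.ofReal (Real.exp m)) :
    μ {ζ | a ≤ ∑ x ∈ B, l x * φ (z x ζ)} ≤ ENNReal.ofReal (Real.exp (m * (∑ x ∈ B, l x) / L - a)) := by
  have hmeas : Measurable fun ζ => ENNReal.ofReal (Real.exp (∑ x ∈ B, l x * φ (z x ζ))) :=
    (Real.measurable_exp.comp (Finset.measurable_sum _ fun x _ => (hφ.comp (hz.meas x)).const_mul _)).ennreal_ofReal
  have h1 := mul_meas_ge_le_lintegral hmeas (ENNReal.ofReal (Real.exp a)) (μ := μ)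
  have h2 := h1.trans (prod_bound hz hφ B hL hl0 hlL)
  have hs : 0 ≤ (∑ x ∈ B, l x)/L := div_nonneg (Finset.sum_nonneg hl0) hL.le
  have h3 := h2.trans (ENNReal.rpow_le_rpow hm hs)
  rw [ENNReal.ofReal_rpow_of_pos (Real.exp_pos _), ← Real.exp_mul] at h3
  have h4 : {ζ | a ≤ ∑ x ∈ B, l x * φ (z x ζ)} = {ζ | ENNReal.ofReal (Real.exp a) ≤ ENNReal.ofReal (Real.exp (∑ x ∈ B, l x * φ (z x ζ)))} := by
    ext ζ
    simp only [mem_setOf_eq]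
    rw [ENNReal.ofReal_le_ofReal_iff (Real.exp_pos _).le, Real.exp_le_exp]
  rw [h4]
  rw [mul_comm, ← ENNReal.le_div_iff_mul_le (Or.inl (by simp [Real.exp_pos])) (Or.inl ENNReal.ofReal_ne_top), ← ENNReal.ofReal_div_of_pos (Real.exp_pos _), ← Real.exp_sub, ← mul_div_assoc] at h3
  exact h3

/-- Laplace bound for lower tails. -/
lemma laplace_low [IsProbabilityMeasure μ] {X : Ωz → ℝ} (hX0 : ∀ ζ, X ζ ≤ 0)
    {E : Set Ωz} (hE : MeasurableSet E) (hE1 : ∀ ζ ∈ E, X ζ ≤ -1) :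
    ∫⁻ ζ, ENNReal.ofReal (Real.exp (X ζ)) ∂μ ≤ ENNReal.ofReal (Real.exp (-((μ E).toReal / 2))) := by
  have h1 : ∫⁻ ζ, ENNReal.ofReal (Real.exp (X ζ)) ∂μ ≤ ∫⁻ ζ, (E.indicator (fun _ => ENNReal.ofReal (1/2)) ζ + Eᶜ.indicator (fun _ => 1) ζ) ∂μ := by
    apply lintegral_mono
    intro ζ
    by_cases h : ζ ∈ E
    · simp only [h, indicator_of_mem, mem_compl_iff, not_true_eq_false, not_false_eq_true, indicator_of_notMem, add_zero]
      apply ENNReal.ofReal_le_ofReal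
      have : Real.exp (-1) ≤ 1/2 := by
        rw [Real.exp_neg, inv_eq_one_div]
        apply one_div_le_one_div_of_le (by norm_num)
        have := Real.add_one_le_exp (1:ℝ); linarith
      exact (Real.exp_le_exp.mpr (hE1 ζ h)).trans this
    · simp only [h, indicator_of_notMem, not_false_eq_true, mem_compl_iff, indicator_of_mem, zero_add]
      rw [← ENNReal.ofReal_one]
      exact ENNReal.ofReal_le_ofReal (Real.exp_le_one_iff.mpr (hX0 ζ))
  refine h1.trans ?_
  rw [lintegral_add_left (measurable_const.indicator hE), lintegral_indicator_const hE, lintegral_indicator_const hE.compl, prob_compl_eq_one_sub hE, one_mul]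
  set p := (μ E).toReal with hp
  have hpE : μ E = ENNReal.ofReal p := (ENNReal.ofReal_toReal (measure_ne_top μ E)).symm
  have hp1 : p ≤ 1 := measureReal_le_one
  have hp0 : 0 ≤ p := ENNReal.toReal_nonneg
  rw [hpE, ← ENNReal.ofReal_mul (by norm_num), ← ENNReal.ofReal_one, ← ENNReal.ofReal_sub _ hp0, ← ENNReal.ofReal_add (by positivity) (by linarith)]
  apply ENNReal.ofReal_le_ofReal
  have := Real.add_one_le_exp (-(p/2))
  linarith

/-- Laplace bound for upper tails. -/
lemma laplace_up [IsProbabilityMeasure μ] {X : Ωz → ℝ} (hXm : Measurable X) (hX0 : ∀ ζ, 0 ≤ X ζ) (hX1 : ∀ ζ, X ζ ≤ 1)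
    {e : ℝ} (he0 : 0 ≤ e) (he : ∫⁻ ζ, ENNReal.ofReal (X ζ) ∂μ ≤ ENNReal.ofReal e) :
    ∫⁻ ζ, ENNReal.ofReal (Real.exp (X ζ)) ∂μ ≤ ENNReal.ofReal (Real.exp (2 * e)) := by
  have h1 : ∫⁻ ζ, ENNReal.ofReal (Real.exp (X ζ)) ∂μ ≤ ∫⁻ ζ, (1 + 2 * ENNReal.ofReal (X ζ)) ∂μ := by
    apply lintegral_mono
    intro ζ
    have h : Real.exp (X ζ) ≤ 1 + 2 * X ζ := by
      have h2 := Real.abs_exp_sub_one_le (x := X ζ) (by rw [abs_of_nonneg (hX0 ζ)]; exact hX1 ζ)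
      rw [abs_of_nonneg (hX0 ζ)] at h2
      have := (abs_le.mp h2).2
      linarith
    calc _ ≤ ENNReal.ofReal (1 + 2 * X ζ) := ENNReal.ofReal_le_ofReal h
      _ = _ := by
        rw [ENNReal.ofReal_add (by norm_num) (by have := hX0 ζ; positivity), ENNReal.ofReal_mul (by norm_num)]; simp
  refine h1.trans ?_
  rw [lintegral_add_left measurable_const, lintegral_const_mul _ hXm.ennreal_ofReal, lintegral_const, measure_univ, mul_one]
  calc (1:ENNReal) + 2 * ∫⁻ ζ, ENNReal.ofReal (X ζ) ∂μ ≤ 1 + 2 * ENNReal.ofReal e := by gcongr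
    _ = ENNReal.ofReal (1 + 2 * e) := by
        rw [ENNReal.ofReal_add (by norm_num) (by positivity), ENNReal.ofReal_mul (by norm_num)]; simp
    _ ≤ _ := by
        apply ENNReal.ofReal_le_ofReal
        have := Real.add_one_le_exp (2*e)
        linarith

lemma Acl_jmeas (W : Wk d P Y) (hzm : ∀ x, Measurable (z x)) {ψ : ℝ → ENNReal} (hψ : Measurable ψ) (t : ℝ) :
    Measurable fun p : Ωz × Ω => Acl (fun v => ψ (z v p.1)) Y t p.2 := by
  unfold Acl
  have h1 : Measurable fun q : (Fin d → ℤ) × Ωz => ψ (z q.1 q.2) :=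
    measurable_from_prod_countable_right fun v => hψ.comp (hzm v)
  have h2 : Measurable fun q : (Ωz × Ω) × ℝ => ψ (z (Y q.2 q.1.2) q.1.1) :=
    h1.comp ((W.jm.comp (measurable_snd.prodMk (measurable_snd.comp measurable_fst))).prodMk (measurable_fst.comp measurable_fst))
  exact h2.lintegral_prod_right'

lemma lt_meas (W : Wk d P Y) (n : ℕ) (x : Fin d → ℤ) : Measurable (lt Y n x) := by
  have : Measurable fun ω => ∫⁻ v in Ioc (0:ℝ) 1, Nf Y v x n ω := (Nf_jmeas W x n).lintegral_prod_right'
  convert this using 1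
  ext ω
  exact W.lt_eq n x ω

/-- Annealed estimate. -/
lemma Wk.annealed (hd : 3 ≤ d) (W : Wk d P Y) (hz : IsScenery d α μ z) {ψ : ℝ → ℝ} (hψ : Measurable ψ) (hψ0 : ∀ y, 0 ≤ ψ y)
    (n L : ℕ) (hL : 1 ≤ L) (I : Set ENNReal) (hI : MeasurableSet I) (κ : ENNReal)
    (hκ : ∀ (F : Finset (Fin d → ℤ)) (l : (Fin d → ℤ) → ℝ), (∀ x ∈ F, 0 ≤ l x) → (∀ x ∈ F, l x ≤ (2*L:ℕ)) →
      ∑ x ∈ F, l x = n → μ {ζ | ENNReal.ofReal (∑ x ∈ F, l x * ψ (z x ζ)) ∈ I} ≤ κ) :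
    ∫⁻ ζ, P {ω | Acl (fun v => ENNReal.ofReal (ψ (z v ζ))) Y n ω ∈ I} ∂μ ≤
      P {ω | ∃ x, ((2*L:ℕ):ENNReal) < lt Y n x ω} + κ := by
  have := W.prob
  have := hz.prob
  have hA := Acl_jmeas W hz.meas (ψ := fun y => ENNReal.ofReal (ψ y)) hψ.ennreal_ofReal n
  have jm : Measurable fun p : Ωz × Ω => ind (Acl (fun v => ENNReal.ofReal (ψ (z v p.1))) Y n p.2 ∈ I) :=
    measurable_ind (hA hI)
  have e1 : ∫⁻ ζ, P {ω | Acl (fun v => ENNReal.ofReal (ψ (z v ζ))) Y n ω ∈ I} ∂μ =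
      ∫⁻ ζ, ∫⁻ ω, ind (Acl (fun v => ENNReal.ofReal (ψ (z v ζ))) Y n ω ∈ I) ∂P ∂μ := by
    apply lintegral_congr
    intro ζ
    exact (lintegral_ind _ ((hA.comp (measurable_const.prodMk measurable_id)) hI)).symm
  rw [e1, lintegral_lintegral_swap jm.aemeasurable]
  have mbad : MeasurableSet {ω | ∃ x, ((2*L:ℕ):ENNReal) < lt Y n x ω} := by
    simp only [setOf_exists]
    exact MeasurableSet.iUnion fun x => measurableSet_lt measurable_const (lt_meas W n x)
  calc _ ≤ ∫⁻ ω, (ind (∃ x, ((2*L:ℕ):ENNReal) < lt Y n x ω) + κ) ∂P := by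
        apply lintegral_mono_ae
        filter_upwards [W.Acl_sum (by omega) n] with ω hω
        have e2 : ∫⁻ ζ, ind (Acl (fun v => ENNReal.ofReal (ψ (z v ζ))) Y n ω ∈ I) ∂μ = μ {ζ | Acl (fun v => ENNReal.ofReal (ψ (z v ζ))) Y n ω ∈ I} :=
          lintegral_ind _ ((hA.comp (measurable_id.prodMk measurable_const)) hI)
        rw [e2]
        by_cases hb : ∃ x, ((2*L:ℕ):ENNReal) < lt Y n x ω
        · rw [ind_true hb]
          exact prob_le_one.trans le_self_add
        · rw [ind_false hb, zero_add]
          push Not at hb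
          obtain ⟨F, hF⟩ := hω
          have hfin : ∀ x, lt Y n x ω ≠ ⊤ := fun x => ne_top_of_le_ne_top (ENNReal.natCast_ne_top _) (hb x)
          have hk := hκ F (fun x => (lt Y n x ω).toReal) (fun x _ => ENNReal.toReal_nonneg)
            (fun x _ => by
              have := ENNReal.toReal_mono (ENNReal.natCast_ne_top _) (hb x)
              simpa using this)
            (by
              have h1 := hF (fun _ => 1)
              rw [Acl_one] at h1
              simp only [one_mul] at h1
              rw [← ENNReal.toReal_sum (fun x _ => hfin x), ← h1]; simp)
          refine le_trans (measure_mono ?_) hk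
          intro ζ hζ
          simp only [mem_setOf_eq] at hζ ⊢
          rw [hF] at hζ
          convert hζ using 1
          rw [ENNReal.ofReal_sum_of_nonneg fun x _ => mul_nonneg ENNReal.toReal_nonneg (hψ0 _)]
          apply Finset.sum_congr rfl
          intro x _
          rw [ENNReal.ofReal_mul ENNReal.toReal_nonneg, ENNReal.ofReal_toReal (hfin x), mul_comm]
    _ = _ := by
        rw [lintegral_add_left (measurable_ind mbad), lintegral_ind _ mbad, lintegral_const, measure_univ, mul_one]

/-- A Borel–Cantelli statement. -/
lemma bc {f : ℕ → Ωz → ENNReal} (hf : ∀ n, Measurable (f n)) {g b : ℕ → ℝ}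
    (hfg : ∀ᶠ n in atTop, ∫⁻ ζ, f n ζ ∂μ ≤ ENNReal.ofReal (g n * b n)) (hg : Summable g) (hg0 : ∀ n, 0 ≤ g n)
    (hb : ∀ᶠ n in atTop, 0 < b n) : ∀ᵐ ζ ∂μ, ∀ᶠ n in atTop, f n ζ ≤ ENNReal.ofReal (b n) := by
  obtain ⟨N, hN⟩ := eventually_atTop.mp (hfg.and hb)
  have h1 : ∑' n, μ {ζ | ENNReal.ofReal (b (n+N)) < f (n+N) ζ} ≠ ⊤ := by
    have h2 : ∀ n, μ {ζ | ENNReal.ofReal (b (n+N)) < f (n+N) ζ} ≤ ENNReal.ofReal (g (n+N)) := by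
      intro n
      obtain ⟨h3, h4⟩ := hN (n+N) (by omega)
      have h5 := (mul_meas_ge_le_lintegral (hf (n+N)) (ENNReal.ofReal (b (n+N))) (μ := μ)).trans h3
      rw [mul_comm, ENNReal.ofReal_mul (hg0 _)] at h5
      have h6 := (ENNReal.mul_le_mul_iff_left (by simpa using h4) ENNReal.ofReal_ne_top).mp h5
      refine le_trans (measure_mono ?_) h6
      intro ζ h
      simp only [mem_setOf_eq] at h ⊢
      exact h.le
    refine ne_top_of_le_ne_top ?_ (ENNReal.tsum_le_tsum h2)
    have hs : Summable fun n => g (n+N) := (summable_nat_add_iff N).mpr hg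
    exact hs.tsum_ofReal_ne_top
  filter_upwards [ae_eventually_notMem h1] with ζ hζ
  obtain ⟨M, hM⟩ := eventually_atTop.mp hζ
  refine eventually_atTop.mpr ⟨M + N, fun n hn => ?_⟩
  have := hM (n - N) (by omega)
  rw [show n - N + N = n by omega] at this
  simpa using this

end
end LRC

set_option linter.all false

namespace LRC
open scoped NNReal

lemma exp_small {b c : ℝ} (hb : 0 < b) (hc : 0 < c) (K : ℝ) :
    ∀ᶠ x : ℝ in atTop, Real.exp (-(c * x^b)) ≤ x^(-K) := by
  have h := (isLittleO_exp_neg_mul_rpow_atTop hc (-(K/b))).bound one_pos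
  have h2 := (tendsto_rpow_atTop hb).eventually h
  filter_upwards [h2, eventually_gt_atTop 0] with x hx hx0
  rw [Real.norm_of_nonneg (Real.exp_pos _).le, one_mul, Real.norm_of_nonneg (by positivity), ← Real.rpow_mul hx0.le] at hx
  rw [← neg_mul]
  convert hx using 2
  field_simp

lemma const_le_rpow (C : ℝ) {ε : ℝ} (hε : 0 < ε) : ∀ᶠ x : ℝ in atTop, C ≤ x^ε :=
  (tendsto_rpow_atTop hε).eventually_ge_atTop C

section
variable {Ω : Type*} [MeasurableSpace Ω]
variable {d : ℕ} {P : Measure Ω} {Y : ℝ → Ω → (Fin d → ℤ)}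
variable {Ωz : Type*} [MeasurableSpace Ωz] {μ : Measure Ωz} {z : (Fin d → ℤ) → Ωz → ℝ} {α : ℝ}

/-- upper tail function -/
noncomputable def pz (μ : Measure Ωz) (z : (Fin d → ℤ) → Ωz → ℝ) (r : ℝ) : ℝ := (μ {ω | r < z 0 ω}).toReal

lemma pz_bounds (hα : 0 < α) (hz : IsScenery d α μ z) {ε : ℝ} (hε : 0 < ε) :
    ∀ᶠ r : ℝ in atTop, r^(-α-ε) ≤ pz μ z r ∧ pz μ z r ≤ r^(-α+ε) := by
  have h1 := hz.tail.eventually (gt_mem_nhds (show -α < -α + min ε (α/2) by linarith [lt_min hε (half_pos hα)]))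
  have h2 := hz.tail.eventually (lt_mem_nhds (show -α - ε < -α by linarith))
  filter_upwards [h1, h2, eventually_gt_atTop 1] with r h1 h2 hr
  have hl : 0 < Real.log r := Real.log_pos hr
  have hr0 : 0 < r := by linarith
  change Real.log (pz μ z r) / Real.log r < _ at h1
  change _ < Real.log (pz μ z r) / Real.log r at h2
  have hp : 0 < pz μ z r := by
    have hp0 : 0 ≤ pz μ z r := ENNReal.toReal_nonneg
    rcases hp0.eq_or_lt with h | h
    · rw [← h] at h1
      simp at h1
      linarith [min_le_right ε (α/2)]
    · exact h
  rw [div_lt_iff₀ hl] at h1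
  rw [lt_div_iff₀ hl] at h2
  constructor
  · rw [Real.rpow_def_of_pos hr0, ← Real.le_log_iff_exp_le hp]
    linarith
  · rw [Real.rpow_def_of_pos hr0, ← Real.log_le_iff_le_exp hp]
    have : (-α + min ε (α/2)) * Real.log r ≤ (-α + ε) * Real.log r := by gcongr; exact min_le_left _ _
    linarith

lemma Wk.prob_meas (W : Wk d P Y) (hz : IsScenery d α μ z) {ψ : ℝ → ℝ} (hψ : Measurable ψ) (t : ℝ) {I : Set ENNReal} (hI : MeasurableSet I) :
    Measurable fun ζ => P {ω | Acl (fun v => ENNReal.ofReal (ψ (z v ζ))) Y t ω ∈ I} := by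
  have := W.prob
  have hA := Acl_jmeas W hz.meas (ψ := fun y => ENNReal.ofReal (ψ y)) hψ.ennreal_ofReal t
  have jm : Measurable fun p : Ωz × Ω => ind (Acl (fun v => ENNReal.ofReal (ψ (z v p.1))) Y t p.2 ∈ I) :=
    measurable_ind (hA hI)
  have := jm.lintegral_prod_right' (ν := P)
  convert this using 1
  ext ζ
  exact (lintegral_ind _ ((hA.comp (measurable_const.prodMk measurable_id)) hI)).symm

lemma Wk.quench (hd : 3 ≤ d) (W : Wk d P Y) (hz : IsScenery d α μ z) {ψ : ℕ → ℝ → ℝ} (hψ : ∀ n, Measurable (ψ n)) (hψ0 : ∀ n y, 0 ≤ ψ n y)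
    (I : ℕ → Set ENNReal) (hI : ∀ n, MeasurableSet (I n)) {η c : ℝ} (hη : 0 < η) (hc : 0 < c)
    (hκ : ∀ᶠ n : ℕ in atTop, ∀ (F : Finset (Fin d → ℤ)) (l : (Fin d → ℤ) → ℝ), (∀ x ∈ F, 0 ≤ l x) →
      (∀ x ∈ F, l x ≤ (2*⌈(n:ℝ)^η⌉₊:ℕ)) → ∑ x ∈ F, l x = n →
      μ {ζ | ENNReal.ofReal (∑ x ∈ F, l x * ψ n (z x ζ)) ∈ I n} ≤ ENNReal.ofReal (Real.exp (-(c * (n:ℝ)^η)))) (K : ℝ) :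
    ∀ᵐ ζ ∂μ, ∀ᶠ n : ℕ in atTop, P {ω | Acl (fun v => ENNReal.ofReal (ψ n (z v ζ))) Y n ω ∈ I n} ≤ ENNReal.ofReal ((n:ℝ)^(-K)) := by
  obtain ⟨ρ, hρ, htail⟩ := W.lt_tail hd
  have hs : Summable fun n : ℕ => (n:ℝ)^(-2:ℝ) := Real.summable_nat_rpow.mpr (by norm_num)
  have hlog : 0 < Real.log ρ := Real.log_pos hρ
  refine bc (fun n => W.prob_meas hz (hψ n) n (hI n)) (g := fun n : ℕ => (n:ℝ)^(-2:ℝ)) (b := fun n => (n:ℝ)^(-K)) ?_ hs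
    (fun n => by positivity) ?_
  · have s1 := tendsto_natCast_atTop_atTop.eventually (exp_small hη hc (K+3))
    have s2 := tendsto_natCast_atTop_atTop.eventually (exp_small hη hlog (K+5))
    filter_upwards [hκ, s1, s2, eventually_ge_atTop 3] with n hκ s1 s2 hn
    have hn3 : (3:ℝ) ≤ n := by exact_mod_cast hn
    have hn0 : (0:ℝ) < n := by linarith
    have hpos : (0:ℝ) < (n:ℝ)^η := by positivity
    have hL : 1 ≤ ⌈(n:ℝ)^η⌉₊ := Nat.ceil_pos.mpr hpos
    refine (W.annealed hd hz (hψ n) (hψ0 n) n _ hL (I n) (hI n) _ hκ).trans ?_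
    refine (add_le_add (htail n _ hL) le_rfl).trans ?_
    rw [← ENNReal.ofReal_add (by positivity) (Real.exp_pos _).le]
    apply ENNReal.ofReal_le_ofReal
    have a1 : (ρ^⌈(n:ℝ)^η⌉₊)⁻¹ ≤ Real.exp (-(Real.log ρ * (n:ℝ)^η)) := by
      rw [Real.exp_neg]
      apply inv_anti₀ (Real.exp_pos _)
      rw [← Real.rpow_natCast, Real.rpow_def_of_pos (show 0 < ρ by linarith)]
      apply Real.exp_le_exp.mpr
      gcongr
      exact Nat.le_ceil _
    have a2 : (n:ℝ)^2 * (n:ℝ)^(-(K+5)) = (n:ℝ)^(-(K+3)) := by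
      rw [← Real.rpow_natCast, ← Real.rpow_add hn0]; congr 1; push_cast; ring
    have a3 : (n:ℝ)^(-2:ℝ) * (n:ℝ)^(-K) = n * (n:ℝ)^(-(K+3)) := by
      conv_rhs => rw [← Real.rpow_one (n:ℝ), Real.rpow_one, mul_comm, ← Real.rpow_add_one hn0.ne']
      rw [← Real.rpow_add hn0]; congr 1; ring
    rw [a3]
    have a4 : 2 * (n:ℝ)^2 * (ρ^⌈(n:ℝ)^η⌉₊)⁻¹ ≤ 2 * (n:ℝ)^(-(K+3)) := by
      rw [← a2, mul_assoc]
      gcongr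
      exact a1.trans s2
    have a5 : 0 ≤ (n:ℝ)^(-(K+3)) := by positivity
    nlinarith
  · filter_upwards [eventually_gt_atTop 0] with n hn
    have : (0:ℝ) < n := by exact_mod_cast hn
    positivity

lemma ceil_le_two {x : ℝ} (hx : 1 ≤ x) : ((⌈x⌉₊:ℕ):ℝ) ≤ 2 * x := by
  have := Nat.ceil_lt_add_one (show 0 ≤ x by linarith)
  linarith

/-- Lower tails of the clock. -/
lemma Wk.Q1 (hd : 3 ≤ d) (W : Wk d P Y) (hz : IsScenery d α μ z) {r : ℕ → ℝ} (hr : ∀ᶠ n in atTop, 0 < r n) {η : ℝ} (hη : 0 < η)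
    (hp : ∀ᶠ n : ℕ in atTop, (n:ℝ)^η ≤ n * pz μ z (r n)) (K : ℝ) :
    ∀ᵐ ζ ∂μ, ∀ᶠ n : ℕ in atTop, P {ω | Acl (fun v => ENNReal.ofReal (z v ζ)) Y n ω ≤ ENNReal.ofReal (n * r n * pz μ z (r n) / 4)} ≤ ENNReal.ofReal ((n:ℝ)^(-K)) := by
  have := hz.prob
  have h := W.quench hd hz (ψ := fun _ y => max y 0) (fun _ => measurable_id.max measurable_const) (fun _ y => le_max_right _ _)
    (fun n => Iic (ENNReal.ofReal (n * r n * pz μ z (r n) / 4))) (fun n => measurableSet_Iic) (η := η/2) (c := 1/16)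
    (by positivity) (by norm_num) ?_ K
  · simpa only [max_eq_left (hz.nonneg _ _), mem_Iic] using h
  filter_upwards [hr, hp, eventually_ge_atTop 1] with n hr hp hn F l hl0 hlL hsum
  have hn0 : (1:ℝ) ≤ n := by exact_mod_cast hn
  set L : ℕ := ⌈(n:ℝ)^(η/2)⌉₊ with hL
  set p := pz μ z (r n) with hpd
  have hx1 : 1 ≤ (n:ℝ)^(η/2) := Real.one_le_rpow hn0 (by positivity)
  have hL0 : (0:ℝ) < (2*L:ℕ) := by
    have : 0 < L := Nat.ceil_pos.mpr (by linarith)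
    positivity
  have hL2 : ((2*L:ℕ):ℝ) ≤ 4 * (n:ℝ)^(η/2) := by
    push_cast; have := ceil_le_two hx1; rw [← hL] at this; linarith
  set φ : ℝ → ℝ := fun y => -(max y 0 / ((2*L:ℕ) * r n)) with hφ
  have hφm : Measurable φ := ((measurable_id.max measurable_const).div_const _).neg
  have hm := laplace_low (μ := μ) (X := fun ζ => ((2*L:ℕ):ℝ) * φ (z 0 ζ)) (E := {ω | r n < z 0 ω})
    (fun ζ => by
      simp only [hφ, mul_neg, Left.neg_nonpos_iff]
      have : 0 ≤ max (z 0 ζ) 0 := le_max_right _ _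
      positivity)
    (measurableSet_lt measurable_const (hz.meas 0))
    (fun ζ (hζ : r n < z 0 ζ) => by
      simp only [hφ, mul_neg, neg_le_neg_iff]
      rw [max_eq_left (hz.nonneg _ _), show ((2*L:ℕ):ℝ) * (z 0 ζ / ((2*L:ℕ) * r n)) = z 0 ζ / r n by field_simp, one_le_div hr]
      exact hζ.le)
  have hch := chernoff hz hφm F hL0 hl0 hlL (a := -(n * p / (4 * (2*L:ℕ)))) hm
  have hp0 : 0 ≤ p := ENNReal.toReal_nonneg
  refine le_trans (measure_mono ?_) (hch.trans ?_)
  · intro ζ hζ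
    simp only [mem_setOf_eq, mem_Iic] at hζ ⊢
    rw [ENNReal.ofReal_le_ofReal_iff (by positivity)] at hζ
    have e : ∑ x ∈ F, l x * φ (z x ζ) = -((∑ x ∈ F, l x * max (z x ζ) 0) / ((2*L:ℕ) * r n)) := by
      rw [Finset.sum_div, ← Finset.sum_neg_distrib]
      apply Finset.sum_congr rfl
      intro x _; simp only [hφ]; ring
    rw [e]
    apply neg_le_neg
    rw [div_le_div_iff₀ (by positivity) (by positivity)]
    have := mul_le_mul_of_nonneg_right hζ (show 0 ≤ 4 * ((2*L:ℕ):ℝ) by positivity)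
    linarith
  · apply ENNReal.ofReal_le_ofReal
    apply Real.exp_le_exp.mpr
    rw [hsum]
    change -(p/2) * n / _ - _ ≤ _
    have e2 : -(p/2) * n / ((2*L:ℕ):ℝ) - -(n * p / (4 * (2*L:ℕ))) = -(n * p / (4 * (2*L:ℕ))) := by field_simp; ring
    rw [e2]
    apply neg_le_neg
    rw [le_div_iff₀ (by positivity)]
    have e3 : (n:ℝ)^(η/2) * (n:ℝ)^(η/2) = (n:ℝ)^η := by rw [← Real.rpow_add (by linarith)]; congr 1; ring
    calc 1/16 * (n:ℝ)^(η/2) * (4 * (2*L:ℕ)) ≤ 1/16 * (n:ℝ)^(η/2) * (4 * (4 * (n:ℝ)^(η/2))) := by gcongr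
      _ = (n:ℝ)^η := by rw [← e3]; ring
      _ ≤ _ := hp

/-- Upper tails of truncated clocks. -/
lemma Wk.Q2 (hd : 3 ≤ d) (W : Wk d P Y) (hz : IsScenery d α μ z) {ψ : ℕ → ℝ → ℝ} (hψ : ∀ n, Measurable (ψ n)) (hψ0 : ∀ n y, 0 ≤ ψ n y)
    {M : ℕ → ℝ} (hM : ∀ᶠ n in atTop, 0 < M n) (hψM : ∀ n y, ψ n y ≤ M n) {C : ℝ} (hC : 0 ≤ C)
    (hE : ∀ᶠ n : ℕ in atTop, ∫⁻ ζ, ENNReal.ofReal (ψ n (z 0 ζ)) ∂μ ≤ ENNReal.ofReal (M n * C / n)) {ε : ℝ} (hε : 0 < ε) (K : ℝ) :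
    ∀ᵐ ζ ∂μ, ∀ᶠ n : ℕ in atTop, P {ω | ENNReal.ofReal (M n * (n:ℝ)^ε) ≤ Acl (fun v => ENNReal.ofReal (ψ n (z v ζ))) Y n ω} ≤ ENNReal.ofReal ((n:ℝ)^(-K)) := by
  have := hz.prob
  refine W.quench hd hz hψ hψ0 (fun n => Ici (ENNReal.ofReal (M n * (n:ℝ)^ε))) (fun n => measurableSet_Ici) (η := ε/2) (c := 1/8)
    (by positivity) (by norm_num) ?_ K
  filter_upwards [hM, hE, eventually_ge_atTop 1, tendsto_natCast_atTop_atTop.eventually (const_le_rpow (8 * C) (half_pos hε))] with n hM hE hn hbig F l hl0 hlL hsum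
  have hn0 : (1:ℝ) ≤ n := by exact_mod_cast hn
  set L : ℕ := ⌈(n:ℝ)^(ε/2)⌉₊ with hL
  have hx1 : 1 ≤ (n:ℝ)^(ε/2) := Real.one_le_rpow hn0 (by positivity)
  have hL1 : (1:ℝ) ≤ (2*L:ℕ) := by
    have : 0 < L := Nat.ceil_pos.mpr (by linarith)
    exact_mod_cast (by omega : 1 ≤ 2 * L)
  have hL0 : (0:ℝ) < (2*L:ℕ) := by linarith
  have hL2 : ((2*L:ℕ):ℝ) ≤ 4 * (n:ℝ)^(ε/2) := by
    push_cast; have := ceil_le_two hx1; rw [← hL] at this; linarith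
  set φ : ℝ → ℝ := fun y => ψ n y / ((2*L:ℕ) * M n) with hφ
  have hφm : Measurable φ := (hψ n).div_const _
  have e0 : ∀ y, ((2*L:ℕ):ℝ) * φ y = ψ n y / M n := fun y => by simp only [hφ]; field_simp
  have hm := laplace_up (μ := μ) (X := fun ζ => ((2*L:ℕ):ℝ) * φ (z 0 ζ)) ((hφm.comp (hz.meas 0)).const_mul _)
    (fun ζ => by rw [e0]; exact div_nonneg (hψ0 _ _) hM.le)
    (fun ζ => by rw [e0, div_le_one hM]; exact hψM _ _) (e := C / n) (by positivity)
    (by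
      simp only [e0]
      have e1 : ∀ ζ, ENNReal.ofReal (ψ n (z 0 ζ) / M n) = ENNReal.ofReal (M n)⁻¹ * ENNReal.ofReal (ψ n (z 0 ζ)) := by
        intro ζ
        rw [← ENNReal.ofReal_mul (by positivity)]; congr 1; ring
      simp only [e1]
      have hmm : Measurable fun ζ => ENNReal.ofReal (ψ n (z 0 ζ)) := ((hψ n).comp (hz.meas 0)).ennreal_ofReal
      rw [lintegral_const_mul _ hmm]
      refine (mul_le_mul_right hE _).trans ?_
      rw [← ENNReal.ofReal_mul (by positivity)]
      apply le_of_eq; congr 1; field_simp)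
  have hch := chernoff hz hφm F hL0 hl0 hlL (a := (n:ℝ)^ε / (2*L:ℕ)) hm
  refine le_trans (measure_mono ?_) (hch.trans ?_)
  · intro ζ hζ
    simp only [mem_setOf_eq, mem_Ici] at hζ ⊢
    rw [ENNReal.ofReal_le_ofReal_iff (Finset.sum_nonneg fun x hx => mul_nonneg (hl0 x hx) (hψ0 _ _))] at hζ
    have e : ∑ x ∈ F, l x * φ (z x ζ) = (∑ x ∈ F, l x * ψ n (z x ζ)) / ((2*L:ℕ) * M n) := by
      rw [Finset.sum_div]
      apply Finset.sum_congr rfl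
      intro x _; simp only [hφ]; ring
    rw [e, div_le_div_iff₀ (by positivity) (by positivity)]
    have := mul_le_mul_of_nonneg_right hζ hL0.le
    linarith
  · apply ENNReal.ofReal_le_ofReal
    apply Real.exp_le_exp.mpr
    rw [hsum]
    have e2 : 2 * (C/n) * n / ((2*L:ℕ):ℝ) - (n:ℝ)^ε / (2*L:ℕ) = -(((n:ℝ)^ε - 2 * C) / (2*L:ℕ)) := by field_simp; ring
    rw [e2]
    apply neg_le_neg
    rw [le_div_iff₀ hL0]
    have e3 : (n:ℝ)^(ε/2) * (n:ℝ)^(ε/2) = (n:ℝ)^ε := by rw [← Real.rpow_add (by linarith)]; congr 1; ring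
    have e4 : 1/8 * (n:ℝ)^(ε/2) * (2*L:ℕ) ≤ 1/8 * (n:ℝ)^(ε/2) * (4 * (n:ℝ)^(ε/2)) := by gcongr
    have e5 : (n:ℝ)^(ε/2) ≤ (n:ℝ)^ε := Real.rpow_le_rpow_of_exponent_le hn0 (by linarith)
    nlinarith

end
end LRC

set_option linter.all false

namespace LRC
open scoped NNReal

lemma rpow_cmp {n t : ℝ} (a : ℝ) (ht : 0 < t) (h1 : t/2 ≤ n) (h2 : n ≤ 2*t) : n^a ≤ 2^|a| * t^a := by
  have hn : 0 < n := by linarith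
  rcases le_or_gt 0 a with h | h
  · rw [abs_of_nonneg h, ← Real.mul_rpow (by norm_num) ht.le]
    exact Real.rpow_le_rpow hn.le h2 h
  · rw [abs_of_neg h, Real.rpow_neg (by norm_num), ← Real.inv_rpow (by norm_num), ← Real.mul_rpow (by norm_num) ht.le]
    exact Real.rpow_le_rpow_of_nonpos (by positivity) (by linarith) h.le

lemma rpow_ev (C : ℝ) {a b : ℝ} (h : a < b) : ∀ᶠ t : ℝ in atTop, C * t^a ≤ t^b := by
  filter_upwards [const_le_rpow C (sub_pos.mpr h), eventually_gt_atTop 0] with t ht ht0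
  calc C * t^a ≤ t^(b-a) * t^a := by gcongr
    _ = t^b := by rw [← Real.rpow_add ht0]; congr 1; ring

lemma floor_near : ∀ᶠ t : ℝ in atTop, 1 ≤ t ∧ t/2 ≤ (⌊t⌋₊:ℝ) ∧ (⌊t⌋₊:ℝ) ≤ t := by
  filter_upwards [eventually_ge_atTop 2] with t ht
  refine ⟨by linarith, ?_, Nat.floor_le (by linarith)⟩
  have := Nat.lt_floor_add_one t
  linarith

lemma ceil_near : ∀ᶠ t : ℝ in atTop, 1 ≤ t ∧ t ≤ (⌈t⌉₊:ℝ) ∧ (⌈t⌉₊:ℝ) ≤ 2*t := by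
  filter_upwards [eventually_ge_atTop 2] with t ht
  exact ⟨by linarith, Nat.le_ceil t, ceil_le_two (by linarith)⟩

section
variable {Ω : Type*} [MeasurableSpace Ω]
variable {d : ℕ} {P : Measure Ω} {Y : ℝ → Ω → (Fin d → ℤ)}
variable {Ωz : Type*} [MeasurableSpace Ωz] {μ : Measure Ωz} {z : (Fin d → ℤ) → Ωz → ℝ} {α : ℝ}

lemma Acl_mono_t (g : (Fin d → ℤ) → ENNReal) {s t : ℝ} (h : s ≤ t) (ω : Ω) : Acl g Y s ω ≤ Acl g Y t ω :=
  lintegral_mono_set (Ioc_subset_Ioc_right h)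

lemma moment (hα : 0 < α) (hz : IsScenery d α μ z) {β : ℝ} (hβ : 0 < β) (hβα : β < α) :
    ∃ C, 0 ≤ C ∧ ∫⁻ ζ, ENNReal.ofReal (z 0 ζ ^ β) ∂μ ≤ ENNReal.ofReal C := by
  have := hz.prob
  suffices h : ∫⁻ ζ, ENNReal.ofReal (z 0 ζ ^ β) ∂μ < ⊤ from
    ⟨_, ENNReal.toReal_nonneg, (ENNReal.ofReal_toReal h.ne).ge⟩
  rw [lintegral_rpow_eq_lintegral_meas_lt_mul μ (ae_of_all _ (hz.nonneg 0)) (hz.meas 0).aemeasurable hβ]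
  apply ENNReal.mul_lt_top ENNReal.ofReal_lt_top
  obtain ⟨r0, hr0⟩ := eventually_atTop.mp ((pz_bounds hα hz (ε := (α-β)/2) (by linarith)).and (eventually_gt_atTop 0))
  have hr00 : 0 < r0 := (hr0 r0 le_rfl).2
  rw [← Ioc_union_Ioi_eq_Ioi hr00.le]
  refine (lintegral_union_le _ _ _).trans_lt (ENNReal.add_lt_top.mpr ⟨?_, ?_⟩)
  · have hi : IntegrableOn (fun t : ℝ => t^(β-1)) (Ioc 0 r0) :=
      (intervalIntegrable_iff_integrableOn_Ioc_of_le hr00.le).mp (intervalIntegral.intervalIntegrable_rpow' (by linarith))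
    refine lt_of_le_of_lt ?_ hi.lintegral_lt_top
    apply lintegral_mono
    intro t
    calc _ ≤ 1 * ENNReal.ofReal (t^(β-1)) := mul_le_mul_left prob_le_one _
      _ = _ := one_mul _
  · have hi : IntegrableOn (fun t : ℝ => t^(-α+(α-β)/2+(β-1))) (Ioi r0) :=
      integrableOn_Ioi_rpow_of_lt (by linarith) hr00
    refine lt_of_le_of_lt ?_ hi.lintegral_lt_top
    apply setLIntegral_mono' measurableSet_Ioi
    intro t ht
    have ht0 : 0 < t := hr00.trans ht
    have h := (hr0 t (le_of_lt ht)).1.2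
    rw [Real.rpow_add ht0, ENNReal.ofReal_mul (by positivity)]
    refine mul_le_mul_left ?_ _
    rw [← ENNReal.ofReal_toReal (measure_ne_top μ {a | t < z 0 a})]
    exact ENNReal.ofReal_le_ofReal h

lemma Wk.low_gen (hd : 3 ≤ d) (W : Wk d P Y) (hz : IsScenery d α μ z) {r : ℕ → ℝ} (hr : ∀ᶠ n in atTop, 0 < r n) {η : ℝ} (hη : 0 < η)
    (hp : ∀ᶠ n : ℕ in atTop, (n:ℝ)^η ≤ n * pz μ z (r n)) {b : ℝ → ℝ}
    (hb : ∀ᶠ t : ℝ in atTop, b t ≤ (⌊t⌋₊:ℝ) * r ⌊t⌋₊ * pz μ z (r ⌊t⌋₊) / 4) (K : ℝ) :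
    ∀ᵐ ζ ∂μ, ∀ᶠ t : ℝ in atTop, P {ω | Acl (fun v => ENNReal.ofReal (z v ζ)) Y t ω ≤ ENNReal.ofReal (b t)} ≤ ENNReal.ofReal (t^(-K)) := by
  filter_upwards [W.Q1 hd hz hr hη hp (K+1)] with ζ h
  filter_upwards [(tendsto_nat_floor_atTop (α := ℝ)).eventually h, hb, floor_near, rpow_ev (2^|-(K+1)|) (show -(K+1) < -K by linarith)] with t h hb hf hK
  refine (measure_mono ?_).trans (h.trans (ENNReal.ofReal_le_ofReal ?_))
  · intro ω hω
    simp only [mem_setOf_eq] at hω ⊢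
    exact (Acl_mono_t _ hf.2.2 ω).trans (hω.trans (ENNReal.ofReal_le_ofReal hb))
  · exact (rpow_cmp _ (by linarith [hf.1]) hf.2.1 (by linarith [hf.1, hf.2.2])).trans hK

lemma Wk.low_lin (hd : 3 ≤ d) (hα : 0 < α) (W : Wk d P Y) (hz : IsScenery d α μ z) :
    ∃ c > 0, ∀ K : ℝ, ∀ᵐ ζ ∂μ, ∀ᶠ t : ℝ in atTop, P {ω | Acl (fun v => ENNReal.ofReal (z v ζ)) Y t ω ≤ ENNReal.ofReal (c*t)} ≤ ENNReal.ofReal (t^(-K)) := by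
  obtain ⟨r0, hr0, hr1⟩ := ((pz_bounds hα hz one_pos).and (eventually_gt_atTop 0)).exists
  have hp : 0 < pz μ z r0 := lt_of_lt_of_le (by positivity) hr0.1
  refine ⟨r0 * pz μ z r0 / 8, by positivity, fun K => ?_⟩
  refine W.low_gen hd hz (r := fun _ => r0) (η := 1/2) (Eventually.of_forall fun _ => hr1) (by norm_num) ?_ ?_ K
  · have := tendsto_natCast_atTop_atTop.eventually (rpow_ev (pz μ z r0)⁻¹ (show (1/2:ℝ) < 1 by norm_num))
    filter_upwards [this] with n hn
    rw [Real.rpow_one, inv_mul_le_iff₀ hp] at hn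
    linarith
  · filter_upwards [floor_near] with t ht
    have : r0 * pz μ z r0 * (t/2) ≤ r0 * pz μ z r0 * (⌊t⌋₊:ℝ) := by gcongr; exact ht.2.1
    linarith

lemma Wk.low_pow (hd : 3 ≤ d) (hα : 0 < α) (W : Wk d P Y) (hz : IsScenery d α μ z) {γ : ℝ} (hγ : γ < max (1/α) 1) (K : ℝ) :
    ∀ᵐ ζ ∂μ, ∀ᶠ t : ℝ in atTop, P {ω | Acl (fun v => ENNReal.ofReal (z v ζ)) Y t ω ≤ ENNReal.ofReal (t^γ)} ≤ ENNReal.ofReal (t^(-K)) := by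
  rcases lt_max_iff.mp hγ with h | h
  · obtain ⟨s, hs1, hs2⟩ := exists_between (max_lt h (show 0 < 1/α by positivity))
    have hs0 : 0 < s := (le_max_right _ _).trans_lt hs1
    have hsγ : γ < s := (le_max_left _ _).trans_lt hs1
    rw [lt_div_iff₀ hα] at hs2
    set ε := (1 - s*α)/(2*s) with hε
    have hε0 : 0 < ε := by apply div_pos <;> linarith
    set η := 1 - s*(α+ε) with hη
    have e1 : s * ε = (1 - s*α)/2 := by rw [hε]; field_simp
    have hη0 : 0 < η := by rw [hη, mul_add, e1]; linarith
    have hpow := ((tendsto_rpow_atTop hs0).comp tendsto_natCast_atTop_atTop).eventually (pz_bounds hα hz hε0)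
    have hp : ∀ᶠ n : ℕ in atTop, (n:ℝ)^η ≤ n * pz μ z ((n:ℝ)^s) := by
      filter_upwards [hpow, eventually_gt_atTop 0] with n h hn
      have hn0 : (0:ℝ) < n := by exact_mod_cast hn
      have h1 := h.1
      simp only [Function.comp] at h1
      rw [← Real.rpow_mul hn0.le] at h1
      calc (n:ℝ)^η = n * (n:ℝ)^(s*(-α-ε)) := by
            rw [mul_comm, ← Real.rpow_add_one hn0.ne']; congr 1; rw [hη]; ring
        _ ≤ _ := by gcongr
    refine W.low_gen hd hz (r := fun n => (n:ℝ)^s) (η := η) ?_ hη0 hp ?_ K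
    · filter_upwards [eventually_gt_atTop 0] with n hn
      have hn0 : (0:ℝ) < n := by exact_mod_cast hn
      positivity
    · filter_upwards [(tendsto_nat_floor_atTop (α := ℝ)).eventually hp, floor_near, rpow_ev (4 * 2^|s|) hsγ] with t hp hf hb
      have ht : 0 < t := by linarith [hf.1]
      have a1 := rpow_cmp (n := t) (t := (⌊t⌋₊:ℝ)) s (by linarith [hf.1,hf.2.1]) (by linarith [hf.2.2]) (by linarith [hf.2.1])
      have a2 : (1:ℝ) ≤ (⌊t⌋₊:ℝ) := by
        exact_mod_cast Nat.one_le_iff_ne_zero.mpr (by have := Nat.floor_pos.mpr hf.1; omega)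
      have a3 : 1 ≤ (⌊t⌋₊:ℝ)^η := Real.one_le_rpow a2 hη0.le
      have a4 : (⌊t⌋₊:ℝ)^s ≤ (⌊t⌋₊:ℝ) * (⌊t⌋₊:ℝ)^s * pz μ z ((⌊t⌋₊:ℝ)^s) := by
        have : (⌊t⌋₊:ℝ)^s * 1 ≤ (⌊t⌋₊:ℝ)^s * ((⌊t⌋₊:ℝ) * pz μ z ((⌊t⌋₊:ℝ)^s)) := by gcongr; linarith
        linarith
      have a5 : 4 * 2^|s| * t^γ ≤ 2^|s| * (⌊t⌋₊:ℝ)^s := hb.trans a1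
      have a6 : 4 * t^γ ≤ (⌊t⌋₊:ℝ)^s := by
        have : (0:ℝ) < 2^|s| := by positivity
        nlinarith
      linarith
  · obtain ⟨c, hc, hK⟩ := W.low_lin hd hα hz
    filter_upwards [hK K] with ζ h1
    filter_upwards [h1, rpow_ev c⁻¹ h] with t h1 h2
    refine (measure_mono ?_).trans h1
    intro ω hω
    simp only [mem_setOf_eq] at hω ⊢
    refine hω.trans (ENNReal.ofReal_le_ofReal ?_)
    rw [Real.rpow_one, inv_mul_le_iff₀ hc] at h2
    exact h2

/-- upper tails of the clock truncated at height `n^θ` -/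
lemma Wk.up_trunc (hd : 3 ≤ d) (hα : 0 < α) (W : Wk d P Y) (hz : IsScenery d α μ z) {θ : ℝ} (hθ : max (1/α) 1 < θ) {ε : ℝ} (hε : 0 < ε) (K : ℝ) :
    ∀ᵐ ζ ∂μ, ∀ᶠ t : ℝ in atTop, P {ω | ENNReal.ofReal (t^(θ+ε)) ≤ Acl (fun v => ENNReal.ofReal ((Iic ((⌈t⌉₊:ℝ)^θ)).indicator (fun y => max y 0) (z v ζ))) Y t ω} ≤ ENNReal.ofReal (t^(-K)) := by
  have := hz.prob
  have h1θ : 1 < θ := (le_max_right _ _).trans_lt hθ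
  have hαθ : 1/α < θ := (le_max_left _ _).trans_lt hθ
  have hθ0 : 0 < θ := by linarith
  obtain ⟨C, hC, hmom⟩ := moment hα hz (β := 1/θ) (by positivity) (by rw [div_lt_iff₀ hα] at hαθ; rw [div_lt_iff₀ hθ0]; linarith)
  have hQ := W.Q2 hd hz (ψ := fun n => (Iic ((n:ℝ)^θ)).indicator (fun y => max y 0)) (M := fun n => (n:ℝ)^θ) (C := C)
    (fun n => (measurable_id.max measurable_const).indicator measurableSet_Iic)
    (fun n y => indicator_nonneg (fun _ _ => le_max_right _ _) _)
    (by filter_upwards [eventually_gt_atTop 0] with n hn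
        have hn0 : (0:ℝ) < n := by exact_mod_cast hn
        positivity)
    (by intro n y
        by_cases h : y ∈ Iic ((n:ℝ)^θ)
        · rw [indicator_of_mem h]; exact max_le h (by positivity)
        · rw [indicator_of_notMem h]; positivity) hC
    (by
      filter_upwards [eventually_gt_atTop 0] with n hn
      have hn0 : (0:ℝ) < n := by exact_mod_cast hn
      have hb : ∀ ζ, ENNReal.ofReal ((Iic ((n:ℝ)^θ)).indicator (fun y => max y 0) (z 0 ζ)) ≤ ENNReal.ofReal ((n:ℝ)^(θ-1)) * ENNReal.ofReal (z 0 ζ ^ (1/θ)) := by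
        intro ζ
        rw [← ENNReal.ofReal_mul (by positivity)]
        apply ENNReal.ofReal_le_ofReal
        have hz0 := hz.nonneg 0 ζ
        by_cases h : z 0 ζ ∈ Iic ((n:ℝ)^θ)
        · rw [indicator_of_mem h, max_eq_left hz0]
          rcases hz0.eq_or_lt with h0 | h0
          · rw [← h0]; positivity
          · calc z 0 ζ = z 0 ζ ^ (1 - 1/θ) * z 0 ζ ^ (1/θ) := by
                  rw [← Real.rpow_add h0]; simp
              _ ≤ ((n:ℝ)^θ) ^ (1 - 1/θ) * z 0 ζ ^ (1/θ) := by
                  gcongr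
                  · rw [sub_nonneg, div_le_one hθ0]; exact h1θ.le
                  · exact h
              _ = _ := by
                  rw [← Real.rpow_mul hn0.le]; congr 2; field_simp
        · rw [indicator_of_notMem h]; positivity
      refine (lintegral_mono hb).trans ?_
      have hmm : Measurable fun ζ => ENNReal.ofReal (z 0 ζ ^ (1/θ)) := ((hz.meas 0).pow_const _).ennreal_ofReal
      rw [lintegral_const_mul _ hmm]
      refine (mul_le_mul_right hmom _).trans ?_
      rw [← ENNReal.ofReal_mul (by positivity)]
      apply le_of_eq; congr 1
      rw [Real.rpow_sub_one hn0.ne']; ring) (half_pos hε) (max K 0)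
  filter_upwards [hQ] with ζ h
  filter_upwards [(tendsto_nat_ceil_atTop (α := ℝ)).eventually h, ceil_near, rpow_ev (2^|θ+ε/2|) (show θ+ε/2 < θ+ε by linarith)] with t h hf hb
  have ht : 0 < t := by linarith [hf.1]
  have hn0 : (0:ℝ) < ⌈t⌉₊ := by linarith [hf.2.1]
  refine (measure_mono ?_).trans (h.trans (ENNReal.ofReal_le_ofReal ?_))
  · intro ω hω
    simp only [mem_setOf_eq] at hω ⊢
    refine le_trans (ENNReal.ofReal_le_ofReal ?_) (hω.trans (Acl_mono_t _ hf.2.1 ω))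
    rw [← Real.rpow_add hn0]
    exact (rpow_cmp _ ht (by linarith [hf.2.1]) hf.2.2).trans hb
  · calc (⌈t⌉₊:ℝ)^(-(max K 0)) ≤ t^(-(max K 0)) := Real.rpow_le_rpow_of_nonpos ht hf.2.1 (by simp)
      _ ≤ _ := Real.rpow_le_rpow_of_exponent_le hf.1 (by simp)

/-- upper tails of the time spent in high layers -/
lemma Wk.up_high (hd : 3 ≤ d) (hα : 0 < α) (W : Wk d P Y) (hz : IsScenery d α μ z) {θ : ℝ} (hθ : 1/α < θ) {ε : ℝ} (hε : 0 < ε) (K : ℝ) :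
    ∀ᵐ ζ ∂μ, ∀ᶠ t : ℝ in atTop, P {ω | ENNReal.ofReal (t^ε) ≤ Acl (fun v => ind (t^θ < z v ζ)) Y t ω} ≤ ENNReal.ofReal (t^(-K)) := by
  have := hz.prob
  have hθ0 : 0 < θ := lt_trans (by positivity) hθ
  rw [div_lt_iff₀ hα] at hθ
  set κ := (θ*α-1)/θ with hκ
  have hκ0 : 0 < κ := by apply div_pos <;> linarith
  have hQ := W.Q2 hd hz (ψ := fun n => (Ioi (((n:ℝ)/2)^θ)).indicator (fun y => 1)) (M := fun n => 1) (C := 2)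
    (fun n => measurable_const.indicator measurableSet_Ioi)
    (fun n y => indicator_nonneg (fun _ _ => zero_le_one) _)
    (Eventually.of_forall fun _ => one_pos)
    (by intro n y
        by_cases h : y ∈ Ioi (((n:ℝ)/2)^θ)
        · rw [indicator_of_mem h]
        · rw [indicator_of_notMem h]; norm_num) (by norm_num)
    (by
      have hlim : Tendsto (fun n : ℕ => ((n:ℝ)/2)^θ) atTop atTop :=
        (tendsto_rpow_atTop hθ0).comp (tendsto_natCast_atTop_atTop.atTop_div_const (by norm_num))
      filter_upwards [eventually_gt_atTop 0, hlim.eventually (pz_bounds hα hz hκ0)] with n hn hp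
      have hn0 : (0:ℝ) < n := by exact_mod_cast hn
      have e : ∀ ζ, ENNReal.ofReal ((Ioi (((n:ℝ)/2)^θ)).indicator (fun y => 1) (z 0 ζ)) = ind (((n:ℝ)/2)^θ < z 0 ζ) := by
        intro ζ
        by_cases h : z 0 ζ ∈ Ioi (((n:ℝ)/2)^θ)
        · rw [indicator_of_mem h, ind_true (mem_Ioi.mp h)]; simp
        · rw [indicator_of_notMem h, ind_false (fun hh => h (mem_Ioi.mpr hh))]; simp
      simp only [e]
      rw [lintegral_ind μ (measurableSet_lt measurable_const (hz.meas 0)), ← ENNReal.ofReal_toReal (measure_ne_top μ _)]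
      apply ENNReal.ofReal_le_ofReal
      refine hp.2.trans ?_
      rw [← Real.rpow_mul (by positivity), show θ * (-α+κ) = -1 by rw [hκ]; field_simp; ring, Real.rpow_neg_one]
      apply le_of_eq; field_simp) (half_pos hε) (max K 0)
  filter_upwards [hQ] with ζ h
  filter_upwards [(tendsto_nat_ceil_atTop (α := ℝ)).eventually h, ceil_near, rpow_ev (2^|ε/2|) (show ε/2 < ε by linarith)] with t h hf hb
  have ht : 0 < t := by linarith [hf.1]
  have hn0 : (0:ℝ) < ⌈t⌉₊ := by linarith [hf.2.1]
  refine (measure_mono ?_).trans (h.trans (ENNReal.ofReal_le_ofReal ?_))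
  · intro ω hω
    simp only [mem_setOf_eq] at hω ⊢
    refine le_trans (ENNReal.ofReal_le_ofReal ?_) (hω.trans ((Acl_mono_t _ hf.2.1 ω).trans ?_))
    · rw [one_mul]
      exact (rpow_cmp _ ht (by linarith [hf.2.1]) hf.2.2).trans hb
    · apply lintegral_mono
      intro u
      dsimp only
      by_cases hh : t^θ < z (Y u ω) ζ
      · have : z (Y u ω) ζ ∈ Ioi (((⌈t⌉₊:ℝ)/2)^θ) := lt_of_le_of_lt (Real.rpow_le_rpow (by positivity) (by linarith [hf.2.2]) hθ0.le) hh
        rw [indicator_of_mem this]; simpa using ind_le_one _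
      · rw [ind_false hh]; exact zero_le
  · calc (⌈t⌉₊:ℝ)^(-(max K 0)) ≤ t^(-(max K 0)) := Real.rpow_le_rpow_of_nonpos ht hf.2.1 (by simp)
      _ ≤ _ := Real.rpow_le_rpow_of_exponent_le hf.1 (by simp)

end
end LRC

set_option linter.all false

namespace LRC
open scoped NNReal

lemma dyadic {Q : ℕ → Prop} (h : ∀ᶠ i in atTop, Q i) :
    ∀ᶠ t : ℝ in atTop, ∃ i : ℕ, Q i ∧ (2:ℝ)^i ≤ t ∧ t < 2 * (2:ℝ)^i := by
  obtain ⟨N, hN⟩ := eventually_atTop.mp h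
  filter_upwards [eventually_ge_atTop ((2:ℝ)^N), eventually_ge_atTop 1] with t ht h1
  obtain ⟨i, hi1, hi2⟩ := exists_nat_pow_near h1 (one_lt_two)
  refine ⟨i, hN i ?_, hi1, by rw [pow_succ] at hi2; linarith⟩
  have : (2:ℝ)^N < 2^(i+1) := ht.trans_lt hi2
  have := (pow_lt_pow_iff_right₀ (one_lt_two (α := ℝ))).mp this
  omega

lemma two_pow_tendsto : Tendsto (fun i : ℕ => (2:ℝ)^i) atTop atTop := tendsto_pow_atTop_atTop_of_one_lt one_lt_two

lemma two_pow_summable {κ : ℝ} (hκ : 0 < κ) : Summable fun i : ℕ => ((2:ℝ)^i)^(-κ) := by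
  have e : (fun i : ℕ => ((2:ℝ)^i)^(-κ)) = fun i : ℕ => ((2:ℝ)^(-κ))^i := by
    funext i
    rw [← Real.rpow_natCast, ← Real.rpow_natCast, ← Real.rpow_mul (by norm_num), ← Real.rpow_mul (by norm_num)]
    congr 1; ring
  rw [e]
  exact summable_geometric_of_lt_one (by positivity) (Real.rpow_lt_one_of_one_lt_of_neg one_lt_two (by linarith))

section
variable {Ω : Type*} [MeasurableSpace Ω]
variable {d : ℕ} {P : Measure Ω} {Y : ℝ → Ω → (Fin d → ℤ)}
variable {Ωz : Type*} [MeasurableSpace Ωz] {μ : Measure Ωz} {z : (Fin d → ℤ) → Ωz → ℝ} {α : ℝ}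

lemma ind_pz (hz : IsScenery d α μ z) (r : ℝ) (x : Fin d → ℤ) : ∫⁻ ζ, ind (r < z x ζ) ∂μ = ENNReal.ofReal (pz μ z r) := by
  have := hz.prob
  rw [lintegral_ind μ (measurableSet_lt measurable_const (hz.meas x))]
  have h := (hz.ident x).measure_mem_eq (measurableSet_Ioi (a := r))
  unfold pz
  rw [ENNReal.ofReal_toReal (measure_ne_top μ _)]
  exact h

lemma green_mean (hd : 0 < d) (hz : IsScenery d α μ z) (r : ℝ) (N : ℕ) :
    ∫⁻ ζ, ∑' x, ind (r < z x ζ) * ∑ j ∈ Finset.range N, ENNReal.ofReal (heatKernel d (j+1) 0 x) ∂μ = ENNReal.ofReal (pz μ z r) * N := by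
  have hm : ∀ x, Measurable fun ζ => ind (r < z x ζ) := fun x => measurable_ind (measurableSet_lt measurable_const (hz.meas x))
  rw [lintegral_tsum (fun x => ((hm x).mul_const _).aemeasurable)]
  have e : ∀ x, ∫⁻ ζ, ind (r < z x ζ) * ∑ j ∈ Finset.range N, ENNReal.ofReal (heatKernel d (j+1) 0 x) ∂μ =
      ENNReal.ofReal (pz μ z r) * ∑ j ∈ Finset.range N, ENNReal.ofReal (heatKernel d (j+1) 0 x) := by
    intro x
    rw [lintegral_mul_const _ (hm x), ind_pz hz]
  simp only [e]
  rw [ENNReal.tsum_mul_left, Summable.tsum_finsetSum (fun _ _ => ENNReal.summable)]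
  congr 1
  rw [Finset.sum_congr rfl fun (j:ℕ) _ => heat_tsum d hd (show (0:ℝ) ≤ j+1 by positivity) 0]
  simp

lemma Wk.visit (hd : 3 ≤ d) (hα : 0 < α) (W : Wk d P Y) (hz : IsScenery d α μ z) {θ : ℝ} (hθ : 0 < θ) {ε : ℝ} (hε : 0 < ε) :
    ∀ᵐ ζ ∂μ, ∀ᶠ t : ℝ in atTop, P {ω | (∃ u ∈ Icc 0 t, t^θ < z (Y u ω) ζ) ∧ Y t ω = 0} ≤ ENNReal.ofReal (t^(1-θ*α-d/2+ε)) := by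
  have hd0 : 0 < d := by omega
  set f : ℕ → Ωz → ENNReal := fun i ζ => ∑' x, ind (((2:ℝ)^i)^θ < z x ζ) * ∑ j ∈ Finset.range (⌊2*(2:ℝ)^i⌋₊+1), ENNReal.ofReal (heatKernel d (j+1) 0 x) with hf
  have hbc := bc (μ := μ) (f := f) (g := fun i => ((2:ℝ)^i)^(-(ε/8))) (b := fun i => ((2:ℝ)^i)^(1-θ*α+ε/2))
    (fun i => Measurable.ennreal_tsum fun x => (measurable_ind (measurableSet_lt measurable_const (hz.meas x))).mul_const _)
    (by
      have hlim : Tendsto (fun i : ℕ => ((2:ℝ)^i)^θ) atTop atTop := (tendsto_rpow_atTop hθ).comp two_pow_tendsto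
      filter_upwards [hlim.eventually (pz_bounds hα hz (show 0 < ε/4/θ by positivity)),
        two_pow_tendsto.eventually (rpow_ev 3 (show 1-θ*α+ε/4 < 1-θ*α+3*ε/8 by linarith))] with i h1 h2
      rw [hf, green_mean hd0 hz]
      have hT : (1:ℝ) ≤ 2^i := one_le_pow₀ (by norm_num)
      set T := (2:ℝ)^i with hTd
      have hT0 : 0 < T := by linarith
      rw [← ENNReal.ofReal_natCast, ← ENNReal.ofReal_mul (show 0 ≤ pz μ z (T^θ) from ENNReal.toReal_nonneg)]
      apply ENNReal.ofReal_le_ofReal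
      have a1 : ((⌊2*T⌋₊+1:ℕ):ℝ) ≤ 3 * T := by
        push_cast
        have := Nat.floor_le (show 0 ≤ 2*T by positivity)
        linarith
      have a2 := h1.2
      rw [← Real.rpow_mul hT0.le] at a2
      calc pz μ z (T^θ) * ((⌊2*T⌋₊+1:ℕ):ℝ) ≤ T^(θ*(-α+ε/4/θ)) * (3*T) := by gcongr
        _ = 3 * T^(1-θ*α+ε/4) := by
            rw [show θ*(-α+ε/4/θ) = (1-θ*α+ε/4) - 1 by field_simp; ring, Real.rpow_sub_one hT0.ne']
            field_simp
        _ ≤ _ := h2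
        _ = _ := by rw [← Real.rpow_add hT0]; congr 1; ring)
    (two_pow_summable (by positivity)) (fun i => by positivity) (Eventually.of_forall fun i => by positivity)
  filter_upwards [hbc] with ζ h
  filter_upwards [dyadic h, eventually_ge_atTop 2, rpow_ev ((2*Real.exp (6*d)*2^|-(d:ℝ)/2|) * (2^|1-θ*α+ε/2|)) (show 1-θ*α-d/2+ε/2 < 1-θ*α-d/2+ε by linarith)] with t ⟨i, h, hi1, hi2⟩ ht hC
  set T := (2:ℝ)^i with hTd
  have ht0 : 0 < t := by linarith
  have hT0 : 0 < T := by positivity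
  refine (W.vis hd0 ht (fun v => t^θ < z v ζ)).trans ?_
  have a1 : ∑' x, ind (t^θ < z x ζ) * ∑ j ∈ Finset.range (⌊t⌋₊+1), ENNReal.ofReal (heatKernel d (j+1) 0 x) ≤ f i ζ := by
    apply ENNReal.tsum_le_tsum
    intro x
    refine mul_le_mul' (ind_mono fun hx => lt_of_le_of_lt (Real.rpow_le_rpow hT0.le hi1 hθ.le) hx) ?_
    apply Finset.sum_le_sum_of_subset
    intro j hj
    rw [Finset.mem_range] at hj ⊢
    have := Nat.floor_le_floor hi2.le
    rw [hTd] at this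
    omega
  refine (mul_le_mul_right (a1.trans h) _).trans ?_
  rw [← ENNReal.ofReal_mul (by positivity)]
  apply ENNReal.ofReal_le_ofReal
  have b1 := rpow_cmp (n := t/2) (t := t) (-(d:ℝ)/2) ht0 le_rfl (by linarith)
  have b2 := rpow_cmp (n := T) (t := t) (1-θ*α+ε/2) ht0 (by linarith) (by linarith)
  calc 2 * Real.exp (6*d) * (t/2)^(-(d:ℝ)/2) * T^(1-θ*α+ε/2)
      ≤ 2 * Real.exp (6*d) * (2^|-(d:ℝ)/2| * t^(-(d:ℝ)/2)) * (2^|1-θ*α+ε/2| * t^(1-θ*α+ε/2)) := by gcongr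
    _ = ((2*Real.exp (6*d)*2^|-(d:ℝ)/2|) * (2^|1-θ*α+ε/2|)) * t^(1-θ*α-d/2+ε/2) := by
        rw [show 1-θ*α-(d:ℝ)/2+ε/2 = -(d:ℝ)/2 + (1-θ*α+ε/2) by ring, Real.rpow_add ht0 (-(d:ℝ)/2) (1-θ*α+ε/2)]; ring
    _ ≤ _ := hC

/-- Many high layers close to the origin. -/
lemma many (hd : 3 ≤ d) (hα : 0 < α) (hz : IsScenery d α μ z) {c : ℝ} (hc : 0 < c) {θ : ℝ} (hθ : 0 < θ) (hθα : θ*α < d/2) {ε : ℝ} (hε : 0 < ε) :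
    ∀ᵐ ζ ∂μ, ∀ᶠ t : ℝ in atTop, ∃ F : Finset (Fin d → ℤ), (∀ x ∈ F, (∀ k, |(x k:ℝ)| ≤ c * √t) ∧ t^θ < z x ζ) ∧
      t^((d:ℝ)/2-θ*α-ε) ≤ F.card := by
  classical
  have := hz.prob
  set e0 := min ε ((d:ℝ)/2-θ*α) with he0
  have he : 0 < e0 := lt_min hε (by linarith)
  set B : ℕ → Finset (Fin d → ℤ) := fun i => Fintype.piFinset fun _ => Finset.Icc (-(⌊c*√((2:ℝ)^i)⌋₊:ℤ)) (⌊c*√((2:ℝ)^i)⌋₊:ℤ) with hB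
  set p : ℕ → ℝ := fun i => pz μ z ((2*(2:ℝ)^i)^θ) with hp
  have hBm : ∀ i, ∀ x ∈ B i, ∀ k, |(x k:ℝ)| ≤ c*√((2:ℝ)^i) := by
    intro i x hx k
    rw [hB, Fintype.mem_piFinset] at hx
    have h1 := Finset.mem_Icc.mp (hx k)
    have h2 : |x k| ≤ (⌊c*√((2:ℝ)^i)⌋₊:ℤ) := abs_le.mpr h1
    have h3 : ((|x k|:ℤ):ℝ) ≤ ((⌊c*√((2:ℝ)^i)⌋₊:ℤ):ℝ) := Int.cast_le.mpr h2
    rw [Int.cast_abs, Int.cast_natCast] at h3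
    exact h3.trans (Nat.floor_le (by positivity))
  have hBc : ∀ i, c^d * ((2:ℝ)^i)^((d:ℝ)/2) ≤ (B i).card := by
    intro i
    have e1 : (B i).card = (2*⌊c*√((2:ℝ)^i)⌋₊+1)^d := by
      rw [hB, Fintype.card_piFinset]
      simp only [Int.card_Icc, Finset.prod_const, Finset.card_univ, Fintype.card_fin]
      congr 1
      omega
    rw [e1]
    push_cast
    have e2 : ((2:ℝ)^i)^((d:ℝ)/2) = (√((2:ℝ)^i))^d := by
      rw [← Real.rpow_natCast (√((2:ℝ)^i)) d, Real.sqrt_eq_rpow, ← Real.rpow_mul (by positivity)]; congr 1; ring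
    rw [e2, ← mul_pow]
    apply pow_le_pow_left₀ (by positivity)
    have := Nat.lt_floor_add_one (c*√((2:ℝ)^i))
    have h4 : (0:ℝ) ≤ (⌊c*√((2:ℝ)^i)⌋₊:ℝ) := by positivity
    linarith
  have hprod : ∀ᶠ i : ℕ in atTop, ((2:ℝ)^i)^((d:ℝ)/2-θ*α-e0/2) ≤ (B i).card * p i / 4 := by
    have hlim : Tendsto (fun i : ℕ => (2*(2:ℝ)^i)^θ) atTop atTop :=
      (tendsto_rpow_atTop hθ).comp (two_pow_tendsto.const_mul_atTop (by norm_num))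
    filter_upwards [hlim.eventually (pz_bounds hα hz (show 0 < e0/4/θ by positivity)),
        two_pow_tendsto.eventually (rpow_ev (4 * (c^d)⁻¹ * 2^|-θ*α-e0/4|) (show (d:ℝ)/2-θ*α-e0/2 < (d:ℝ)/2-θ*α-e0/4 by linarith))] with i h1 h2
    have hBi := hBc i
    have h1 := h1.1
    change _ ≤ p i at h1
    set T := (2:ℝ)^i with hTd
    have hT0 : 0 < T := by positivity
    rw [← Real.rpow_mul (by positivity), show θ*(-α-e0/4/θ) = -θ*α-e0/4 by field_simp] at h1
    have a1 := rpow_cmp (n := T) (t := 2*T) (-θ*α-e0/4) (by positivity) (by linarith) (by linarith)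
    have a2 : T^(-θ*α-e0/4) ≤ 2^|-θ*α-e0/4| * p i := a1.trans (by gcongr)
    have a3 : T^((d:ℝ)/2-θ*α-e0/4) = T^((d:ℝ)/2) * T^(-θ*α-e0/4) := by rw [← Real.rpow_add hT0]; congr 1; ring
    have hp0 : 0 ≤ p i := ENNReal.toReal_nonneg
    have hcd : 0 < c^d := by positivity
    have h2p : (0:ℝ) < 2^|-θ*α-e0/4| := by positivity
    rw [a3] at h2
    have a4 : 4 * (c^d)⁻¹ * 2^|-θ*α-e0/4| * T^((d:ℝ)/2-θ*α-e0/2) ≤ (c^d)⁻¹ * (B i).card * (2^|-θ*α-e0/4| * p i) := by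
      refine h2.trans ?_
      apply mul_le_mul _ a2 (by positivity) (by positivity)
      rw [inv_mul_eq_div, le_div_iff₀ hcd]; linarith
    have a5 : 0 < (c^d)⁻¹ * 2^|-θ*α-e0/4| := by positivity
    have a6 : ((c^d)⁻¹ * 2^|-θ*α-e0/4|) * (4 * T^((d:ℝ)/2-θ*α-e0/2)) ≤ ((c^d)⁻¹ * 2^|-θ*α-e0/4|) * ((B i).card * p i) := by linarith
    have := le_of_mul_le_mul_left a6 a5
    linarith
  have hφm : ∀ i : ℕ, Measurable fun y : ℝ => -((Ioi ((2*(2:ℝ)^i)^θ)).indicator (fun _ => (1:ℝ)) y) := fun i =>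
    (measurable_const.indicator measurableSet_Ioi).neg
  have hsum : ∀ i ζ, ∑ x ∈ B i, 1 * -((Ioi ((2*(2:ℝ)^i)^θ)).indicator (fun _ => (1:ℝ)) (z x ζ)) =
      -(((B i).filter fun x => (2*(2:ℝ)^i)^θ < z x ζ).card : ℝ) := by
    intro i ζ
    simp only [one_mul, Finset.sum_neg_distrib, indicator_apply, mem_Ioi]
    rw [Finset.sum_ite, Finset.sum_const_zero, add_zero, Finset.sum_const, nsmul_eq_mul, mul_one]
  have hbad := bc (μ := μ) (f := fun i ζ => ind (-((B i).card * p i / 4) ≤ ∑ x ∈ B i, 1 * -((Ioi ((2*(2:ℝ)^i)^θ)).indicator (fun _ => (1:ℝ)) (z x ζ))))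
    (g := fun i => ((2:ℝ)^i)^(-(1:ℝ))) (b := fun i => 1/2)
    (fun i => measurable_ind (measurableSet_le measurable_const (Finset.measurable_sum _ fun x _ => ((hφm i).comp (hz.meas x)).const_mul _)))
    (by
      filter_upwards [hprod, two_pow_tendsto.eventually (exp_small (show 0 < (d:ℝ)/2-θ*α-e0/2 by linarith [min_le_right ε ((d:ℝ)/2-θ*α)]) one_pos 2), two_pow_tendsto.eventually (rpow_ev 2 (show (-2:ℝ) < -1 by norm_num))] with i h1 h2 h3
      have hset : MeasurableSet {ζ | -((B i).card * p i / 4) ≤ ∑ x ∈ B i, 1 * -((Ioi ((2*(2:ℝ)^i)^θ)).indicator (fun _ => (1:ℝ)) (z x ζ))} :=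
        measurableSet_le measurable_const (Finset.measurable_sum _ fun x _ => ((hφm i).comp (hz.meas x)).const_mul _)
      rw [lintegral_ind μ hset]
      have hm := laplace_low (μ := μ) (X := fun ζ => (1:ℝ) * -((Ioi ((2*(2:ℝ)^i)^θ)).indicator (fun _ => (1:ℝ)) (z 0 ζ))) (E := {ζ | (2*(2:ℝ)^i)^θ < z 0 ζ})
        (fun ζ => by
          rw [one_mul, Left.neg_nonpos_iff]; exact indicator_nonneg (fun _ _ => zero_le_one) _)
        (measurableSet_lt measurable_const (hz.meas 0))
        (fun ζ hζ => by
          rw [one_mul, indicator_of_mem (show z 0 ζ ∈ Ioi ((2*(2:ℝ)^i)^θ) from hζ)])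
      have hch := chernoff hz (hφm i) (B i) one_pos (l := fun _ => 1) (fun _ _ => zero_le_one) (fun _ _ => le_rfl) (a := -((B i).card * p i / 4)) hm
      refine hch.trans (ENNReal.ofReal_le_ofReal ?_)
      simp only [Finset.sum_const, nsmul_eq_mul, mul_one]
      change Real.exp (-(p i/2) * _ / 1 - _) ≤ _
      have : -(p i/2) * ((B i).card:ℝ) / 1 - -((B i).card * p i / 4) ≤ -(1 * ((2:ℝ)^i)^((d:ℝ)/2-θ*α-e0/2)) := by linarith
      have := (Real.exp_le_exp.mpr this).trans h2
      linarith)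
    (two_pow_summable one_pos) (fun i => by positivity) (Eventually.of_forall fun i => by norm_num)
  filter_upwards [hbad] with ζ h
  have hev := two_pow_tendsto.eventually (rpow_ev (2^|(d:ℝ)/2-θ*α-ε|) (show (d:ℝ)/2-θ*α-ε < (d:ℝ)/2-θ*α-e0/2 by linarith [min_le_left ε ((d:ℝ)/2-θ*α)]))
  filter_upwards [dyadic ((h.and hprod).and hev), eventually_ge_atTop 1] with t ⟨i, ⟨⟨h, hpr⟩, h3⟩, hi1, hi2⟩ ht
  refine ⟨(B i).filter fun x => (2*(2:ℝ)^i)^θ < z x ζ, ?_, ?_⟩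
  · intro x hx
    rw [Finset.mem_filter] at hx
    refine ⟨fun k => (hBm i x hx.1 k).trans (by gcongr), lt_of_le_of_lt (Real.rpow_le_rpow (by linarith) hi2.le hθ.le) hx.2⟩
  · rw [hsum] at h
    have h4 : ¬ (-((B i).card * p i / 4) ≤ -(((B i).filter fun x => (2*(2:ℝ)^i)^θ < z x ζ).card : ℝ)) := by
      intro hh
      rw [ind_true hh, ENNReal.one_le_ofReal] at h
      norm_num at h
    have h5 := rpow_cmp (n := t) (t := (2:ℝ)^i) ((d:ℝ)/2-θ*α-ε) (by positivity) (by linarith) (by linarith)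
    linarith

/-- lower bound on the mean time spent in the high layers -/
lemma Wk.high_low (hd : 3 ≤ d) (hα : 0 < α) (W : Wk d P Y) (hz : IsScenery d α μ z) {θ : ℝ} (hθ : 0 < θ) (hθα : θ*α < d/2) {ε : ℝ} (hε : 0 < ε) :
    ∀ᵐ ζ ∂μ, ∀ᶠ t : ℝ in atTop, ENNReal.ofReal (t^(1-θ*α-d/2-ε)) ≤
      ∫⁻ ω, ind (Y t ω = 0) * Acl (fun v => ind (t^θ < z v ζ)) Y t ω ∂P := by
  have := W.prob
  have hd0 : 0 < d := by omega
  obtain ⟨c, hc, hc1, hnear⟩ := heat_ge_near d hd0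
  filter_upwards [many hd hα hz (half_pos hc) hθ hθα (half_pos hε)] with ζ h
  filter_upwards [h, eventually_ge_atTop 3, rpow_ev (3*(c*c)⁻¹) (show 1-θ*α-d/2-ε < 1-θ*α-(d:ℝ)/2-ε/2 by linarith)] with t ⟨F, hF, hcard⟩ ht hC
  have ht0 : 0 < t := by linarith
  have hgm : Measurable fun v : Fin d → ℤ => ind (t^θ < z v ζ) := measurable_of_countable _
  have hYt : Measurable fun ω => ind (Y t ω = 0) := measurable_ind (sing_meas (W.meas t) 0)
  have hj : Measurable fun p : Ω × ℝ => ind (Y t p.1 = 0) * ind (t^θ < z (Y p.2 p.1) ζ) :=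
    (hYt.comp measurable_fst).mul (hgm.comp (W.jm.comp measurable_swap))
  have e1 : ∫⁻ ω, ind (Y t ω = 0) * Acl (fun v => ind (t^θ < z v ζ)) Y t ω ∂P =
      ∫⁻ u in Ioc 0 t, ∫⁻ ω, ind (Y t ω = 0) * ind (t^θ < z (Y u ω) ζ) ∂P := by
    rw [← lintegral_lintegral_swap hj.aemeasurable]
    apply lintegral_congr
    intro ω
    unfold Acl
    have hm1 : Measurable fun u => ind (t^θ < z (Y u ω) ζ) := hgm.comp (W.jm.comp (measurable_id.prodMk measurable_const))
    rw [lintegral_const_mul _ hm1]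
  rw [e1]
  have hin : ∀ u ∈ Ioc (t/3) (2*t/3), ENNReal.ofReal (F.card * (c * c * t^(-(d:ℝ)))) ≤ ∫⁻ ω, ind (Y t ω = 0) * ind (t^θ < z (Y u ω) ζ) ∂P := by
    intro u hu
    have hu0 : 0 < u := by linarith [hu.1]
    have mm : ∀ x, MeasurableSet {ω | Y u ω = x ∧ Y t ω = 0} := fun x => (sing_meas (W.meas u) x).inter (sing_meas (W.meas t) 0)
    calc ENNReal.ofReal (F.card * (c * c * t^(-(d:ℝ)))) = ∑ x ∈ F, ENNReal.ofReal (c * c * t^(-(d:ℝ))) := by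
          rw [Finset.sum_const, nsmul_eq_mul, ENNReal.ofReal_mul (by positivity), ENNReal.ofReal_natCast]
      _ ≤ ∑ x ∈ F, P {ω | Y u ω = x ∧ Y t ω = 0} := by
          apply Finset.sum_le_sum
          intro x hx
          rw [W.two hu0.le (by linarith [hu.2]), ← ENNReal.ofReal_mul (heat_nonneg d hu0.le _ _)]
          apply ENNReal.ofReal_le_ofReal
          have hs : ∀ s, t/3 ≤ s → c/2*√t ≤ c*√s := by
            intro s hs
            have : √t ≤ 2*√s := by
              rw [Real.sqrt_le_left (by positivity), mul_pow, Real.sq_sqrt (by linarith)]; linarith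
            nlinarith
          have hpw : ∀ s, t/3 ≤ s → s ≤ t → c*t^(-(d:ℝ)/2) ≤ c*s^(-(d:ℝ)/2) := by
            intro s h1 h2
            apply mul_le_mul_of_nonneg_left _ hc.le
            apply Real.rpow_le_rpow_of_nonpos (by linarith) h2
            have : (0:ℝ) ≤ d := by positivity
            linarith
          have b1 := (hpw u hu.1.le (by linarith [hu.2])).trans (hnear u (by linarith [hu.1]) 0 x (fun k => by
            simpa using ((hF x hx).1 k).trans (hs u hu.1.le)))
          have b2 := (hpw (t-u) (by linarith [hu.2]) (by linarith)).trans (hnear (t-u) (by linarith [hu.2]) x 0 (fun k => by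
            simpa using ((hF x hx).1 k).trans (hs (t-u) (by linarith [hu.2]))))
          calc c*c*t^(-(d:ℝ)) = (c*t^(-(d:ℝ)/2)) * (c*t^(-(d:ℝ)/2)) := by
                rw [show -(d:ℝ) = -(d:ℝ)/2 + -(d:ℝ)/2 by ring, Real.rpow_add ht0]; ring_nf
            _ ≤ _ := mul_le_mul b1 b2 (by positivity) (heat_nonneg d hu0.le _ _)
      _ = ∫⁻ ω, ∑ x ∈ F, ind (Y u ω = x ∧ Y t ω = 0) ∂P := by
          rw [lintegral_finsetSum _ fun x _ => measurable_ind (mm x)]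
          exact Finset.sum_congr rfl fun x _ => (lintegral_ind P (mm x)).symm
      _ ≤ _ := by
          apply lintegral_mono
          intro ω
          dsimp only
          simp only [ind_and]
          rw [← Finset.sum_mul, mul_comm]
          refine mul_le_mul_right ?_ _
          by_cases hx : Y u ω ∈ F
          · rw [ind_true (hF _ hx).2, Finset.sum_eq_single (Y u ω)]
            · exact ind_le_one _
            · intro x _ hne; exact ind_false (Ne.symm hne)
            · intro hh; exact absurd hx hh
          · rw [Finset.sum_eq_zero]
            · exact zero_le
            · intro x hxF; apply ind_false; rintro rfl; exact hx hxF
  calc ENNReal.ofReal (t^(1-θ*α-d/2-ε)) ≤ ENNReal.ofReal (F.card * (c * c * t^(-(d:ℝ)))) * ENNReal.ofReal (t/3) := by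
        rw [← ENNReal.ofReal_mul (by positivity)]
        apply ENNReal.ofReal_le_ofReal
        have a0 : 0 < c*c := by positivity
        have a1 : t^(1-θ*α-(d:ℝ)/2-ε/2) = t^((d:ℝ)/2-θ*α-ε/2) * t^(-(d:ℝ)) * t := by
          rw [← Real.rpow_add ht0, ← Real.rpow_add_one ht0.ne']; congr 1; ring
        have a2 : 3*(c*c)⁻¹ * t^(1-θ*α-(d:ℝ)/2-ε) ≤ F.card * t^(-(d:ℝ)) * t := by
          refine hC.trans ?_
          rw [a1]; gcongr
        have a3 : t^(1-θ*α-(d:ℝ)/2-ε) = (c*c/3) * (3*(c*c)⁻¹ * t^(1-θ*α-(d:ℝ)/2-ε)) := by field_simp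
        rw [a3]
        calc _ ≤ (c*c/3) * (F.card * t^(-(d:ℝ)) * t) := by gcongr
          _ = _ := by ring
    _ = ∫⁻ u in Ioc (t/3) (2*t/3), ENNReal.ofReal (F.card * (c * c * t^(-(d:ℝ)))) := by
        rw [setLIntegral_const, Real.volume_Ioc]; congr 2; ring
    _ ≤ ∫⁻ u in Ioc (t/3) (2*t/3), ∫⁻ ω, ind (Y t ω = 0) * ind (t^θ < z (Y u ω) ζ) ∂P := setLIntegral_mono' measurableSet_Ioc hin
    _ ≤ _ := lintegral_mono_set (Ioc_subset_Ioc (by linarith) (by linarith))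

end
end LRC

set_option linter.all false

namespace LRC
open scoped NNReal

section
variable {Ω : Type*} [MeasurableSpace Ω]
variable {d : ℕ} {P : Measure Ω} {Y : ℝ → Ω → (Fin d → ℤ)}
variable {Ωz : Type*} [MeasurableSpace Ωz] {μ : Measure Ωz} {z : (Fin d → ℤ) → Ωz → ℝ} {α : ℝ}

/-- the clock -/
noncomputable def Az (z : (Fin d → ℤ) → Ωz → ℝ) (Y : ℝ → Ω → (Fin d → ℤ)) (ζ : Ωz) (t : ℝ) (ω : Ω) : ENNReal :=
  Acl (fun v => ENNReal.ofReal (z v ζ)) Y t ω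

lemma Wk.up (hd : 3 ≤ d) (hα : 0 < α) (W : Wk d P Y) (hz : IsScenery d α μ z) {θ : ℝ} (hθ : max (1/α) 1 < θ) {ε : ℝ} (hε : 0 < ε) :
    ∀ᵐ ζ ∂μ, ∀ᶠ t : ℝ in atTop, P {ω | ENNReal.ofReal (t^θ) ≤ Az z Y ζ t ω ∧ Y t ω = 0} ≤ ENNReal.ofReal (t^(1-θ*α-d/2+ε)) := by
  set s := min ((θ - max (1/α) 1)/2) (ε/(4*α)) with hs
  have hs0 : 0 < s := lt_min (by linarith) (by positivity)
  have hs1 : s ≤ (θ - max (1/α) 1)/2 := min_le_left _ _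
  have hs2 : s * α ≤ ε/4 := by
    have : s ≤ ε/(4*α) := min_le_right _ _
    rw [le_div_iff₀ (by positivity)] at this
    linarith
  have h1m : 1 ≤ max (1/α) 1 := le_max_right _ _
  filter_upwards [W.up_trunc hd hα hz (θ := θ - s) (by linarith) hs0 (θ*α+d/2), W.visit hd hα hz (θ := θ-s) (by linarith) (half_pos hε)] with ζ h1 h2
  filter_upwards [h1, h2, eventually_ge_atTop 1, rpow_ev 2 (show 1-θ*α-(d:ℝ)/2+3*ε/4 < 1-θ*α-d/2+ε by linarith)] with t h1 h2 ht h3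
  have ht0 : 0 < t := by linarith
  have a1 : t^(-(θ*α+d/2)) ≤ t^(1-θ*α-(d:ℝ)/2+3*ε/4) := Real.rpow_le_rpow_of_exponent_le ht (by linarith)
  have a2 : t^(1-(θ-s)*α-(d:ℝ)/2+ε/2) ≤ t^(1-θ*α-(d:ℝ)/2+3*ε/4) := Real.rpow_le_rpow_of_exponent_le ht (by linarith)
  refine (measure_mono ?_).trans ((measure_union_le _ _).trans ((add_le_add h2 h1).trans ?_))
  · rintro ω ⟨hA, hY⟩
    by_cases hv : ∃ u ∈ Icc 0 t, t^(θ-s) < z (Y u ω) ζ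
    · exact Or.inl ⟨hv, hY⟩
    · right
      push Not at hv
      simp only [mem_setOf_eq]
      rw [sub_add_cancel]
      refine hA.trans (le_of_eq ?_)
      unfold Az Acl
      apply setLIntegral_congr_fun measurableSet_Ioc
      intro u hu
      have hm : z (Y u ω) ζ ∈ Iic ((⌈t⌉₊:ℝ)^(θ-s)) :=
        (hv u ⟨hu.1.le, hu.2⟩).trans (Real.rpow_le_rpow ht0.le (Nat.le_ceil t) (by linarith))
      dsimp only
      rw [indicator_of_mem hm, max_eq_left (hz.nonneg _ _)]
  · rw [← ENNReal.ofReal_add (by positivity) (by positivity)]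
    apply ENNReal.ofReal_le_ofReal
    linarith

lemma Wk.lo (hd : 3 ≤ d) (hα : 0 < α) (W : Wk d P Y) (hz : IsScenery d α μ z) {σ : ℝ} (hσ : max (1/α) 1 < σ) (hσα : σ*α < d/2) {ε : ℝ} (hε : 0 < ε) :
    ∀ᵐ ζ ∂μ, ∀ᶠ t : ℝ in atTop, ENNReal.ofReal (t^(1-σ*α-d/2-ε)) ≤ P {ω | ENNReal.ofReal (t^σ) ≤ Az z Y ζ t ω ∧ Y t ω = 0} := by
  have := W.prob
  set e := min (((d:ℝ)/2-σ*α)/(2*α)) (ε/(α+1)) with he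
  have he0 : 0 < e := lt_min (div_pos (by linarith) (by positivity)) (by positivity)
  have he1 : e * α ≤ ((d:ℝ)/2-σ*α)/2 := by
    have : e ≤ ((d:ℝ)/2-σ*α)/(2*α) := min_le_left _ _
    rw [le_div_iff₀ (by positivity)] at this
    linarith
  have he2 : e * α + e ≤ ε := by
    have : e ≤ ε/(α+1) := min_le_right _ _
    rw [le_div_iff₀ (by positivity)] at this
    linarith
  have h1m : 1 ≤ max (1/α) 1 := le_max_right _ _
  have h2m : 1/α ≤ max (1/α) 1 := le_max_left _ _
  set X := 1-(σ+e)*α-(d:ℝ)/2 with hX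
  filter_upwards [W.high_low hd hα hz (θ := σ+e) (by linarith) (by linarith) (show 0 < e/8 by positivity),
    W.visit hd hα hz (θ := σ+e) (by linarith) (show 0 < e/8 by positivity),
    W.up_high hd hα hz (θ := σ+e) (by linarith) (show 0 < e/8 by positivity) (1-(X-3*e/8))] with ζ h1 h2 h3
  filter_upwards [h1, h2, h3, eventually_ge_atTop 1, rpow_ev 4 (show X-3*e/8 < X-e/8 by linarith), rpow_ev 2 (show X-e/2 < X-e/4 by linarith)] with t h1 h2 h3 ht r1 r2
  have ht0 : 0 < t := by linarith
  set V := {ω | (∃ u ∈ Icc 0 t, t^(σ+e) < z (Y u ω) ζ) ∧ Y t ω = 0} with hV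
  set τ := fun ω => Acl (fun v => ind (t^(σ+e) < z v ζ)) Y t ω with hτ
  set G := {ω | ENNReal.ofReal (t^σ) ≤ Az z Y ζ t ω ∧ Y t ω = 0} with hG
  set H := {ω | ENNReal.ofReal (t^(e/8)) ≤ τ ω} with hH
  have hGm : MeasurableSet G := (measurableSet_le measurable_const (Acl_meas _ W.jm t)).inter (sing_meas (W.meas t) 0)
  have hHm : MeasurableSet H := measurableSet_le measurable_const (Acl_meas _ W.jm t)
  have hτt : ∀ ω, τ ω ≤ ENNReal.ofReal t := by
    intro ω
    calc τ ω ≤ ∫⁻ u in Ioc (0:ℝ) t, 1 := lintegral_mono fun u => ind_le_one _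
      _ = _ := by simp
  have hτA : ∀ ω, ENNReal.ofReal (t^(σ+e)) * τ ω ≤ Az z Y ζ t ω := by
    intro ω
    have hgm : Measurable fun v : Fin d → ℤ => ind (t^(σ+e) < z v ζ) := measurable_of_countable _
    have hm1 : Measurable fun u => ind (t^(σ+e) < z (Y u ω) ζ) := hgm.comp (W.jm.comp (measurable_id.prodMk measurable_const))
    simp only [hτ]
    unfold Az Acl
    rw [← lintegral_const_mul _ hm1]
    apply lintegral_mono
    intro u
    dsimp only
    by_cases hh : t^(σ+e) < z (Y u ω) ζ
    · rw [ind_true hh, mul_one]; exact ENNReal.ofReal_le_ofReal hh.le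
    · rw [ind_false hh, mul_zero]; exact zero_le
  have hpt : ∀ ω, ind (Y t ω = 0) * τ ω ≤ ENNReal.ofReal (t^(-(e/2))) * ind (ω ∈ toMeasurable P V) + (ENNReal.ofReal (t^(e/8)) * ind (ω ∈ G) + ENNReal.ofReal t * ind (ω ∈ H)) := by
    intro ω
    by_cases hY : Y t ω = 0
    swap
    · rw [ind_false hY, zero_mul]; exact zero_le
    rw [ind_true hY, one_mul]
    by_cases hh : ω ∈ H
    · rw [ind_true hh, mul_one]
      exact (hτt ω).trans (le_add_left (le_add_left le_rfl))
    by_cases hg : ω ∈ G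
    · rw [ind_true hg, mul_one]
      have : τ ω ≤ ENNReal.ofReal (t^(e/8)) := le_of_lt (not_le.mp hh)
      exact this.trans (le_add_left (le_add_right le_rfl))
    have hA : Az z Y ζ t ω < ENNReal.ofReal (t^σ) := by
      by_contra hc; exact hg ⟨not_lt.mp hc, hY⟩
    by_cases hv : ω ∈ V
    · rw [ind_true (subset_toMeasurable P V hv), mul_one]
      refine le_trans ?_ (le_add_right le_rfl)
      have h5 := (hτA ω).trans hA.le
      have h6 : τ ω = ENNReal.ofReal (t^(-(σ+e))) * (ENNReal.ofReal (t^(σ+e)) * τ ω) := by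
        rw [← mul_assoc, ← ENNReal.ofReal_mul (by positivity), ← Real.rpow_add ht0]; simp
      rw [h6]
      refine (mul_le_mul_right h5 _).trans ?_
      rw [← ENNReal.ofReal_mul (by positivity), ← Real.rpow_add ht0]
      exact ENNReal.ofReal_le_ofReal (Real.rpow_le_rpow_of_exponent_le ht (by linarith))
    · have : τ ω = 0 := by
        simp only [hτ]
        unfold Acl
        rw [setLIntegral_congr_fun (g := fun _ => 0) measurableSet_Ioc, lintegral_zero]
        intro u hu
        exact ind_false fun hh => hv ⟨⟨u, ⟨hu.1.le, hu.2⟩, hh⟩, hY⟩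
      rw [this]; exact zero_le
  have hi := h1.trans (lintegral_mono hpt)
  have mV : Measurable fun ω => ind (ω ∈ toMeasurable P V) := measurable_ind (measurableSet_toMeasurable P V)
  have mG : Measurable fun ω => ind (ω ∈ G) := measurable_ind hGm
  have mH : Measurable fun ω => ind (ω ∈ H) := measurable_ind hHm
  have iS : ∀ S : Set Ω, MeasurableSet S → ∫⁻ ω, ind (ω ∈ S) ∂P = P S := fun S hS => lintegral_ind P (p := fun ω => ω ∈ S) hS
  rw [lintegral_add_left (mV.const_mul _), lintegral_add_left (mG.const_mul _), lintegral_const_mul _ mV, lintegral_const_mul _ mG, lintegral_const_mul _ mH,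
    iS _ (measurableSet_toMeasurable P V), iS _ hGm, iS _ hHm, measure_toMeasurable] at hi
  have hi2 := hi.trans (add_le_add (mul_le_mul_right h2 _) (add_le_add le_rfl (mul_le_mul_right h3 _)))
  rw [← ENNReal.ofReal_toReal (measure_ne_top P G)] at hi2 ⊢
  rw [← ENNReal.ofReal_mul (by positivity), ← ENNReal.ofReal_mul (by positivity), ← ENNReal.ofReal_mul (by positivity),
    ← ENNReal.ofReal_add (by positivity) (by positivity), ← ENNReal.ofReal_add (by positivity) (by positivity),
    ENNReal.ofReal_le_ofReal_iff (by positivity)] at hi2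
  apply ENNReal.ofReal_le_ofReal
  have b1 : t^(-(e/2)) * t^(X+e/8) = t^(X-3*e/8) := by rw [← Real.rpow_add ht0]; congr 1; ring
  have b2 : t * t^(-(1-(X-3*e/8))) = t^(X-3*e/8) := by
    rw [mul_comm, ← Real.rpow_add_one ht0.ne']; congr 1; ring
  rw [b1, b2] at hi2
  have b3 : t^(X-e/8) ≤ 2 * (t^(e/8) * (P G).toReal) := by linarith
  have b4 : t^(X-e/4) ≤ 2 * (P G).toReal := by
    have e1 : t^(X-e/4) = t^(-(e/8)) * t^(X-e/8) := by rw [← Real.rpow_add ht0]; congr 1; ring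
    have e2 : t^(-(e/8)) * t^(e/8) = 1 := by rw [← Real.rpow_add ht0]; simp
    rw [e1]
    calc _ ≤ t^(-(e/8)) * (2 * (t^(e/8) * (P G).toReal)) := by gcongr
      _ = (t^(-(e/8)) * t^(e/8)) * (2 * (P G).toReal) := by ring
      _ = _ := by rw [e2, one_mul]
  have b5 : t^(1-σ*α-(d:ℝ)/2-ε) ≤ t^(X-e/2) := Real.rpow_le_rpow_of_exponent_le ht (by rw [hX]; linarith)
  linarith

end
end LRC

set_option linter.all false

namespace LRC
open scoped NNReal

section
variable {Ω : Type*} [MeasurableSpace Ω]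
variable {d : ℕ} {P : Measure Ω} {Y : ℝ → Ω → (Fin d → ℤ)}
variable {Ωz : Type*} [MeasurableSpace Ωz] {μ : Measure Ωz} {z : (Fin d → ℤ) → Ωz → ℝ} {α : ℝ}

/-- the return probability written through the clock -/
noncomputable def pp (P : Measure Ω) (z : (Fin d → ℤ) → Ωz → ℝ) (Y : ℝ → Ω → (Fin d → ℤ)) (ζ : Ωz) (t : ℝ) (k : ℤ) : ENNReal :=
  ∫⁻ ω, ind (Y t ω = 0) * ENNReal.ofReal (h1 (Az z Y ζ t ω).toReal k) ∂P

lemma Az_meas (W : Wk d P Y) (z : (Fin d → ℤ) → Ωz → ℝ) (ζ : Ωz) (t : ℝ) : Measurable (Az z Y ζ t) :=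
  Acl_meas _ W.jm t

lemma Az_ms (W : Wk d P Y) (z : (Fin d → ℤ) → Ωz → ℝ) (ζ : Ωz) (t : ℝ) (c : ENNReal) :
    MeasurableSet {ω | c ≤ Az z Y ζ t ω ∧ Y t ω = 0} := by
  have m1 : MeasurableSet {ω | c ≤ Az z Y ζ t ω} := measurableSet_le measurable_const (Az_meas W z ζ t)
  have m2 : MeasurableSet {ω | Y t ω = 0} := sing_meas (W.meas t) 0
  exact m1.inter m2

lemma upper_gen (hd : 0 < d) (W : Wk d P Y) (z : (Fin d → ℤ) → Ωz → ℝ) (ζ : Ωz) (t : ℝ) (k : ℤ) {s0 B : ℝ} (hs : 0 < s0)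
    (hB : ∀ s, 0 ≤ s → s ≤ s0 → h1 s k ≤ B) :
    pp P z Y ζ t k ≤ ENNReal.ofReal B * P {ω | Az z Y ζ t ω ≤ ENNReal.ofReal s0} +
      ENNReal.ofReal (1/√s0) * P {ω | ENNReal.ofReal s0 ≤ Az z Y ζ t ω ∧ Y t ω = 0} := by
  have m1 : MeasurableSet {ω | Az z Y ζ t ω ≤ ENNReal.ofReal s0} := measurableSet_le (Az_meas W z ζ t) measurable_const
  have m2 := Az_ms W z ζ t (ENNReal.ofReal s0)
  have i1 : Measurable fun ω => ind (Az z Y ζ t ω ≤ ENNReal.ofReal s0) := measurable_ind m1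
  have i2 : Measurable fun ω => ind (ENNReal.ofReal s0 ≤ Az z Y ζ t ω ∧ Y t ω = 0) := measurable_ind m2
  rw [← lintegral_ind P m1, ← lintegral_ind P m2, ← lintegral_const_mul _ i1, ← lintegral_const_mul _ i2,
    ← lintegral_add_left (i1.const_mul _)]
  unfold pp
  apply lintegral_mono_ae
  have hf := W.Acl_lt_top hd (fun v => ENNReal.ofReal (z v ζ)) (fun v => ENNReal.ofReal_ne_top)
  filter_upwards [hf] with ω hω
  have hA : Az z Y ζ t ω ≠ ⊤ := (hω t).ne
  by_cases hY : Y t ω = 0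
  swap
  · rw [ind_false hY, zero_mul]; exact zero_le
  rw [ind_true hY, one_mul]
  by_cases hle : Az z Y ζ t ω ≤ ENNReal.ofReal s0
  · rw [ind_true hle, mul_one]
    refine le_add_right (ENNReal.ofReal_le_ofReal (hB _ ENNReal.toReal_nonneg ?_))
    exact ENNReal.toReal_le_of_le_ofReal hs.le hle
  · have hge := (not_le.mp hle).le
    have hpq : ENNReal.ofReal s0 ≤ Az z Y ζ t ω ∧ Y t ω = 0 := ⟨hge, hY⟩
    rw [ind_true hpq, mul_one]
    refine le_add_left (ENNReal.ofReal_le_ofReal ?_)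
    have hs1 : s0 ≤ (Az z Y ζ t ω).toReal := (ENNReal.ofReal_le_iff_le_toReal hA).mp hge
    refine (h1_le (hs.trans_le hs1) k).trans ?_
    exact one_div_le_one_div_of_le (Real.sqrt_pos.mpr hs) (Real.sqrt_le_sqrt hs1)

lemma lower_gen (hd : 0 < d) (W : Wk d P Y) (z : (Fin d → ℤ) → Ωz → ℝ) (ζ : Ωz) (t : ℝ) (k : ℤ) {s0 s1 b : ℝ} (hs : 0 < s0) (hs1 : 0 < s1)
    (hb : ∀ s, s0 ≤ s → s ≤ s1 → b ≤ h1 s k) :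
    ENNReal.ofReal b * P {ω | ENNReal.ofReal s0 ≤ Az z Y ζ t ω ∧ Y t ω = 0} ≤ 
      pp P z Y ζ t k + ENNReal.ofReal b * P {ω | ENNReal.ofReal s1 ≤ Az z Y ζ t ω ∧ Y t ω = 0} := by
  have m1 := Az_ms W z ζ t (ENNReal.ofReal s0)
  have m2 := Az_ms W z ζ t (ENNReal.ofReal s1)
  have i1 : Measurable fun ω => ind (ENNReal.ofReal s0 ≤ Az z Y ζ t ω ∧ Y t ω = 0) := measurable_ind m1
  have i2 : Measurable fun ω => ind (ENNReal.ofReal s1 ≤ Az z Y ζ t ω ∧ Y t ω = 0) := measurable_ind m2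
  unfold pp
  rw [← lintegral_ind P m1, ← lintegral_ind P m2, ← lintegral_const_mul _ i1, ← lintegral_const_mul _ i2,
    ← lintegral_add_right _ (i2.const_mul _)]
  apply lintegral_mono_ae
  have hf := W.Acl_lt_top hd (fun v => ENNReal.ofReal (z v ζ)) (fun v => ENNReal.ofReal_ne_top)
  filter_upwards [hf] with ω hω
  have hA : Az z Y ζ t ω ≠ ⊤ := (hω t).ne
  by_cases hp : ENNReal.ofReal s0 ≤ Az z Y ζ t ω ∧ Y t ω = 0
  swap
  · rw [ind_false hp, mul_zero]; exact zero_le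
  rw [ind_true hp, mul_one]
  by_cases hq : ENNReal.ofReal s1 ≤ Az z Y ζ t ω ∧ Y t ω = 0
  · rw [ind_true hq, mul_one]; exact le_add_left le_rfl
  · rw [ind_true hp.2, one_mul]
    refine le_add_right (ENNReal.ofReal_le_ofReal (hb _ ?_ ?_))
    · exact (ENNReal.ofReal_le_iff_le_toReal hA).mp hp.1
    · have : Az z Y ζ t ω ≤ ENNReal.ofReal s1 := by
        by_contra hc; exact hq ⟨(not_le.mp hc).le, hp.2⟩
      exact ENNReal.toReal_le_of_le_ofReal hs1.le this

lemma sqrt_rpow {t : ℝ} (ht : 0 < t) (a : ℝ) : √(t^a) = t^(a/2) := by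
  rw [Real.sqrt_eq_rpow, ← Real.rpow_mul ht.le]; congr 1; ring

/-- upper bound, first regime -/
lemma Wk.upper1 (hd : 3 ≤ d) (hα : 0 < α) (W : Wk d P Y) (hz : IsScenery d α μ z) (k : ℝ → ℤ) {ε : ℝ} (hε : 0 < ε) :
    ∀ᵐ ζ ∂μ, ∀ᶠ t : ℝ in atTop, pp P z Y ζ t (k t) ≤ ENNReal.ofReal (t^(-(max (1/α) 1/2 + d/2) + ε)) := by
  set γ := max (1/α) 1 with hγ
  filter_upwards [W.low_pow hd hα hz (γ := γ - ε) (by linarith) (γ/2 + d/2)] with ζ h1'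
  filter_upwards [h1', eventually_ge_atTop 1, rpow_ev 2 (show -(γ/2+(d:ℝ)/2)+ε/2 < -(γ/2+(d:ℝ)/2)+ε by linarith)] with t h1' ht h3
  have ht0 : 0 < t := by linarith
  refine (upper_gen (by omega) W z ζ t (k t) (s0 := t^(γ-ε)) (B := 1) (by positivity) (fun s hs _ => h1_le_one hs _)).trans ?_
  have e1 : P {ω | ENNReal.ofReal (t^(γ-ε)) ≤ Az z Y ζ t ω ∧ Y t ω = 0} ≤ ENNReal.ofReal (t^(-(d:ℝ)/2)) := by
    refine (measure_mono (fun ω h => h.2 : _ ⊆ {ω | Y t ω = 0})).trans ?_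
    rw [W.marg ht0.le]
    exact ENNReal.ofReal_le_ofReal (heat_le d (by omega) ht0 _ _)
  refine (add_le_add (mul_le_mul_right h1' _) (mul_le_mul_right e1 _)).trans ?_
  rw [ENNReal.ofReal_one, one_mul, ← ENNReal.ofReal_mul (by positivity), ← ENNReal.ofReal_add (by positivity) (by positivity)]
  apply ENNReal.ofReal_le_ofReal
  rw [sqrt_rpow ht0, one_div, ← Real.rpow_neg ht0.le, ← Real.rpow_add ht0]
  have a1 : t^(-(γ/2+(d:ℝ)/2)) ≤ t^(-(γ/2+(d:ℝ)/2)+ε/2) := Real.rpow_le_rpow_of_exponent_le ht (by linarith)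
  have a2 : t^(-((γ-ε)/2) + -(d:ℝ)/2) ≤ t^(-(γ/2+(d:ℝ)/2)+ε/2) := Real.rpow_le_rpow_of_exponent_le ht (by linarith)
  linarith

/-- upper bound, second regime -/
lemma Wk.upper2 (hd : 3 ≤ d) (hα : 0 < α) (W : Wk d P Y) (hz : IsScenery d α μ z) {δ : ℝ} (hδ : max (1/α) 1/2 < δ) {ε : ℝ} (hε : 0 < ε) :
    ∀ᵐ ζ ∂μ, ∀ᶠ t : ℝ in atTop, pp P z Y ζ t ⌊t^δ⌋ ≤ ENNReal.ofReal (t^(-(δ*(1+2*α)-1+d/2) + ε)) := by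
  set γ := max (1/α) 1 with hγ
  have hγ1 : 1 ≤ γ := le_max_right _ _
  set e := min (δ - γ/2) (ε/(2*(2+α))) with he
  have he0 : 0 < e := lt_min (by linarith) (by positivity)
  have he1 : e ≤ δ - γ/2 := min_le_left _ _
  have he2 : e*(2+α) ≤ ε/2 := by
    have : e ≤ ε/(2*(2+α)) := min_le_right _ _
    rw [le_div_iff₀ (by positivity)] at this
    linarith
  have he3 : 0 < e * α := by positivity
  set r := δ*(1+2*α)-1+(d:ℝ)/2 with hr
  filter_upwards [W.up hd hα hz (θ := 2*δ-e) (by linarith) he0] with ζ h1'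
  filter_upwards [h1', eventually_ge_atTop 1, rpow_ev (Real.exp 2) (show -(r+1) < -r by linarith), rpow_ev 2 (show -r+ε/2 < -r+ε by linarith),
    exp_small (half_pos he0) (show (0:ℝ) < 1/2 by norm_num) (r+1), rpow_ev 2 (show (0:ℝ) < δ by linarith)] with t h1' ht h2 h3 h4 h5
  have ht0 : 0 < t := by linarith
  rw [Real.rpow_zero] at h5
  have hk : t^δ/2 ≤ (⌊t^δ⌋ : ℝ) := by have := Int.sub_one_lt_floor (t^δ); linarith
  have hR : t^(δ-e/2) * t^(e/2) = t^δ := by rw [← Real.rpow_add ht0]; congr 1; ring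
  have hR0 : 0 < t^(δ-e/2) := by positivity
  have hR1 : 1 ≤ t^(δ-e/2) := Real.one_le_rpow ht (by linarith)
  have hsq : t^(2*δ-e) = (t^(δ-e/2))^2 := by
    rw [← Real.rpow_natCast, ← Real.rpow_mul ht0.le]; congr 1; push_cast; ring
  refine (upper_gen (by omega) W z ζ t ⌊t^δ⌋ (s0 := t^(2*δ-e)) (B := t^(-r)) (by positivity) (fun s hs hs' => ?_)).trans ?_
  · refine (h1_tail hs hR1 (hs'.trans hsq.le) _).trans ?_
    refine le_trans ?_ h2
    refine mul_le_mul_of_nonneg_left (le_trans ?_ h4) (Real.exp_pos _).le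
    rw [Real.exp_le_exp, neg_le_neg_iff, le_div_iff₀ hR0]
    nlinarith
  have hPr := W.prob
  refine (add_le_add (mul_le_mul_right prob_le_one _) (mul_le_mul_right h1' _)).trans ?_
  rw [mul_one, ← ENNReal.ofReal_mul (by positivity), ← ENNReal.ofReal_add (by positivity) (by positivity)]
  apply ENNReal.ofReal_le_ofReal
  rw [sqrt_rpow ht0, one_div, ← Real.rpow_neg ht0.le, ← Real.rpow_add ht0]
  have a1 : t^(-r) ≤ t^(-r+ε/2) := Real.rpow_le_rpow_of_exponent_le ht (by linarith)
  have a2 : t^(-((2*δ-e)/2) + (1-(2*δ-e)*α-(d:ℝ)/2+e)) ≤ t^(-r+ε/2) := by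
    apply Real.rpow_le_rpow_of_exponent_le ht
    rw [hr]; nlinarith
  linarith

/-- lower bound, diffusive case -/
lemma Wk.lower1 (hd : 3 ≤ d) (hα : 1 ≤ α) (W : Wk d P Y) (hz : IsScenery d α μ z) {δ : ℝ} (hδ0 : 0 ≤ δ) (hδ : δ ≤ 1/2) 
    (hfar : ∀ C : ℝ, 0 < C → ∃ c > 0, ∃ s0 > (0:ℝ), ∀ s ≥ s0, ∀ k : ℤ, |(k:ℝ)| ≤ C * √s → c / √s ≤ h1 s k) {ε : ℝ} (hε : 0 < ε) :
    ∀ᵐ ζ ∂μ, ∀ᶠ t : ℝ in atTop, ENNReal.ofReal (t^(-(1/2 + d/2:ℝ) - ε)) ≤ pp P z Y ζ t ⌊t^δ⌋ := by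
  have hα0 : 0 < α := by linarith
  have hPr := W.prob
  obtain ⟨c, hc, hlin⟩ := W.low_lin hd hα0 hz
  obtain ⟨c1, hc1, s0, hs0, hf⟩ := hfar (1/√c) (by positivity)
  obtain ⟨c0, hc0, -, hnear⟩ := heat_ge_near d (by omega)
  have hmx : max (1/α) 1 < 1 + ε := by
    apply max_lt
    · have : 1/α ≤ 1 := by rw [div_le_one hα0]; exact hα
      linarith
    · linarith
  filter_upwards [hlin (d/2+ε/2), W.up hd hα0 hz hmx (half_pos hε)] with ζ h1' h2'
  filter_upwards [h1', h2', eventually_ge_atTop 1, rpow_ev (4/c0) (show -((d:ℝ)/2+ε/2) < -(d:ℝ)/2 by linarith),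
    rpow_ev (2/(c1*c0)) (show -((1/2:ℝ)+d/2)-ε < -((1/2:ℝ)+d/2)-ε/2 by linarith),
    eventually_ge_atTop (s0/c)] with t h1' h2' ht h3 h4 h5
  have ht0 : 0 < t := by linarith
  have hst : √(t^(1+ε)) = t^((1+ε)/2) := sqrt_rpow ht0 _
  have hg := lower_gen (by omega) W z ζ t ⌊t^δ⌋ (s0 := c*t) (s1 := t^(1+ε)) (b := c1 / t^((1+ε)/2)) (by positivity) (by positivity) (by
    intro s hs hs'
    have hsp : 0 < s := lt_of_lt_of_le (by positivity) hs
    refine le_trans ?_ (hf s ?_ _ ?_)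
    · rw [← hst]
      exact div_le_div_of_nonneg_left hc1.le (Real.sqrt_pos.mpr hsp) (Real.sqrt_le_sqrt hs')
    · rw [div_le_iff₀ hc] at h5; linarith
    · have hk0 : (0:ℝ) ≤ (⌊t^δ⌋:ℝ) := by exact_mod_cast Int.floor_nonneg.mpr (by positivity)
      rw [abs_of_nonneg hk0]
      calc (⌊t^δ⌋:ℝ) ≤ t^δ := Int.floor_le _
        _ ≤ t^(1/2:ℝ) := Real.rpow_le_rpow_of_exponent_le ht hδ
        _ = √t := (Real.sqrt_eq_rpow t).symm
        _ = 1/√c * √(c*t) := by rw [Real.sqrt_mul hc.le]; field_simp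
        _ ≤ 1/√c * √s := by gcongr)
  set b := c1 / t^((1+ε)/2) with hb
  have hb0 : 0 < b := by positivity
  set G := {ω | ENNReal.ofReal (c*t) ≤ Az z Y ζ t ω ∧ Y t ω = 0} with hG
  have hGlow : ENNReal.ofReal (c0 * t^(-(d:ℝ)/2)) ≤ ENNReal.ofReal (t^(-((d:ℝ)/2+ε/2))) + P G := by
    have hm : P {ω | Y t ω = 0} ≤ P {ω | Az z Y ζ t ω ≤ ENNReal.ofReal (c*t)} + P G := by
      refine (measure_mono ?_).trans (measure_union_le _ _)
      intro ω hω
      rcases le_total (Az z Y ζ t ω) (ENNReal.ofReal (c*t)) with h | h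
      · exact Or.inl h
      · exact Or.inr ⟨h, hω⟩
    rw [W.marg ht0.le] at hm
    refine (ENNReal.ofReal_le_ofReal (hnear t ht 0 0 (fun i => by simp; positivity))).trans (hm.trans ?_)
    exact add_le_add h1' le_rfl
  have hg2 := hg.trans (add_le_add le_rfl (mul_le_mul_right h2' _))
  have hp1 : pp P z Y ζ t ⌊t^δ⌋ ≠ ⊤ := by
    refine ne_top_of_le_ne_top ENNReal.one_ne_top ?_
    unfold pp
    calc _ ≤ ∫⁻ ω, 1 ∂P := lintegral_mono fun ω => by
          refine (mul_le_mul' (ind_le_one _) (ENNReal.ofReal_le_ofReal (h1_le_one ENNReal.toReal_nonneg _))).trans ?_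
          simp
      _ = 1 := by simp
  rw [← ENNReal.ofReal_toReal (measure_ne_top P G)] at hGlow hg2
  rw [← ENNReal.ofReal_toReal hp1] at hg2 ⊢
  rw [← ENNReal.ofReal_mul hb0.le, ← ENNReal.ofReal_mul hb0.le, ← ENNReal.ofReal_add ENNReal.toReal_nonneg (by positivity),
    ENNReal.ofReal_le_ofReal_iff (by positivity)] at hg2
  rw [← ENNReal.ofReal_add (by positivity) ENNReal.toReal_nonneg, ENNReal.ofReal_le_ofReal_iff (by positivity)] at hGlow
  apply ENNReal.ofReal_le_ofReal
  set p := (pp P z Y ζ t ⌊t^δ⌋).toReal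
  set q := (P G).toReal
  set x := t^(-(d:ℝ)/2) with hx
  set y := t^(-((d:ℝ)/2+ε/2)) with hy
  have a1 : t^(1-(1+ε)*α-(d:ℝ)/2+ε/2) ≤ y := by
    apply Real.rpow_le_rpow_of_exponent_le ht; nlinarith
  have a2 : 4 * y ≤ c0 * x := by
    rw [div_mul_eq_mul_div, div_le_iff₀ hc0] at h3; linarith
  have a3 : b * (c0*x/2) ≤ p := by nlinarith
  refine le_trans ?_ a3
  have a4 : b * (c0*x/2) = c1*c0/2 * t^(-((1/2:ℝ)+d/2)-ε/2) := by
    have : t^(-((1/2:ℝ)+d/2)-ε/2) = (t^((1+ε)/2))⁻¹ * x := by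
      rw [hx, ← Real.rpow_neg ht0.le, ← Real.rpow_add ht0]; congr 1; ring
    rw [this, hb]; ring
  rw [a4]
  rw [div_mul_eq_mul_div, div_le_iff₀ (by positivity)] at h4
  linarith

/-- lower bound, the other case -/
lemma Wk.lower2 (hd : 3 ≤ d) (hα : 0 < α) (W : Wk d P Y) (hz : IsScenery d α μ z) {δ δ0 : ℝ} (hδ0 : 0 ≤ δ) (hδ : δ ≤ δ0) (hm : max (1/α) 1/2 ≤ δ0)
    (hl : δ0 < d/(4*α)) {ε : ℝ} (hε : 0 < ε) :
    ∀ᵐ ζ ∂μ, ∀ᶠ t : ℝ in atTop, ENNReal.ofReal (t^(-(δ0*(1+2*α)-1+d/2:ℝ) - ε)) ≤ pp P z Y ζ t ⌊t^δ⌋ := by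
  have hPr := W.prob
  obtain ⟨c, hc, hnear⟩ := h1_ge_near
  have hγ1 : 1 ≤ max (1/α) 1 := le_max_right _ _
  set e := min (d/(4*α) - δ0) (ε/(4*(2*α+1))) with he
  have he0 : 0 < e := lt_min (by linarith) (by positivity)
  have he1 : (δ0 + e) * (4*α) ≤ d := by
    have : e ≤ d/(4*α) - δ0 := min_le_left _ _
    rw [← le_div_iff₀ (by positivity)]; linarith
  have he2 : e*(2*α+1) ≤ ε/4 := by
    have : e ≤ ε/(4*(2*α+1)) := min_le_right _ _
    rw [le_div_iff₀ (by positivity)] at this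
    linarith
  have he3 : 0 < e * α := by positivity
  set σ := 2*δ0 + e with hσ
  set r := δ0*(1+2*α)-1+(d:ℝ)/2 with hr
  filter_upwards [W.lo hd hα hz (σ := σ) (by linarith) (by rw [hσ]; nlinarith) (ε := e*α/4) (by positivity), 
    W.up hd hα hz (θ := σ+e) (by linarith) (ε := e*α/4) (by positivity)] with ζ h1' h2'
  set X := 1-σ*α-(d:ℝ)/2 with hX
  filter_upwards [h1', h2', eventually_ge_atTop 1, rpow_ev 2 (show X - 3*(e*α)/4 < X - e*α/4 by linarith),
    rpow_ev (2/c) (show -r-ε < -r-ε/2 by linarith), rpow_ev (1/c) (show δ0 < σ/2 by rw [hσ]; linarith)] with t h1' h2' ht h3 h4 h5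
  have ht0 : 0 < t := by linarith
  have hst : √(t^(σ+e)) = t^((σ+e)/2) := sqrt_rpow ht0 _
  have hg := lower_gen (by omega) W z ζ t ⌊t^δ⌋ (s0 := t^σ) (s1 := t^(σ+e)) (b := c / t^((σ+e)/2)) (by positivity) (by positivity) (by
    intro s hs hs'
    have hsp : 0 < s := lt_of_lt_of_le (by positivity) hs
    refine le_trans ?_ (hnear s ?_ _ ?_)
    · rw [← hst]
      exact div_le_div_of_nonneg_left hc.le (Real.sqrt_pos.mpr hsp) (Real.sqrt_le_sqrt hs')
    · exact le_trans (Real.one_le_rpow ht (by linarith)) hs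
    · have hk0 : (0:ℝ) ≤ (⌊t^δ⌋:ℝ) := by exact_mod_cast Int.floor_nonneg.mpr (by positivity)
      rw [abs_of_nonneg hk0]
      calc (⌊t^δ⌋:ℝ) ≤ t^δ := Int.floor_le _
        _ ≤ t^δ0 := Real.rpow_le_rpow_of_exponent_le ht hδ
        _ ≤ c * t^(σ/2) := by rw [div_mul_eq_mul_div, div_le_iff₀ hc] at h5; linarith
        _ = c * √(t^σ) := by rw [sqrt_rpow ht0]
        _ ≤ c * √s := by gcongr)
  set b := c / t^((σ+e)/2) with hb
  have hb0 : 0 < b := by positivity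
  have hg2 := (mul_le_mul_right h1' _).trans (hg.trans (add_le_add le_rfl (mul_le_mul_right h2' _)))
  have hp1 : pp P z Y ζ t ⌊t^δ⌋ ≠ ⊤ := by
    refine ne_top_of_le_ne_top ENNReal.one_ne_top ?_
    unfold pp
    calc _ ≤ ∫⁻ ω, 1 ∂P := lintegral_mono fun ω => by
          refine (mul_le_mul' (ind_le_one _) (ENNReal.ofReal_le_ofReal (h1_le_one ENNReal.toReal_nonneg _))).trans ?_
          simp
      _ = 1 := by simp
  rw [← ENNReal.ofReal_toReal hp1] at hg2 ⊢
  rw [← ENNReal.ofReal_mul hb0.le, ← ENNReal.ofReal_mul hb0.le, ← ENNReal.ofReal_add ENNReal.toReal_nonneg (by positivity),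
    ENNReal.ofReal_le_ofReal_iff (by positivity)] at hg2
  apply ENNReal.ofReal_le_ofReal
  set p := (pp P z Y ζ t ⌊t^δ⌋).toReal
  have a1 : t^(1-(σ+e)*α-(d:ℝ)/2+e*α/4) = t^(X - 3*(e*α)/4) := by
    congr 1; rw [hX]; ring
  rw [a1] at hg2
  have a3 : b * (t^(X-e*α/4)/2) ≤ p := by nlinarith
  refine le_trans ?_ a3
  have a4 : b * (t^(X-e*α/4)/2) = c/2 * t^(-((σ+e)/2) + (X-e*α/4)) := by
    rw [hb, Real.rpow_add ht0, Real.rpow_neg ht0.le]; ring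
  rw [a4]
  have a5 : t^(-r-ε/2) ≤ t^(-((σ+e)/2) + (X-e*α/4)) := by
    apply Real.rpow_le_rpow_of_exponent_le ht
    rw [hX, hσ, hr]; nlinarith
  rw [div_mul_eq_mul_div, div_le_iff₀ hc] at h4
  nlinarith

lemma log_lim {f : ℝ → ℝ} {r : ℝ} (hf : ∀ j : ℕ, ∀ᶠ t : ℝ in atTop, t^(-r-1/((j:ℝ)+1)) ≤ f t ∧ f t ≤ t^(-r+1/((j:ℝ)+1))) :
    Tendsto (fun t => Real.log (f t) / Real.log t) atTop (nhds (-r)) := by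
  rw [Metric.tendsto_nhds]
  intro ε hε
  obtain ⟨j, hj⟩ := exists_nat_one_div_lt hε
  filter_upwards [hf j, eventually_gt_atTop 1] with t h ht
  have ht0 : 0 < t := by linarith
  have hl : 0 < Real.log t := Real.log_pos ht
  have h0 : 0 < t^(-r-1/((j:ℝ)+1)) := by positivity
  have g1 := Real.log_le_log h0 h.1
  have g2 := Real.log_le_log (h0.trans_le h.1) h.2
  rw [Real.log_rpow ht0] at g1 g2
  rw [Real.dist_eq, abs_lt]
  have k1 := (le_div_iff₀ hl).mpr g1
  have k2 := (div_le_iff₀ hl).mpr g2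
  constructor <;> linarith

end
end LRC

/-- Theorem (power-law moderate deviation regime): for `d ≥ 3`, `α < d/2` and
`δ ∈ [0, d/(4α))`, ℙ-a.s. `P₀^ω(X_t = (⌊t^δ⌋, 0)) = t^{-r(d,α,δ)+o(1)}` as `t → ∞`. -/
theorem stmt10 (d : ℕ) (hd : 3 ≤ d) (α δ : ℝ) (hα : 0 < α) (hαd : α < d / 2)
    (hδ₀ : 0 ≤ δ) (hδ₁ : δ < d / (4 * α))
    {Ωz Ωw : Type*} [MeasurableSpace Ωz] [MeasurableSpace Ωw]
    (μ : Measure Ωz) (z : (Fin d → ℤ) → Ωz → ℝ) (hz : IsScenery d α μ z)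
    (P : (Fin (d + 1) → ℤ) → Measure Ωw) (S : ℝ → Ωw → (Fin (d + 1) → ℤ))
    (hS : IsCTSRW (d + 1) P S) :
    ∀ᵐ ζ ∂ μ, Tendsto
      (fun t : ℝ => Real.log
          ((P 0) {ω | layeredWalk d z S t ζ ω = ((⌊t ^ δ⌋ : ℤ), 0)}).toReal / Real.log t)
      atTop (nhds (-(rExp d α δ))) := by
  have hd0 : 0 < d := by omega
  have W := LRC.wk_of hd0 hS
  have hmax : max (1/(2*α)) (1/2) = max (1/α) 1/2 := by
    have e0 : 1/(2*α) = 1/α/2 := by field_simp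
    rw [e0, max_div_div_right (by norm_num : (0:ℝ) ≤ 2)]
  have hd3 : (3:ℝ) ≤ d := by exact_mod_cast hd
  have hup : ∀ ε : ℝ, 0 < ε → ∀ᵐ ζ ∂μ, ∀ᶠ t : ℝ in atTop,
      LRC.pp (P 0) z (LRC.tlp d S) ζ t ⌊t^δ⌋ ≤ ENNReal.ofReal (t^(-(rExp d α δ) + ε)) := by
    intro ε hε
    unfold rExp
    split_ifs with h
    · rw [hmax]; exact W.upper1 hd hα hz (fun t => ⌊t^δ⌋) hε
    · rw [hmax, not_le] at h
      exact W.upper2 hd hα hz h hε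
  have hlo : ∀ ε : ℝ, 0 < ε → ∀ᵐ ζ ∂μ, ∀ᶠ t : ℝ in atTop,
      ENNReal.ofReal (t^(-(rExp d α δ) - ε)) ≤ LRC.pp (P 0) z (LRC.tlp d S) ζ t ⌊t^δ⌋ := by
    intro ε hε
    unfold rExp
    split_ifs with h
    · by_cases hα1 : 1 ≤ α
      · have hm : max (1/(2*α)) (1/2) = 1/2 := by
          apply max_eq_right
          exact one_div_le_one_div_of_le (by norm_num) (by linarith)
        rw [hm] at h ⊢
        exact W.lower1 hd hα1 hz hδ₀ h (fun C hC => LRC.h1_ge_far hd0 hS C hC) hε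
      · have hm : max (1/(2*α)) (1/2) = 1/(2*α) := by
          apply max_eq_left
          exact one_div_le_one_div_of_le (by positivity) (by linarith)
        rw [hm] at h hmax ⊢
        have hl : 1/(2*α) < (d:ℝ)/(4*α) := by
          rw [div_lt_div_iff₀ (by positivity) (by positivity)]; nlinarith
        have := W.lower2 hd hα hz hδ₀ h hmax.symm.le hl hε
        have e1 : 1/(2*α)*(1+2*α)-1+(d:ℝ)/2 = 1/(2*α) + d/2 := by field_simp; ring
        rw [e1] at this
        exact this
    · rw [hmax, not_le] at h
      exact W.lower2 hd hα hz hδ₀ le_rfl h.le hδ₁ hε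
  have hall := (ae_all_iff.mpr fun j : ℕ => hup (1/((j:ℝ)+1)) (by positivity)).and
    (ae_all_iff.mpr fun j : ℕ => hlo (1/((j:ℝ)+1)) (by positivity))
  filter_upwards [hall] with ζ hζ
  apply LRC.log_lim
  intro j
  filter_upwards [hζ.1 j, hζ.2 j, eventually_ge_atTop 1] with t h1 h2 ht
  have ht0 : 0 < t := by linarith
  have hrep : P 0 {ω | layeredWalk d z S t ζ ω = ((⌊t ^ δ⌋ : ℤ), 0)} = LRC.pp (P 0) z (LRC.tlp d S) ζ t ⌊t^δ⌋ :=
    LRC.repr_formula hd0 z hz.nonneg hS ht0.le ζ _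
  rw [hrep]
  exact ⟨(ENNReal.ofReal_le_iff_le_toReal (ne_top_of_le_ne_top ENNReal.ofReal_ne_top h1)).mp h2,
    ENNReal.toReal_le_of_le_ofReal (by positivity) h1⟩
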